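/- arXiv:0911.0668 — 5 statements merged into one kernel-verified Lean document; each statement's English description precedes it below -/
import Mathlib

section
/- Let A > 0 and θ > 0, and let u : D → ℂⁿ be a C¹ map such that u(x+iy) = 0 whenever x ≥ −A·y², and ‖∂u/∂z̄(z)‖ ≤ θ·‖u(z)‖^{1/2}·‖∂u/∂z(z)‖ for all z ∈ D. Then u ≡ 0 on some neighborhood of 0 in D. -/
open Complex MeasureTheory Metric Filter Asymptotics Topology

/-- The Wirtinger derivative `∂u/∂z̄ = (1/2)(∂u/∂x + i • ∂u/∂y)`. -/
noncomputable def dbar {E : Type*} [NormedAddCommGroup E] [NormedSpace ℂ E]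
    (u : ℂ → E) (z : ℂ) : E :=
  (2⁻¹ : ℝ) • (fderiv ℝ u z 1 + Complex.I • fderiv ℝ u z Complex.I)

/-- The Wirtinger derivative `∂u/∂z = (1/2)(∂u/∂x - i • ∂u/∂y)`. -/
noncomputable def dz {E : Type*} [NormedAddCommGroup E] [NormedSpace ℂ E]
    (u : ℂ → E) (z : ℂ) : E :=
  (2⁻¹ : ℝ) • (fderiv ℝ u z 1 - Complex.I • fderiv ℝ u z Complex.I)

section helpers
variable {E : Type*} [NormedAddCommGroup E] [InnerProductSpace ℂ E]

noncomputable local instance instRealInner : InnerProductSpace ℝ E := InnerProductSpace.complexToReal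

lemma rinner_eq (x y : E) : inner ℝ x y = (inner ℂ x y).re := rfl

noncomputable def rB : E →L[ℝ] E →L[ℝ] ℝ := innerSL ℝ

lemma rB_apply (x y : E) : rB x y = inner ℝ x y := rfl

lemma rinner_I_antisymm (x y : E) :
    inner ℝ x (Complex.I • y) = - inner ℝ y (Complex.I • x) := by
  rw [rinner_eq, rinner_eq, inner_smul_right, inner_smul_right, ← inner_conj_symm x y]
  simp [-inner_conj_symm]

lemma cont_fderiv {w : ℂ → E} (hw : ContDiff ℝ 1 w) (e : ℂ) :
    Continuous (fun z => fderiv ℝ w z e) :=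
  (hw.continuous_fderiv (by norm_num)).clm_apply continuous_const

lemma cs_fderiv {w : ℂ → E} (hs : HasCompactSupport w) (e : ℂ) :
    HasCompactSupport (fun z => fderiv ℝ w z e) :=
  (hs.fderiv ℝ).comp_left (g := fun L : ℂ →L[ℝ] E => L e) (by simp)

lemma null_lagrangian {w : ℂ → E} (hw : ContDiff ℝ 1 w) (hs : HasCompactSupport w) :
    ∫ z, (inner ℝ (fderiv ℝ w z 1) (Complex.I • fderiv ℝ w z Complex.I) : ℝ) = 0 := by
  have c0 := hw.continuous
  have c1 := cont_fderiv hw 1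
  have c2 := cont_fderiv hw Complex.I
  have s1 := cs_fderiv hs 1
  have s2 := cs_fderiv hs Complex.I
  have hd : Differentiable ℝ w := hw.differentiable (by norm_num)
  set F : ℝ → ℝ := fun h => ∫ z, (inner ℝ (fderiv ℝ w z 1) (Complex.I • w (z + h * Complex.I)) : ℝ)
    with hF
  obtain ⟨M, hM⟩ := s2.exists_bound_of_continuous c2
  have key : HasDerivAt F (∫ z, (inner ℝ (fderiv ℝ w z 1)
      (Complex.I • fderiv ℝ w z Complex.I) : ℝ)) 0 := by
    have := (hasDerivAt_integral_of_dominated_loc_of_deriv_le (𝕜 := ℝ) (μ := (volume : Measure ℂ))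
      (F := fun (h : ℝ) (z : ℂ) =>
        (inner ℝ (fderiv ℝ w z 1) (Complex.I • w (z + h * Complex.I)) : ℝ))
      (F' := fun (h : ℝ) (z : ℂ) =>
        (inner ℝ (fderiv ℝ w z 1) (Complex.I • fderiv ℝ w (z + h * Complex.I) Complex.I) : ℝ))
      (x₀ := 0) (s := Set.univ) (bound := fun z => ‖fderiv ℝ w z 1‖ * M)
      Filter.univ_mem ?_ ?_ ?_ ?_ ?_ ?_).2
    · simpa using this
    · exact Eventually.of_forall fun h => (by fun_prop : Continuous _).aestronglyMeasurable
    · apply Continuous.integrable_of_hasCompactSupport (by fun_prop)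
      exact s1.mono (fun z hz => by
        contrapose! hz
        simp only [Function.mem_support, not_not] at hz ⊢
        simp [hz])
    · exact (by fun_prop : Continuous _).aestronglyMeasurable
    · refine Eventually.of_forall fun z h _ => ?_
      refine (norm_inner_le_norm _ _).trans ?_
      rw [norm_smul]
      simp only [Complex.norm_I, one_mul]
      gcongr
      exact hM _
    · apply Continuous.integrable_of_hasCompactSupport (by fun_prop)
      exact s1.norm.mul_right
    · refine Eventually.of_forall fun z h _ => ?_
      have h1 : HasDerivAt (fun h : ℝ => z + h * Complex.I) Complex.I h := by
        simpa using ((Complex.ofRealCLM.hasDerivAt (x := h)).mul_const Complex.I).const_add z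
      have h2 := (hd (z + h * Complex.I)).hasFDerivAt.comp_hasDerivAt h h1
      have h3 := (h2.const_smul Complex.I)
      simpa using (HasDerivAt.inner ℝ (hasDerivAt_const h (fderiv ℝ w z 1)) h3)
  have even : ∀ h, F (-h) = F h := by
    intro h
    have e1 : F h = - ∫ z, (inner ℝ (w z) (Complex.I • fderiv ℝ w (z + h * Complex.I) 1) : ℝ) := by
      have hg : ∀ z, HasFDerivAt (fun z => Complex.I • w (z + h * Complex.I))
          (Complex.I • fderiv ℝ w (z + h * Complex.I)) z := by
        intro z
        have := (hd (z + h * Complex.I)).hasFDerivAt.comp z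
          ((hasFDerivAt_id (𝕜 := ℝ) z).add_const (h * Complex.I))
        exact this.const_smul Complex.I
      have := integral_bilinear_hasFDerivAt_right_eq_neg_left_of_integrable
        (μ := (volume : Measure ℂ)) (f := w) (f' := fderiv ℝ w) (v := 1)
        (g := fun z => Complex.I • w (z + h * Complex.I))
        (g' := fun z => Complex.I • fderiv ℝ w (z + h * Complex.I)) (B := rB)
        ?_ ?_ ?_ (fun z _ => (hd z).hasFDerivAt) (fun z _ => hg z)
      · simp only [rB_apply] at this
        rw [hF]
        simp only
        rw [eq_neg_iff_add_eq_zero, add_comm, ← eq_neg_iff_add_eq_zero]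
        exact this
      · simp only [rB_apply]
        apply Continuous.integrable_of_hasCompactSupport (by fun_prop)
        exact s1.mono (fun z hz => by
          contrapose! hz
          simp only [Function.mem_support, not_not] at hz ⊢
          simp [hz])
      · simp only [rB_apply]
        apply Continuous.integrable_of_hasCompactSupport
        · apply Continuous.inner c0
          exact (c1.comp (by fun_prop : Continuous fun z : ℂ => z + h * Complex.I)).const_smul Complex.I
        exact hs.mono (fun z hz => by
          contrapose! hz
          simp only [Function.mem_support, not_not] at hz ⊢
          simp [hz])
      · simp only [rB_apply]
        apply Continuous.integrable_of_hasCompactSupport (by fun_prop)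
        exact hs.mono (fun z hz => by
          contrapose! hz
          simp only [Function.mem_support, not_not] at hz ⊢
          simp [hz])
    rw [e1, ← integral_neg]
    have : ∀ z, - (inner ℝ (w z) (Complex.I • fderiv ℝ w (z + h * Complex.I) 1) : ℝ)
      = (fun z' => (inner ℝ (fderiv ℝ w z' 1)
        (Complex.I • w (z' + ((-h : ℝ) : ℂ) * Complex.I)) : ℝ)) (z + h * Complex.I) := by
      intro z
      simp only
      rw [rinner_I_antisymm, neg_neg]
      congr 3
      push_cast; ring
    rw [integral_congr_ae (Eventually.of_forall this)]
    exact (integral_add_right_eq_self (μ := (volume : Measure ℂ)) (fun z' => (inner ℝ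
      (fderiv ℝ w z' 1) (Complex.I • w (z' + ((-h : ℝ) : ℂ) * Complex.I)) : ℝ)) _).symm
  have k2 : HasDerivAt F (-(∫ z, (inner ℝ (fderiv ℝ w z 1)
      (Complex.I • fderiv ℝ w z Complex.I) : ℝ))) 0 := by
    have h0 : HasDerivAt F (∫ z, (inner ℝ (fderiv ℝ w z 1)
      (Complex.I • fderiv ℝ w z Complex.I) : ℝ)) (-(0:ℝ)) := by simpa using key
    have := HasDerivAt.scomp (0:ℝ) h0 (hasDerivAt_neg (0:ℝ))
    have e : F ∘ Neg.neg = F := funext even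
    rw [e] at this
    simpa using this
  have := key.unique k2
  linarith

lemma carleman_id {w : ℂ → E} (hw : ContDiff ℝ 1 w) (hs : HasCompactSupport w) (τ r : ℝ) :
    ∫ z, ‖dbar w z - (τ * (z.re + r) / 2) • w z‖ ^ 2
      = (∫ z, ‖dz w z + (τ * (z.re + r) / 2) • w z‖ ^ 2) + τ / 2 * ∫ z, ‖w z‖ ^ 2 := by
  have c0 := hw.continuous
  have c1 := cont_fderiv hw 1
  have c2 := cont_fderiv hw Complex.I
  have s1 := cs_fderiv hs 1
  have s2 := cs_fderiv hs Complex.I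
  have hd : Differentiable ℝ w := hw.differentiable (by norm_num)
  have cre := Complex.continuous_re
  have pt : ∀ z, ‖dbar w z - (τ * (z.re + r) / 2) • w z‖ ^ 2
      = ‖dz w z + (τ * (z.re + r) / 2) • w z‖ ^ 2
        + ((inner ℝ (fderiv ℝ w z 1) (Complex.I • fderiv ℝ w z Complex.I) : ℝ)
        - (τ * (z.re + r)) * inner ℝ (fderiv ℝ w z 1) (w z)) := by
    intro z
    unfold dbar dz
    generalize fderiv ℝ w z 1 = p
    generalize Complex.I • fderiv ℝ w z Complex.I = q
    generalize w z = b
    generalize τ * (z.re + r) = a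
    simp only [← real_inner_self_eq_norm_sq, inner_add_left, inner_add_right, inner_sub_left,
      inner_sub_right, real_inner_smul_left, real_inner_smul_right]
    rw [real_inner_comm p q, real_inner_comm p b, real_inner_comm q b]
    ring
  have i1 : Integrable (fun z => ‖dz w z + (τ * (z.re + r) / 2) • w z‖ ^ 2) := by
    apply Continuous.integrable_of_hasCompactSupport
    · unfold dz; fun_prop
    · have : HasCompactSupport (fun z => dz w z + (τ * (z.re + r) / 2) • w z) := by
        apply HasCompactSupport.add
        · exact (s1.sub (s2.comp_left (g := fun x => Complex.I • x) (by simp))).comp_left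
            (g := fun x => (2⁻¹ : ℝ) • x) (by simp)
        · exact hs.smul_left
      exact this.comp_left (g := fun x => ‖x‖ ^ 2) (by simp)
  have i2 : Integrable (fun z => (inner ℝ (fderiv ℝ w z 1)
      (Complex.I • fderiv ℝ w z Complex.I) : ℝ)) := by
    apply Continuous.integrable_of_hasCompactSupport (by fun_prop)
    exact s1.mono (fun z hz => by
        contrapose! hz
        simp only [Function.mem_support, not_not] at hz ⊢
        simp [hz])
  have i3 : Integrable (fun z => (τ * (z.re + r)) * (inner ℝ (fderiv ℝ w z 1) (w z) : ℝ)) := by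
    apply Continuous.integrable_of_hasCompactSupport (by fun_prop)
    exact hs.mono (fun z hz => by
        contrapose! hz
        simp only [Function.mem_support, not_not] at hz ⊢
        simp [hz])
  have i4 : Integrable (fun z => ‖w z‖ ^ 2) := by
    apply Continuous.integrable_of_hasCompactSupport (by fun_prop)
    exact hs.comp_left (g := fun x => ‖x‖ ^ 2) (by simp)
  have parts : ∫ z, (τ * (z.re + r)) * (inner ℝ (fderiv ℝ w z 1) (w z) : ℝ)
      = - (τ / 2 * ∫ z, ‖w z‖ ^ 2) := by
    have hg : ∀ z : ℂ, HasFDerivAt (fun z : ℂ => (τ * (z.re + r)) • w z)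
        ((τ * (z.re + r)) • fderiv ℝ w z + (τ • Complex.reCLM).smulRight (w z)) z := by
      intro z
      have h1 : HasFDerivAt (fun z : ℂ => τ * (z.re + r)) (τ • Complex.reCLM) z := 
        ((Complex.reCLM.hasFDerivAt (x := z)).add_const r).const_mul τ
      exact h1.smul (hd z).hasFDerivAt
    have := integral_bilinear_hasFDerivAt_right_eq_neg_left_of_integrable
        (μ := (volume : Measure ℂ)) (f := w) (f' := fderiv ℝ w) (v := 1)
        (g := fun z : ℂ => (τ * (z.re + r)) • w z)
        (g' := fun z => ((τ * (z.re + r)) • fderiv ℝ w z + (τ • Complex.reCLM).smulRight (w z)))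
        (B := rB)
        ?_ ?_ ?_ (fun z _ => (hd z).hasFDerivAt) (fun z _ => hg z)
    · have e1 : ∀ z : ℂ, rB (w z) ((((τ * (z.re + r)) • fderiv ℝ w z +
          (τ • Complex.reCLM).smulRight (w z))) 1)
          = (τ * (z.re + r)) * (inner ℝ (fderiv ℝ w z 1) (w z) : ℝ) + τ * ‖w z‖ ^ 2 := by
        intro z
        simp [rB_apply, inner_add_right, real_inner_smul_right, real_inner_comm]
      have e2 : ∀ z : ℂ, rB (fderiv ℝ w z 1) ((τ * (z.re + r)) • w z)
          = (τ * (z.re + r)) * (inner ℝ (fderiv ℝ w z 1) (w z) : ℝ) := by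
        intro z
        simp [rB_apply, real_inner_smul_right]
      simp_rw [e1, e2] at this
      rw [integral_add i3 (i4.const_mul τ), integral_const_mul τ] at this
      linarith
    · simp only [rB_apply, real_inner_smul_right]
      exact i3
    · simp only [rB_apply]
      have e1 : ∀ z : ℂ, inner ℝ (w z) ((((τ * (z.re + r)) • fderiv ℝ w z +
          (τ • Complex.reCLM).smulRight (w z))) 1)
          = (τ * (z.re + r)) * (inner ℝ (fderiv ℝ w z 1) (w z) : ℝ) + τ * ‖w z‖ ^ 2 := by
        intro z
        simp [rB_apply, inner_add_right, real_inner_smul_right, real_inner_comm]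
      simp_rw [e1]
      exact i3.add (i4.const_mul τ)
    · simp only [rB_apply, real_inner_smul_right, real_inner_self_eq_norm_sq]
      apply Continuous.integrable_of_hasCompactSupport (by fun_prop)
      exact HasCompactSupport.mul_left (hs.comp_left (g := fun x => ‖x‖ ^ 2) (by simp))
  simp_rw [pt]
  have i23 : Integrable (fun z => (inner ℝ (fderiv ℝ w z 1)
      (Complex.I • fderiv ℝ w z Complex.I) : ℝ) -
      (τ * (z.re + r)) * (inner ℝ (fderiv ℝ w z 1) (w z) : ℝ)) := i2.sub i3
  rw [integral_add i1 i23, integral_sub i2 i3, null_lagrangian hw hs, parts]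
  ring

lemma fderiv_smul_re {f : ℂ → ℝ} {v : ℂ → E} {z : ℂ} {c : ℝ}
    (hf : HasFDerivAt f (c • Complex.reCLM) z) (hv : DifferentiableAt ℝ v z) :
    fderiv ℝ (fun z => f z • v z) z 1 = f z • fderiv ℝ v z 1 + c • v z ∧
    fderiv ℝ (fun z => f z • v z) z Complex.I = f z • fderiv ℝ v z Complex.I := by
  have := (hf.smul hv.hasFDerivAt).fderiv
  constructor
  · rw [show (fun z => f z • v z) = f • v from rfl, this]; simp
  · rw [show (fun z => f z • v z) = f • v from rfl, this]; simp

lemma dbar_smul_re {f : ℂ → ℝ} {v : ℂ → E} {z : ℂ} {c : ℝ}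
    (hf : HasFDerivAt f (c • Complex.reCLM) z) (hv : DifferentiableAt ℝ v z) :
    dbar (fun z => f z • v z) z = f z • dbar v z + (c / 2) • v z := by
  unfold dbar
  rw [(fderiv_smul_re hf hv).1, (fderiv_smul_re hf hv).2, smul_comm Complex.I (f z)]
  module

lemma dz_smul_re {f : ℂ → ℝ} {v : ℂ → E} {z : ℂ} {c : ℝ}
    (hf : HasFDerivAt f (c • Complex.reCLM) z) (hv : DifferentiableAt ℝ v z) :
    dz (fun z => f z • v z) z = f z • dz v z + (c / 2) • v z := by
  unfold dz
  rw [(fderiv_smul_re hf hv).1, (fderiv_smul_re hf hv).2, smul_comm Complex.I (f z)]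
  module

lemma cont_dbar {w : ℂ → E} (hw : ContDiff ℝ 1 w) : Continuous (dbar w) := by
  have c1 := cont_fderiv hw 1
  have c2 := cont_fderiv hw Complex.I
  unfold dbar; fun_prop

lemma cont_dz {w : ℂ → E} (hw : ContDiff ℝ 1 w) : Continuous (dz w) := by
  have c1 := cont_fderiv hw 1
  have c2 := cont_fderiv hw Complex.I
  unfold dz; fun_prop

lemma cs_dbar {w : ℂ → E} (hs : HasCompactSupport w) : HasCompactSupport (dbar w) :=
  ((cs_fderiv hs 1).add ((cs_fderiv hs Complex.I).comp_left (g := fun x => Complex.I • x)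
    (by simp))).comp_left (g := fun x => (2⁻¹ : ℝ) • x) (by simp)

lemma cs_dz {w : ℂ → E} (hs : HasCompactSupport w) : HasCompactSupport (dz w) :=
  ((cs_fderiv hs 1).sub ((cs_fderiv hs Complex.I).comp_left (g := fun x => Complex.I • x)
    (by simp))).comp_left (g := fun x => (2⁻¹ : ℝ) • x) (by simp)

lemma int_weight {w : ℂ → E} (hw : Continuous w) (hs : HasCompactSupport w) (τ r : ℝ) :
    Integrable (fun z : ℂ => Real.exp (τ * (z.re + r) ^ 2) * ‖w z‖ ^ 2) := by
  have cre := Complex.continuous_re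
  apply Continuous.integrable_of_hasCompactSupport (by fun_prop)
  exact HasCompactSupport.mul_left (hs.comp_left (g := fun x => ‖x‖ ^ 2) (by simp))

lemma carleman {v : ℂ → E} (hv : ContDiff ℝ 1 v) (hs : HasCompactSupport v) {τ R : ℝ}
    (hτ : 0 < τ) (hsupp : ∀ z : ℂ, v z ≠ 0 → |z.re + 2 * R| ≤ 2 * R) :
    τ / 2 * (∫ z : ℂ, Real.exp (τ * (z.re + 2 * R) ^ 2) * ‖v z‖ ^ 2)
      ≤ ∫ z : ℂ, Real.exp (τ * (z.re + 2 * R) ^ 2) * ‖dbar v z‖ ^ 2 ∧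
    (∫ z : ℂ, Real.exp (τ * (z.re + 2 * R) ^ 2) * ‖dz v z‖ ^ 2)
      ≤ (2 + 16 * R ^ 2 * τ) * ∫ z : ℂ, Real.exp (τ * (z.re + 2 * R) ^ 2) * ‖dbar v z‖ ^ 2 := by
  have cre := Complex.continuous_re
  have hd : Differentiable ℝ v := hv.differentiable (by norm_num)
  set g : ℂ → ℝ := fun z => Real.exp (τ / 2 * (z.re + 2 * R) ^ 2) with hg
  have hgc : ContDiff ℝ 1 g := by
    have : ContDiff ℝ 1 (fun z : ℂ => z.re) := Complex.reCLM.contDiff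
    fun_prop
  have hg' : ∀ z, HasFDerivAt g ((g z * (τ * (z.re + 2 * R))) • Complex.reCLM) z := by
    intro z
    have h1 := (((Complex.reCLM.hasFDerivAt (x := z)).add_const (2 * R)).pow 2).const_mul (τ / 2)
    have h2 := h1.exp
    refine HasFDerivAt.congr_fderiv h2 ?_
    ext y
    simp [hg]
    all_goals ring
  have hgsq : ∀ z : ℂ, g z ^ 2 = Real.exp (τ * (z.re + 2 * R) ^ 2) := by
    intro z
    rw [hg]; simp only
    rw [← Real.exp_nat_mul]; congr 1; push_cast; ring
  have hgpos : ∀ z, 0 < g z := fun z => Real.exp_pos _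
  set w : ℂ → E := fun z => g z • v z with hw
  have hwc : ContDiff ℝ 1 w := hgc.smul hv
  have hws : HasCompactSupport w := hs.smul_left
  have id := carleman_id hwc hws τ (2 * R)
  have e1 : ∀ z : ℂ, ‖dbar w z - (τ * (z.re + 2 * R) / 2) • w z‖ ^ 2
      = Real.exp (τ * (z.re + 2 * R) ^ 2) * ‖dbar v z‖ ^ 2 := by
    intro z
    rw [dbar_smul_re (hg' z) (hd z), ← hgsq, ← mul_pow, ← abs_of_pos (hgpos z), ← Real.norm_eq_abs,
      ← norm_smul, Real.norm_eq_abs, abs_of_pos (hgpos z)]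
    congr 2
    simp only [hw]
    module
  have e2 : ∀ z : ℂ, ‖dz w z + (τ * (z.re + 2 * R) / 2) • w z‖ ^ 2
      = Real.exp (τ * (z.re + 2 * R) ^ 2) * ‖dz v z + (τ * (z.re + 2 * R)) • v z‖ ^ 2 := by
    intro z
    rw [dz_smul_re (hg' z) (hd z), ← hgsq, ← mul_pow, ← abs_of_pos (hgpos z), ← Real.norm_eq_abs,
      ← norm_smul, Real.norm_eq_abs, abs_of_pos (hgpos z)]
    congr 2
    simp only [hw]
    module
  have e3 : ∀ z : ℂ, ‖w z‖ ^ 2 = Real.exp (τ * (z.re + 2 * R) ^ 2) * ‖v z‖ ^ 2 := by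
    intro z
    simp only [hw]
    rw [norm_smul, mul_pow, Real.norm_eq_abs, abs_of_pos (hgpos z), hgsq]
  simp_rw [e1, e2, e3] at id
  have i1 := int_weight hv.continuous hs τ (2 * R)
  have i2 := int_weight (cont_dz hv) (cs_dz hs) τ (2 * R)
  have i3 := int_weight (w := fun z => dz v z + (τ * (z.re + 2 * R)) • v z)
    (by have := cont_dz hv; have := hv.continuous; fun_prop)
    ((cs_dz hs).add hs.smul_left) τ (2 * R)
  have n3 : 0 ≤ ∫ z : ℂ, Real.exp (τ * (z.re + 2 * R) ^ 2) *
      ‖dz v z + (τ * (z.re + 2 * R)) • v z‖ ^ 2 := integral_nonneg fun z => by positivity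
  have n1 : 0 ≤ ∫ z : ℂ, Real.exp (τ * (z.re + 2 * R) ^ 2) * ‖v z‖ ^ 2 :=
    integral_nonneg fun z => by positivity
  refine ⟨by linarith, ?_⟩
  have le : (∫ z : ℂ, Real.exp (τ * (z.re + 2 * R) ^ 2) * ‖dz v z‖ ^ 2)
      ≤ ∫ z : ℂ, (2 * (Real.exp (τ * (z.re + 2 * R) ^ 2) *
      ‖dz v z + (τ * (z.re + 2 * R)) • v z‖ ^ 2) + (8 * R ^ 2 * τ ^ 2) *
      (Real.exp (τ * (z.re + 2 * R) ^ 2) * ‖v z‖ ^ 2)) := by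
    apply integral_mono i2 ((i3.const_mul 2).add (i1.const_mul (8 * R ^ 2 * τ ^ 2)))
    intro z
    simp only [Pi.add_apply]
    have h1 : ‖dz v z‖ ≤ ‖dz v z + (τ * (z.re + 2 * R)) • v z‖ + (2 * |R| * τ) * ‖v z‖ := by
      have : dz v z = (dz v z + (τ * (z.re + 2 * R)) • v z) - (τ * (z.re + 2 * R)) • v z := by
        module
      calc ‖dz v z‖ = ‖(dz v z + (τ * (z.re + 2 * R)) • v z) - (τ * (z.re + 2 * R)) • v z‖ := by
            rw [← this]
        _ ≤ _ := norm_sub_le _ _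
        _ ≤ _ := by
          gcongr
          rw [norm_smul, Real.norm_eq_abs, abs_mul, abs_of_pos hτ]
          by_cases hvz : v z = 0
          · simp [hvz]
          · have := hsupp z hvz
            have h2 : 2 * R ≤ 2 * |R| := by linarith [le_abs_self R]
            refine mul_le_mul_of_nonneg_right ?_ (norm_nonneg _)
            nlinarith
    have h2 : ‖dz v z‖ ^ 2 ≤ 2 * ‖dz v z + (τ * (z.re + 2 * R)) • v z‖ ^ 2
        + (8 * R ^ 2 * τ ^ 2) * ‖v z‖ ^ 2 := by
      have h3 : ‖dz v z‖ ^ 2 ≤ (‖dz v z + (τ * (z.re + 2 * R)) • v z‖ + (2 * |R| * τ) * ‖v z‖) ^ 2 := by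
        gcongr
      have h4 : ((2 * |R| * τ) * ‖v z‖) ^ 2 = 4 * R ^ 2 * τ ^ 2 * ‖v z‖ ^ 2 := by
        rw [mul_pow, mul_pow, mul_pow, sq_abs]; norm_num
      nlinarith [sq_nonneg (‖dz v z + (τ * (z.re + 2 * R)) • v z‖ - (2 * |R| * τ) * ‖v z‖)]
    have := mul_le_mul_of_nonneg_left h2 (Real.exp_pos (τ * (z.re + 2 * R) ^ 2)).le
    linarith
  rw [integral_add (i3.const_mul 2) (i1.const_mul _), integral_const_mul, integral_const_mul] at le
  set a1 := ∫ z : ℂ, Real.exp (τ * (z.re + 2 * R) ^ 2) * ‖v z‖ ^ 2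
  set a3 := ∫ z : ℂ, Real.exp (τ * (z.re + 2 * R) ^ 2) *
      ‖dz v z + (τ * (z.re + 2 * R)) • v z‖ ^ 2
  rw [id]
  have : 0 ≤ 16 * R ^ 2 * τ * a3 := by positivity
  have : 0 ≤ τ * a1 := by positivity
  nlinarith

lemma exists_cutoff : ∃ (χ : ℝ → ℝ) (C : ℝ), 0 < C ∧ ContDiff ℝ 1 χ ∧ (∀ t, 0 ≤ χ t) ∧
    (∀ t, χ t ≤ 1) ∧ (∀ t ≤ 0, χ t = 0) ∧ (∀ t, 1 ≤ t → χ t = 1) ∧ (∀ t, |deriv χ t| ≤ C) ∧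
    (∀ t, 1 < t → deriv χ t = 0) := by
  have hc : ContDiff ℝ 1 Real.smoothTransition := Real.smoothTransition.contDiff
  have h1 : ∀ t, 1 < t → deriv Real.smoothTransition t = 0 := by
    intro t ht
    have : Real.smoothTransition =ᶠ[𝓝 t] fun _ => 1 := by
      filter_upwards [lt_mem_nhds ht] with s hs
      exact Real.smoothTransition.one_of_one_le hs.le
    rw [this.deriv_eq]; simp
  have h0 : ∀ t < 0, deriv Real.smoothTransition t = 0 := by
    intro t ht
    have : Real.smoothTransition =ᶠ[𝓝 t] fun _ => 0 := by
      filter_upwards [gt_mem_nhds ht] with s hs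
      exact Real.smoothTransition.zero_of_nonpos hs.le
    rw [this.deriv_eq]; simp
  have hcd : Continuous (deriv Real.smoothTransition) := hc.continuous_deriv (by norm_num)
  obtain ⟨C, hC⟩ := (isCompact_Icc (a := (0:ℝ)) (b := 1)).exists_bound_of_continuousOn
    hcd.continuousOn
  refine ⟨Real.smoothTransition, |C| + 1, by positivity, hc, Real.smoothTransition.nonneg,
    Real.smoothTransition.le_one, fun t ht => Real.smoothTransition.zero_of_nonpos ht,
    fun t ht => Real.smoothTransition.one_of_one_le ht, ?_, h1⟩
  intro t
  rcases lt_or_ge t 0 with h | h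
  · rw [h0 t h]; simp; positivity
  rcases lt_or_ge 1 t with h' | h'
  · rw [h1 t h']; simp; positivity
  have := hC t ⟨h, h'⟩
  rw [Real.norm_eq_abs] at this
  linarith [le_abs_self C]


lemma vol_ball (z : ℂ) {r : ℝ} (hr : 0 ≤ r) : volume.real (ball z r) = r ^ 2 * Real.pi := by
  rw [Measure.real, Complex.volume_ball, ENNReal.toReal_mul, ENNReal.toReal_pow,
    ENNReal.toReal_ofReal hr]
  rfl

lemma vol_closedBall (z : ℂ) {r : ℝ} (hr : 0 ≤ r) :
    volume.real (closedBall z r) = r ^ 2 * Real.pi := by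
  rw [Measure.real, Complex.volume_closedBall, ENNReal.toReal_mul, ENNReal.toReal_pow,
    ENNReal.toReal_ofReal hr]
  rfl

lemma step_final {τ C m δ R X a I E1 E2 : ℝ} (hτ : 0 < τ) (hm : 0 < m)
    (hmδ : m ≤ δ) (hE1 : E1 = Real.exp (τ * (2 * R - X + δ) ^ 2))
    (hE2 : E2 = Real.exp (τ * (2 * R - X + 2 * δ) ^ 2)) (hX : X ≤ R) (hRτ : 1 ≤ τ)
    (h1 : I ≤ 2 * (Real.pi * (2 * (C * m / δ) ^ 2 * E1)))
    (h2 : τ / 2 * ((a / 2) ^ 2 * Real.pi * (E2 * (a / 2) ^ 2)) ≤ I) :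
    a ^ 4 ≤ 128 * C ^ 2 * Real.exp (- (2 * τ * R * δ)) := by
  have hδ : 0 < δ := hm.trans_le hmδ
  have hE : E1 ≤ E2 * Real.exp (- (2 * τ * R * δ)) := by
    rw [hE1, hE2, ← Real.exp_add]
    apply Real.exp_le_exp.2
    have : 0 ≤ τ * δ * (2 * R - 2 * X + 3 * δ) := by
      apply mul_nonneg (by positivity); linarith
    nlinarith
  have hE2p : 0 < E2 := by rw [hE2]; positivity
  have hE1p : 0 < E1 := by rw [hE1]; positivity
  have h3 : (C * m / δ) ^ 2 ≤ C ^ 2 := by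
    rw [mul_div_assoc, mul_pow]
    have : m / δ ≤ 1 := by rw [div_le_one hδ]; exact hmδ
    have h0 : 0 ≤ m / δ := by positivity
    have : (m / δ) ^ 2 ≤ 1 := by nlinarith
    nlinarith [sq_nonneg C]
  have h4 : τ / 2 * ((a / 2) ^ 2 * Real.pi * (E2 * (a / 2) ^ 2)) ≤
      2 * (Real.pi * (2 * C ^ 2 * (E2 * Real.exp (- (2 * τ * R * δ))))) := by
    refine (h2.trans h1).trans ?_
    gcongr
  have h5 : (Real.pi * E2) * (τ * a ^ 4) ≤
      (Real.pi * E2) * (128 * C ^ 2 * Real.exp (- (2 * τ * R * δ))) := by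
    nlinarith
  have h6 := le_of_mul_le_mul_left h5 (by positivity)
  have : 0 ≤ a ^ 4 := by positivity
  nlinarith

lemma alg1 {f p q s d b e : ℝ} (hf : 0 ≤ f) (hs : 0 ≤ s) (hs1 : s ≤ 1) (hb : 0 ≤ b / 2 * e)
    (hq : q ≤ s * p) (n2 : f * p ≤ d + b / 2 * e) {x : ℝ} (n1 : x ≤ f * q + b / 2 * e) :
    x ≤ s * d + b * e := by
  have a1 := mul_le_mul_of_nonneg_left hq hf
  have a2 := mul_le_mul_of_nonneg_left n2 hs
  have a3 := mul_le_mul_of_nonneg_right hs1 hb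
  linarith

lemma alg2 {x s d b t : ℝ} (hx : 0 ≤ x) (hs : s ^ 2 ≤ t) (h : x ≤ s * d + b) :
    x ^ 2 ≤ 2 * t * d ^ 2 + 2 * b ^ 2 := by
  have b1 : x ^ 2 ≤ (s * d + b) ^ 2 := by gcongr
  have b2 : s ^ 2 * d ^ 2 ≤ t * d ^ 2 := by gcongr
  nlinarith [sq_nonneg (s * d - b)]

set_option maxHeartbeats 1000000 in
lemma step {u : ℂ → E} {θ R R' X δ m : ℝ} {χ : ℝ → ℝ} {C : ℝ} (hθ : 0 < θ)
    (hC : 0 < C) (hχ : ContDiff ℝ 1 χ) (hχ0 : ∀ t, 0 ≤ χ t)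
    (hχl : ∀ t ≤ 0, χ t = 0) (hχr : ∀ t, 1 ≤ t → χ t = 1)
    (hχd : ∀ t, |deriv χ t| ≤ C) (hχd1 : ∀ t, 1 < t → deriv χ t = 0)
    (hR : 0 < R) (hR1 : R ≤ 1) (hRR : R < R')
    (hu : ∀ z : ℂ, -R' < z.re → ContDiffAt ℝ 1 u z)
    (hsupp : ∀ z : ℂ, -R' < z.re → u z ≠ 0 → z.re ≤ 0 ∧ ‖z‖ ≤ 1)
    (hineq : ∀ z : ℂ, -R' < z.re → ‖dbar u z‖ ≤ θ * ‖u z‖ ^ ((1 : ℝ) / 2) * ‖dz u z‖)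
    (hLip : ∀ z w : ℂ, -R' < z.re → -R' < w.re → ‖u z - u w‖ ≤ ‖z - w‖)
    (hX : X ≤ R) (hm : 0 < m) (hmδ : m ≤ δ) (hmθ : 72 * θ ^ 2 * m ≤ 1)
    (hbd : ∀ z : ℂ, -X ≤ z.re → ‖u z‖ ≤ m) (z₀ : ℂ) (hz₀ : -(X - 3 * δ) ≤ z₀.re) :
    ‖u z₀‖ ^ 4 ≤ 128 * C ^ 2 * Real.exp (- (δ / (36 * θ ^ 2 * m * R))) := by
  have hδ : 0 < δ := hm.trans_le hmδ
  by_cases hu0 : u z₀ = 0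
  · rw [hu0]; simp; positivity
  set τ : ℝ := 1 / (72 * θ ^ 2 * m * R ^ 2) with hτdef
  have hτ : 0 < τ := by positivity
  have hRτ1 : R ^ 2 * τ = 1 / (72 * θ ^ 2 * m) := by rw [hτdef]; field_simp
  have hRτ : 1 ≤ R ^ 2 * τ := by
    rw [hRτ1]; exact (one_le_div (by positivity)).2 hmθ
  have hτ1 : 1 ≤ τ := by
    have : R ^ 2 ≤ 1 := by nlinarith
    nlinarith
  have hmτ : 72 * θ ^ 2 * m * (R ^ 2 * τ) = 1 := by rw [hRτ1]; field_simp
  set f : ℂ → ℝ := fun z => χ ((z.re + X) / δ) with hf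
  have hfc : ContDiff ℝ 1 f := by
    have : ContDiff ℝ 1 (fun z : ℂ => z.re) := Complex.reCLM.contDiff
    exact hχ.comp ((this.add contDiff_const).div_const δ)
  have hf' : ∀ z, HasFDerivAt f ((deriv χ ((z.re + X) / δ) / δ) • Complex.reCLM) z := by
    intro z
    have h1 : HasFDerivAt (fun z : ℂ => (z.re + X) / δ) ((1 / δ) • Complex.reCLM) z := by
      have := ((Complex.reCLM.hasFDerivAt (x := z)).add_const X).const_mul (1 / δ)
      refine this.congr_of_eventuallyEq (Eventually.of_forall fun y => ?_)
      simp; ring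
    have h2 := ((hχ.differentiable (by norm_num)) ((z.re + X) / δ)).hasDerivAt.comp_hasFDerivAt z h1
    refine HasFDerivAt.congr_fderiv h2 ?_
    rw [smul_smul]; congr 1; ring
  have hfl : ∀ z : ℂ, z.re ≤ -X → f z = 0 := fun z hz =>
    hχl _ (div_nonpos_of_nonpos_of_nonneg (by linarith) hδ.le)
  have hfr : ∀ z : ℂ, -X + δ ≤ z.re → f z = 1 := fun z hz =>
    hχr _ ((one_le_div hδ).2 (by linarith))
  set v : ℂ → E := fun z => f z • u z with hv
  have hv0 : ∀ z : ℂ, z.re < -X → v =ᶠ[𝓝 z] fun _ => 0 := by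
    intro z hz
    have : ∀ᶠ y : ℂ in 𝓝 z, y.re < -X := Complex.continuous_re.continuousAt.eventually_lt_const hz
    filter_upwards [this] with y hy
    simp [hv, hfl y hy.le]
  have hvc : ContDiff ℝ 1 v := by
    rw [contDiff_iff_contDiffAt]
    intro z
    rcases lt_or_ge z.re (-X) with h | h
    · exact contDiffAt_const.congr_of_eventuallyEq (hv0 z h)
    · exact hfc.contDiffAt.smul (hu z (by linarith))
  have hvX : ∀ z, v z ≠ 0 → -X < z.re ∧ u z ≠ 0 := by
    intro z hz
    refine ⟨?_, fun h => hz (by simp [hv, h])⟩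
    by_contra h
    exact hz (by simp [hv, hfl z (not_lt.1 h)])
  have hvs : HasCompactSupport v := by
    refine HasCompactSupport.intro (isCompact_closedBall (0 : ℂ) 1) fun z hz => ?_
    by_contra h
    obtain ⟨h1, h2⟩ := hvX z h
    exact hz (by simpa using (hsupp z (by linarith) h2).2)
  have hvR : ∀ z : ℂ, v z ≠ 0 → |z.re + 2 * R| ≤ 2 * R := by
    intro z h
    obtain ⟨h1, h2⟩ := hvX z h
    have := (hsupp z (by linarith) h2).1
    rw [abs_le]; constructor <;> linarith
  obtain ⟨car1, car2⟩ := carleman hvc hvs hτ hvR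
  set W : ℂ → ℝ := fun z => Real.exp (τ * (z.re + 2 * R) ^ 2) with hW
  have hWpos : ∀ z, 0 < W z := fun z => Real.exp_pos _
  have iv := int_weight hvc.continuous hvs τ (2 * R)
  have idz := int_weight (cont_dz hvc) (cs_dz hvs) τ (2 * R)
  have idb := int_weight (cont_dbar hvc) (cs_dbar hvs) τ (2 * R)
  set I := ∫ z : ℂ, Real.exp (τ * (z.re + 2 * R) ^ 2) * ‖dbar v z‖ ^ 2 with hI
  set E1 := Real.exp (τ * (2 * R - X + δ) ^ 2) with hE1
  set E2 := Real.exp (τ * (2 * R - X + 2 * δ) ^ 2) with hE2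
  set K := 2 * (C * m / δ) ^ 2 * E1 with hK
  have hK0 : 0 ≤ K := by positivity
  have pw : ∀ z : ℂ, W z * ‖dbar v z‖ ^ 2 ≤ 2 * θ ^ 2 * m * (W z * ‖dz v z‖ ^ 2) +
      (closedBall (0:ℂ) 1).indicator (fun _ => K) z := by
    intro z
    have ind0 : 0 ≤ (closedBall (0:ℂ) 1).indicator (fun _ => K) z :=
      Set.indicator_nonneg (fun _ _ => hK0) z
    have t0 : 0 ≤ 2 * θ ^ 2 * m * (W z * ‖dz v z‖ ^ 2) := by
      have := hWpos z; positivity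
    rcases lt_or_ge z.re (-X) with h | h
    · have : dbar v z = 0 := by
        unfold dbar
        rw [(hv0 z h).fderiv_eq]; simp
      rw [this]; simp only [norm_zero]
      norm_num
      linarith
    have hzR : -R' < z.re := by linarith
    have hud : DifferentiableAt ℝ u z := (hu z hzR).differentiableAt (by norm_num)
    have e1 := dbar_smul_re (hf' z) hud
    have e2 := dz_smul_re (hf' z) hud
    set c := deriv χ ((z.re + X) / δ) / δ with hc
    change dbar v z = _ at e1
    change dz v z = _ at e2
    have hq := hineq z hzR
    by_cases huz : u z = 0
    · rw [huz] at hq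
      have : dbar u z = 0 := by
        rw [norm_zero, Real.zero_rpow (by norm_num)] at hq
        simpa using hq
      rw [e1, this, huz]; simp only [smul_zero, add_zero, norm_zero]
      norm_num
      linarith
    have hball := (hsupp z hzR huz).2
    have hre := (hsupp z hzR huz).1
    have hum := hbd z h
    set s := θ * ‖u z‖ ^ ((1 : ℝ) / 2) with hs
    have hs0 : 0 ≤ s := by positivity
    have hs2 : s ^ 2 ≤ θ ^ 2 * m := by
      rw [hs, mul_pow, ← Real.sqrt_eq_rpow, Real.sq_sqrt (norm_nonneg _)]
      gcongr
    have hs1 : s ≤ 1 := by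
      have : s ^ 2 ≤ 1 := by
        have : 0 ≤ θ ^ 2 * m := by positivity
        linarith
      exact (sq_le_one_iff₀ hs0).1 this
    have hcC : |c| ≤ C / δ := by
      rw [hc, abs_div, abs_of_pos hδ]
      gcongr
      exact hχd _
    have n2 : f z * ‖dz u z‖ ≤ ‖dz v z‖ + |c| / 2 * ‖u z‖ := by
      have : f z • dz u z = dz v z - (c / 2) • u z := by rw [e2]; module
      calc f z * ‖dz u z‖ = ‖f z • dz u z‖ := by
            rw [norm_smul, Real.norm_eq_abs, abs_of_nonneg (hχ0 _)]
        _ ≤ ‖dz v z‖ + ‖(c / 2) • u z‖ := by rw [this]; exact norm_sub_le _ _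
        _ = _ := by rw [norm_smul, Real.norm_eq_abs, abs_div]; norm_num
    have n1 : ‖dbar v z‖ ≤ f z * ‖dbar u z‖ + |c| / 2 * ‖u z‖ := by
      have k1 : ‖f z • dbar u z‖ = f z * ‖dbar u z‖ := by
        rw [norm_smul, Real.norm_eq_abs, abs_of_nonneg (hχ0 _)]
      have k2 : ‖(c / 2) • u z‖ = |c| / 2 * ‖u z‖ := by
        rw [norm_smul, Real.norm_eq_abs, abs_div]; norm_num
      rw [e1, ← k1, ← k2]
      exact norm_add_le _ _
    have n3 : ‖dbar v z‖ ≤ s * ‖dz v z‖ + |c| * ‖u z‖ := by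
      exact alg1 (hχ0 _) hs0 hs1 (by positivity) hq n2 n1
    have n4 : ‖dbar v z‖ ^ 2 ≤ 2 * (θ ^ 2 * m) * ‖dz v z‖ ^ 2 + 2 * (|c| * ‖u z‖) ^ 2 := by
      exact alg2 (norm_nonneg _) hs2 n3
    have n5 : W z * (2 * (|c| * ‖u z‖) ^ 2) ≤ K := by
      rcases lt_or_ge (-X + δ) z.re with h' | h'
      · have : c = 0 := by
          rw [hc, hχd1 _ ((one_lt_div hδ).2 (by linarith))]; simp
        rw [this]; simpa using hK0
      · have w1 : W z ≤ E1 := by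
          exact Real.exp_le_exp.2 (mul_le_mul_of_nonneg_left
            (pow_le_pow_left₀ (by linarith) (by linarith) 2) hτ.le)
        have w2 : |c| * ‖u z‖ ≤ C * m / δ := by
          calc |c| * ‖u z‖ ≤ C / δ * m := by gcongr
            _ = _ := by ring
        calc W z * (2 * (|c| * ‖u z‖) ^ 2) ≤ E1 * (2 * (C * m / δ) ^ 2) := by gcongr
          _ = K := by rw [hK]; ring
    rw [Set.indicator_of_mem (by simpa using hball)]
    have := mul_le_mul_of_nonneg_left n4 (hWpos z).le
    linarith
  have iK : Integrable ((closedBall (0:ℂ) 1).indicator (fun _ => K)) :=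
    (integrable_indicator_iff measurableSet_closedBall).2
      (integrableOn_const (by exact measure_closedBall_lt_top.ne))
  have J1 : I ≤ 2 * θ ^ 2 * m * (∫ z : ℂ, Real.exp (τ * (z.re + 2 * R) ^ 2) * ‖dz v z‖ ^ 2)
      + Real.pi * K := by
    calc I ≤ ∫ z : ℂ, (2 * θ ^ 2 * m * (W z * ‖dz v z‖ ^ 2) +
          (closedBall (0:ℂ) 1).indicator (fun _ => K) z) :=
        integral_mono idb ((idz.const_mul _).add iK) pw
      _ = _ := by
        rw [integral_add (idz.const_mul _) iK, integral_const_mul,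
          integral_indicator measurableSet_closedBall, setIntegral_const,
          vol_closedBall _ zero_le_one]
        simp
  have hI0 : 0 ≤ I := integral_nonneg fun z => by positivity
  have J2 : I ≤ 2 * (Real.pi * K) := by
    have h1 := mul_le_mul_of_nonneg_left car2 (by positivity : 0 ≤ 2 * θ ^ 2 * m)
    have h2 : 2 * θ ^ 2 * m * ((2 + 16 * R ^ 2 * τ) * I) ≤ 1 / 2 * I := by
      have : 2 * θ ^ 2 * m * (2 + 16 * R ^ 2 * τ) ≤ 1 / 2 := by
        have := mul_le_mul_of_nonneg_left hRτ (by positivity : 0 ≤ 4 * θ ^ 2 * m)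
        nlinarith
      rw [← mul_assoc]
      gcongr
    linarith
  set a := ‖u z₀‖ with ha
  have ha0 : 0 < a := norm_pos_iff.2 hu0
  have ham : a ≤ m := hbd z₀ (by linarith)
  have pw2 : ∀ z : ℂ, (ball z₀ (a / 2)).indicator (fun _ => E2 * (a / 2) ^ 2) z
      ≤ W z * ‖v z‖ ^ 2 := by
    intro z
    by_cases hz : z ∈ ball z₀ (a / 2)
    · rw [Set.indicator_of_mem hz]
      rw [mem_ball, dist_eq_norm] at hz
      have hre : |(z - z₀).re| ≤ a / 2 := (Complex.abs_re_le_norm _).trans hz.le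
      rw [Complex.sub_re, abs_le] at hre
      have hzX : -X + 2 * δ ≤ z.re := by linarith
      have hvz : v z = u z := by simp [hv, hfr z (by linarith)]
      have hl := hLip z z₀ (by linarith) (by linarith)
      have h3 : a / 2 ≤ ‖u z‖ := by
        have := norm_sub_norm_le (u z₀) (u z)
        rw [norm_sub_rev] at this
        linarith
      have h4 : E2 ≤ W z := by
        exact Real.exp_le_exp.2 (mul_le_mul_of_nonneg_left
          (pow_le_pow_left₀ (by linarith) (by linarith) 2) hτ.le)
      rw [hvz]
      gcongr
    · rw [Set.indicator_of_notMem hz]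
      have := hWpos z; positivity
  have iK2 : Integrable ((ball z₀ (a / 2)).indicator (fun _ => E2 * (a / 2) ^ 2)) :=
    (integrable_indicator_iff measurableSet_ball).2
      (integrableOn_const (by exact measure_ball_lt_top.ne))
  have J3 : (a / 2) ^ 2 * Real.pi * (E2 * (a / 2) ^ 2) ≤
      ∫ z : ℂ, Real.exp (τ * (z.re + 2 * R) ^ 2) * ‖v z‖ ^ 2 := by
    calc _ = ∫ z, (ball z₀ (a / 2)).indicator (fun _ => E2 * (a / 2) ^ 2) z := by
          rw [integral_indicator measurableSet_ball, setIntegral_const,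
            vol_ball _ (by positivity)]
          simp
      _ ≤ _ := integral_mono iK2 iv pw2
  have J4 := (mul_le_mul_of_nonneg_left J3 (by positivity : 0 ≤ τ / 2)).trans car1
  have fin := step_final hτ hm hmδ hE1 hE2 hX hτ1 J2 J4
  have : 2 * τ * R * δ = δ / (36 * θ ^ 2 * m * R) := by
    rw [hτdef]; field_simp; norm_num
  rwa [this] at fin


lemma exp_small {κ M : ℝ} (hκ : 0 < κ) (hM : 0 < M) :
    ∃ T : ℝ, ∀ t, T ≤ t → M * (t ^ 8 * Real.exp (-(κ * t))) ≤ 1 := by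
  have h := (Real.tendsto_pow_mul_exp_neg_atTop_nhds_zero 8).comp
    (tendsto_id.const_mul_atTop hκ)
  have h2 := h.eventually_lt_const (show (0 : ℝ) < κ ^ 8 / M by positivity)
  obtain ⟨T, hT⟩ := eventually_atTop.1 h2
  refine ⟨T, fun t ht => ?_⟩
  have := hT t ht
  simp only [Function.comp, id] at this
  rw [lt_div_iff₀ hM, mul_pow] at this
  have h3 : κ ^ 8 * (M * (t ^ 8 * Real.exp (-(κ * t)))) ≤ κ ^ 8 * 1 := by linarith
  exact le_of_mul_le_mul_left h3 (by positivity)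

lemma iter {u : ℂ → E} {θ R' : ℝ} (hθ : 0 < θ) (hR' : 0 < R')
    (hu : ∀ z : ℂ, -R' < z.re → ContDiffAt ℝ 1 u z)
    (hsupp : ∀ z : ℂ, -R' < z.re → u z ≠ 0 → z.re < 0 ∧ ‖z‖ ≤ 1)
    (hineq : ∀ z : ℂ, -R' < z.re → ‖dbar u z‖ ≤ θ * ‖u z‖ ^ ((1 : ℝ) / 2) * ‖dz u z‖)
    (hLip : ∀ z w : ℂ, -R' < z.re → -R' < w.re → ‖u z - u w‖ ≤ 1 / 12 * ‖z - w‖) :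
    ∃ R : ℝ, 0 < R ∧ ∀ z : ℂ, -(R / 2) ≤ z.re → u z = 0 := by
  obtain ⟨χ, C, hC, c1, c2, -, c4, c5, c6, c7⟩ := exists_cutoff
  obtain ⟨T, hT⟩ := exp_small (κ := 1 / (36 * θ ^ 2)) (M := 128 * C ^ 2 * 48 ^ 4)
    (by positivity) (by positivity)
  obtain ⟨R, hR, hR1, hRR, hRθ, hRT⟩ : ∃ R : ℝ, 0 < R ∧ R ≤ 1 ∧ R < R' ∧ 6 * θ ^ 2 * R ≤ 1 ∧
      T ≤ 1 / R := by
    have p1 : 0 < 1 / (6 * θ ^ 2) := by positivity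
    have p2 : 0 < 1 / (|T| + 1) := by positivity
    refine ⟨min (min 1 (R' / 2)) (min (1 / (6 * θ ^ 2)) (1 / (|T| + 1))), ?_, ?_, ?_, ?_, ?_⟩
    · refine lt_min (lt_min one_pos (by linarith)) (lt_min p1 p2)
    · exact (min_le_left _ _).trans (min_le_left _ _)
    · refine ((min_le_left _ _).trans (min_le_right _ _)).trans_lt (by linarith)
    · have : min (min 1 (R' / 2)) (min (1 / (6 * θ ^ 2)) (1 / (|T| + 1))) ≤ 1 / (6 * θ ^ 2) :=
        (min_le_right _ _).trans (min_le_left _ _)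
      rw [le_div_iff₀ (by positivity)] at this
      linarith
    · have h : min (min 1 (R' / 2)) (min (1 / (6 * θ ^ 2)) (1 / (|T| + 1))) ≤ 1 / (|T| + 1) :=
        (min_le_right _ _).trans (min_le_right _ _)
      rw [le_div_iff₀ (lt_min (lt_min one_pos (by linarith)) (lt_min p1 p2))]
      rw [le_div_iff₀ (by positivity)] at h
      have h0 : 0 < min (min 1 (R' / 2)) (min (1 / (6 * θ ^ 2)) (1 / (|T| + 1))) :=
        lt_min (lt_min one_pos (by linarith)) (lt_min p1 p2)
      have := mul_le_mul_of_nonneg_right (le_abs_self T) h0.le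
      linarith
  have key : ∀ j : ℕ, ∀ z : ℂ, -(R / 2 + R / 2 / 2 ^ j) ≤ z.re → ‖u z‖ ≤ R / 12 / 4 ^ j := by
    intro j
    induction j with
    | zero =>
      intro z hz
      by_cases h : u z = 0
      · rw [h, norm_zero]; positivity
      have hz' : -R ≤ z.re := by
        have : R / 2 + R / 2 / 2 ^ 0 = R := by norm_num
        linarith
      have h1 := (hsupp z (by linarith) h).1
      have h2 : u (⟨0, z.im⟩ : ℂ) = 0 := by
        by_contra h3
        have := (hsupp ⟨0, z.im⟩ (by simpa using hR') h3).1
        simp at this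
      have h3 := hLip z ⟨0, z.im⟩ (by linarith) (by simpa using hR')
      have h4 : ‖z - ⟨0, z.im⟩‖ = |z.re| := by
        have : z - ⟨0, z.im⟩ = (z.re : ℂ) := by apply Complex.ext <;> simp
        rw [this, Complex.norm_real, Real.norm_eq_abs]
      rw [h2, sub_zero, h4, abs_of_neg h1] at h3
      have : R / 12 / 4 ^ 0 = R / 12 := by norm_num
      linarith
    | succ j ih =>
      intro z hz
      set q : ℝ := 2 ^ j with hq
      have hq1 : 1 ≤ q := one_le_pow₀ (by norm_num)
      have hq4 : (4 : ℝ) ^ j = q ^ 2 := by rw [hq, ← pow_mul, mul_comm, pow_mul]; norm_num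
      rw [pow_succ, ← hq] at hz
      rw [hq4] at ih
      rw [pow_succ, hq4]
      have hδ : R / 12 / q ^ 2 ≤ R / 12 / q := by
        gcongr
        nlinarith
      have hX : R / 2 + R / 2 / q ≤ R := by
        have : R / 2 / q ≤ R / 2 := div_le_self (by positivity) hq1
        linarith
      have hm1 : R / 12 / q ^ 2 ≤ R / 12 := div_le_self (by positivity) (one_le_pow₀ hq1)
      have st := step (X := R / 2 + R / 2 / q) (δ := R / 12 / q) (m := R / 12 / q ^ 2)
        hθ hC c1 c2 c4 c5 c6 c7 hR hR1 hRR hu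
        (fun z h h' => ⟨(hsupp z h h').1.le, (hsupp z h h').2⟩) hineq
        (fun z w h h' => (hLip z w h h').trans (by linarith [norm_nonneg (z - w)]))
        hX (by positivity) hδ
        (by
          have := mul_le_mul_of_nonneg_left hm1 (by positivity : 0 ≤ 72 * θ ^ 2)
          linarith) ih z
        (by
          refine le_trans (le_of_eq ?_) hz
          field_simp; ring)
      have e1 : R / 12 / q / (36 * θ ^ 2 * (R / 12 / q ^ 2) * R) = 1 / (36 * θ ^ 2) * (q / R) := by
        field_simp
      rw [e1] at st
      have ht := hT (q / R) (hRT.trans (by gcongr))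
      have hqR : 0 < q / R := by positivity
      have h5 : 128 * C ^ 2 * Real.exp (-(1 / (36 * θ ^ 2) * (q / R))) ≤
          1 / (48 ^ 4 * (q / R) ^ 8) := by
        rw [le_div_iff₀ (by positivity)]
        linarith
      have h6 : 1 / (48 ^ 4 * (q / R) ^ 8) ≤ (R / 12 / (q ^ 2 * 4)) ^ 4 := by
        have : (R / 12 / (q ^ 2 * 4)) ^ 4 = R ^ 4 / (48 ^ 4 * q ^ 8) := by
          field_simp; norm_num
        rw [this]
        have : 1 / (48 ^ 4 * (q / R) ^ 8) = R ^ 8 / (48 ^ 4 * q ^ 8) := by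
          field_simp
        rw [this]
        gcongr ?_ / _
        exact pow_le_pow_of_le_one hR.le hR1 (by norm_num)
      exact le_of_pow_le_pow_left₀ (by norm_num) (by positivity) ((st.trans h5).trans h6)
  refine ⟨R, hR, fun z hz => ?_⟩
  have hlim : Tendsto (fun j : ℕ => R / 12 / (4 : ℝ) ^ j) atTop (𝓝 0) :=
    tendsto_const_nhds.div_atTop (tendsto_pow_atTop_atTop_of_one_lt (by norm_num))
  have : ‖u z‖ ≤ 0 := ge_of_tendsto' hlim fun j => key j z (by
    have : 0 < R / 2 / 2 ^ j := by positivity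
    linarith)
  simpa using this

lemma main_abs {u : ℂ → E} {A θ : ℝ} (hA : 0 < A) (hθ : 0 < θ)
    (hu : ContDiffOn ℝ 1 u (ball (0 : ℂ) 1))
    (hzero : ∀ z ∈ ball (0 : ℂ) 1, z.re ≥ -A * z.im ^ 2 → u z = 0)
    (hineq : ∀ z ∈ ball (0 : ℂ) 1,
      ‖dbar u z‖ ≤ θ * ‖u z‖ ^ ((1 : ℝ) / 2) * ‖dz u z‖) :
    ∃ V ∈ 𝓝 (0 : ℂ), ∀ z ∈ V ∩ ball (0 : ℂ) 1, u z = 0 := by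
  have hcf : ContinuousOn (fderiv ℝ u) (ball (0 : ℂ) 1) :=
    hu.continuousOn_fderiv_of_isOpen isOpen_ball (by norm_num)
  have hcf0 : ContinuousAt (fderiv ℝ u) 0 :=
    hcf.continuousAt (isOpen_ball.mem_nhds (by simp))
  have hpos : ∀ z ∈ ball (0 : ℂ) 1, z.re > -A * z.im ^ 2 → fderiv ℝ u z = 0 := by
    intro z hz h
    have h1 : ∀ᶠ w in 𝓝 z, w ∈ ball (0 : ℂ) 1 := isOpen_ball.mem_nhds hz
    have h2 : ∀ᶠ w : ℂ in 𝓝 z, -A * w.im ^ 2 < w.re := by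
      have : IsOpen {w : ℂ | -A * w.im ^ 2 < w.re} :=
        isOpen_lt (by fun_prop) Complex.continuous_re
      exact this.mem_nhds h
    have : u =ᶠ[𝓝 z] fun _ => 0 := by
      filter_upwards [h1, h2] with w hw hw2
      exact hzero w hw hw2.le
    rw [this.fderiv_eq]; simp
  have hf0 : fderiv ℝ u 0 = 0 := by
    have hs : Tendsto (fun n : ℕ => ((1 / ((n : ℝ) + 1 + 1) : ℝ) : ℂ)) atTop (𝓝 0) := by
      have h1 : Tendsto (fun n : ℕ => (1 / ((n : ℝ) + 1 + 1) : ℝ)) atTop (𝓝 0) := by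
        have := (tendsto_add_atTop_iff_nat 1).2 (tendsto_one_div_add_atTop_nhds_zero_nat (𝕜 := ℝ))
        simpa using this
      have := (Complex.continuous_ofReal.tendsto 0).comp h1
      simpa [Function.comp_def] using this
    have h2 := hcf0.tendsto.comp hs
    refine tendsto_nhds_unique h2 (tendsto_const_nhds.congr fun n => ?_)
    symm
    have hn : (0 : ℝ) < 1 / ((n : ℝ) + 1 + 1) := by positivity
    apply hpos
    · rw [mem_ball_zero_iff, Complex.norm_real, Real.norm_eq_abs, abs_of_pos hn,
        div_lt_one (by positivity)]
      have : (0 : ℝ) ≤ n := n.cast_nonneg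
      linarith
    · rw [Complex.ofReal_re, Complex.ofReal_im]
      simpa using hn
  obtain ⟨ρ, hρ, hρ1, hρd⟩ : ∃ ρ : ℝ, 0 < ρ ∧ ρ ≤ 1 ∧ ∀ z : ℂ, ‖z‖ < ρ →
      ‖fderiv ℝ u z‖ ≤ 1 / 12 := by
    obtain ⟨ρ, hρ, h⟩ := Metric.continuousAt_iff.1 hcf0 (1 / 12) (by norm_num)
    refine ⟨min ρ 1, lt_min hρ one_pos, min_le_right _ _, fun z hz => ?_⟩
    have := h (x := z) (by simpa using hz.trans_le (min_le_left _ _))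
    rw [hf0, dist_zero_right] at this
    exact this.le
  set R' : ℝ := min (ρ / 4) (A * (ρ / 4) ^ 2) with hR'
  have hR'0 : 0 < R' := lt_min (by positivity) (by positivity)
  have hcon : ∀ z : ℂ, -R' < z.re → z.re ≤ -A * z.im ^ 2 → ‖z‖ ≤ ρ / 2 := by
    intro z h1 h2
    have h3 : R' ≤ ρ / 4 := min_le_left _ _
    have h4 : R' ≤ A * (ρ / 4) ^ 2 := min_le_right _ _
    have h5 : A * z.im ^ 2 ≤ A * (ρ / 4) ^ 2 := by linarith
    have h6 := le_of_mul_le_mul_left h5 hA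
    have h7 : |z.im| ≤ ρ / 4 := abs_le_of_sq_le_sq h6 (by positivity)
    have h8 : |z.re| ≤ ρ / 4 := by
      have : 0 ≤ A * z.im ^ 2 := by positivity
      rw [abs_le]; constructor <;> linarith
    have := Complex.norm_le_abs_re_add_abs_im z
    linarith
  set U : ℂ → E := (ball (0 : ℂ) 1).indicator u with hU
  have hUin : ∀ z ∈ ball (0 : ℂ) 1, U =ᶠ[𝓝 z] u := by
    intro z hz
    filter_upwards [isOpen_ball.mem_nhds hz] with w hw
    exact Set.indicator_of_mem hw u
  have hUne : ∀ z : ℂ, -R' < z.re → U z ≠ 0 → z.re < -A * z.im ^ 2 ∧ ‖z‖ ≤ ρ / 2 := by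
    intro z h1 h2
    have hz : z ∈ ball (0 : ℂ) 1 := Set.mem_of_indicator_ne_zero h2
    have h3 : U z = u z := Set.indicator_of_mem hz u
    have h4 : z.re < -A * z.im ^ 2 := by
      by_contra h
      exact h2 (h3.trans (hzero z hz (not_lt.1 h)))
    exact ⟨h4, hcon z h1 h4.le⟩
  have hUout : ∀ z : ℂ, -R' < z.re → ρ / 2 < ‖z‖ → U =ᶠ[𝓝 z] fun _ => 0 := by
    intro z h1 h2
    have h3 : ∀ᶠ w : ℂ in 𝓝 z, -R' < w.re :=
      Complex.continuous_re.continuousAt.eventually_const_lt h1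
    have h4 : ∀ᶠ w : ℂ in 𝓝 z, ρ / 2 < ‖w‖ :=
      continuous_norm.continuousAt.eventually_const_lt h2
    filter_upwards [h3, h4] with w hw1 hw2
    by_contra h
    have := (hUne w hw1 h).2
    linarith
  have hmem : ∀ z : ℂ, ‖z‖ ≤ ρ / 2 → z ∈ ball (0 : ℂ) 1 := by
    intro z hz
    rw [mem_ball_zero_iff]; linarith
  have hUc : ∀ z : ℂ, -R' < z.re → ContDiffAt ℝ 1 U z := by
    intro z hz
    rcases le_or_gt ‖z‖ (ρ / 2) with h | h
    · exact (hu.contDiffAt (isOpen_ball.mem_nhds (hmem z h))).congr_of_eventuallyEq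
        (hUin z (hmem z h))
    · exact contDiffAt_const.congr_of_eventuallyEq (hUout z hz h)
  have hUd : ∀ z : ℂ, -R' < z.re → ‖fderiv ℝ U z‖ ≤ 1 / 12 := by
    intro z hz
    rcases le_or_gt ‖z‖ (ρ / 2) with h | h
    · rw [(hUin z (hmem z h)).fderiv_eq]
      exact hρd z (by linarith)
    · rw [(hUout z hz h).fderiv_eq]; simp
  have hconv : Convex ℝ {z : ℂ | -R' < z.re} := convex_halfSpace_re_gt _
  obtain ⟨R, hR, hfin⟩ := iter hθ hR'0 hUc
    (fun z h h' => by
      obtain ⟨a1, a2⟩ := hUne z h h'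
      have : 0 ≤ A * z.im ^ 2 := by positivity
      exact ⟨by linarith, by linarith⟩)
    (by
      intro z hz
      rcases le_or_gt ‖z‖ (ρ / 2) with h | h
      · have e := hUin z (hmem z h)
        have := hineq z (hmem z h)
        unfold dbar dz at this ⊢
        rw [e.fderiv_eq, e.eq_of_nhds]
        exact this
      · unfold dbar dz
        rw [(hUout z hz h).fderiv_eq]; simp)
    (fun z w hz hw => hconv.norm_image_sub_le_of_norm_fderiv_le
      (fun x hx => (hUc x hx).differentiableAt (by norm_num)) hUd hw hz)
  refine ⟨{z : ℂ | -(R / 2) < z.re}, ?_, ?_⟩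
  · have : IsOpen {z : ℂ | -(R / 2) < z.re} := isOpen_lt continuous_const Complex.continuous_re
    exact this.mem_nhds (by simpa using hR)
  · rintro z ⟨h1, h2⟩
    have := hfin z (le_of_lt h1)
    rwa [hU, Set.indicator_of_mem h2] at this

end helpers


/-- Lemma 3: let `A, θ > 0` and let `u : D → ℂⁿ` be `C¹` with
`u(x+iy) = 0` whenever `x ≥ -A·y²`, and `‖∂u/∂z̄‖ ≤ θ·‖u‖^{1/2}·‖∂u/∂z‖` on `D`.
Then `u ≡ 0` on a neighborhood of `0` in `D`. -/
theorem vanishing_near_parabola (n : ℕ)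
    (A θ : ℝ) (hA : 0 < A) (hθ : 0 < θ)
    (u : ℂ → EuclideanSpace ℂ (Fin n))
    (hu : ContDiffOn ℝ 1 u (ball (0 : ℂ) 1))
    (hzero : ∀ z ∈ ball (0 : ℂ) 1, z.re ≥ -A * z.im ^ 2 → u z = 0)
    (hineq : ∀ z ∈ ball (0 : ℂ) 1,
      ‖dbar u z‖ ≤ θ * ‖u z‖ ^ ((1 : ℝ) / 2) * ‖dz u z‖) :
    ∃ V ∈ 𝓝 (0 : ℂ), ∀ z ∈ V ∩ ball (0 : ℂ) 1, u z = 0 := by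
  exact main_abs hA hθ hu hzero hineq
end

section
/- There exists a constant K > 0 such that for every C¹ map u : ℂ → ℂⁿ with compact support contained in D, ∫_D ‖∂u/∂z̄‖² dA ≥ K ∫_D ‖u‖² dA, where dA is Lebesgue measure on ℂ. -/
open Complex MeasureTheory Metric Filter Topology

lemma aux_int_fderiv {f : ℂ → ℝ} (hf : ContDiff ℝ 1 f) (hc : HasCompactSupport f) (v : ℂ) :
    ∫ z, fderiv ℝ f z v = 0 := by
  have hcont : Continuous (fun z => fderiv ℝ f z v) :=
    (hf.continuous_fderiv one_ne_zero).clm_apply continuous_const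
  have hcs : HasCompactSupport (fun z => fderiv ℝ f z v) := hc.fderiv_apply ℝ v
  have := integral_mul_fderiv_eq_neg_fderiv_mul_of_integrable (μ := (volume : Measure ℂ))
    (f := fun _ : ℂ => (1:ℝ)) (g := f) (v := v) (by simp)
    (by simpa using hcont.integrable_of_hasCompactSupport hcs)
    (by simpa using hf.continuous.integrable_of_hasCompactSupport hc)
    (fun x _ => by fun_prop) (fun x _ => (hf.differentiable one_ne_zero) x)
  simpa using this

section
variable {E : Type*} [NormedAddCommGroup E] [InnerProductSpace ℂ E]

attribute [local instance] InnerProductSpace.complexToReal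

lemma aux_antisymm (a b : E) : inner ℝ a (I • b) = - inner ℝ b (I • a) := by
  rw [real_inner_eq_re_inner ℂ, real_inner_eq_re_inner ℂ, inner_smul_right, inner_smul_right,
    ← inner_conj_symm a b]
  simp only [RCLike.re_to_complex, mul_re, I_re, I_im, zero_mul, one_mul, conj_im, zero_sub]

lemma aux_null {u : ℂ → E} (hu : ContDiff ℝ 1 u) (hc : HasCompactSupport u) :
    ∫ z, inner ℝ (fderiv ℝ u z 1) (I • fderiv ℝ u z I) = 0 := by
  have hd : Differentiable ℝ u := hu.differentiable one_ne_zero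
  have hcf (v : ℂ) : Continuous (fun z => fderiv ℝ u z v) :=
    (hu.continuous_fderiv one_ne_zero).clm_apply continuous_const
  have hsf (v : ℂ) : HasCompactSupport (fun z => fderiv ℝ u z v) := hc.fderiv_apply ℝ v
  have hcu := hu.continuous
  set A : ℝ → ℝ := fun t => ∫ z, inner ℝ (u (z + t)) (I • fderiv ℝ u z I) with hA
  have hint (w : ℂ) : Integrable (fun z => inner ℝ (u (z + w)) (I • fderiv ℝ u z I)) := by
    apply Continuous.integrable_of_hasCompactSupport
    · have := hcf I
      fun_prop
    · refine (hsf I).mono ?_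
      intro z hz h
      apply hz
      simp only at h
      simp [h]
  have hint2 (w : ℂ) : Integrable (fun z => inner ℝ (fderiv ℝ u (z + w) I) (I • u z)) := by
    apply Continuous.integrable_of_hasCompactSupport
    · have : Continuous (fun z => fderiv ℝ u (z + w) I) := (hcf I).comp (by fun_prop)
      fun_prop
    · refine hc.mono ?_
      intro z hz h
      apply hz
      simp [h]
  have heven : ∀ t, A (-t) = A t := by
    intro t
    have hdt (z : ℂ) : HasFDerivAt (fun z => u (z + t)) (fderiv ℝ u (z + t)) z :=
      by
      have := (hd (z + t)).hasFDerivAt.comp z ((hasFDerivAt_id z).add_const (t : ℂ))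
      simpa [Function.comp_def] using this
    have h0 : ∫ z, fderiv ℝ (fun z => inner ℝ (u (z + t)) (I • u z)) z I = 0 := by
      apply aux_int_fderiv
      · have : ContDiff ℝ 1 (fun z : ℂ => u (z + t)) := hu.comp (by fun_prop)
        exact this.inner ℝ (hu.const_smul I)
      · refine hc.mono ?_
        intro z hz h
        apply hz
        simp [h]
    have h1 (z : ℂ) : fderiv ℝ (fun z => inner ℝ (u (z + t)) (I • u z)) z I
        = inner ℝ (u (z + t)) (I • fderiv ℝ u z I)
          + inner ℝ (fderiv ℝ u (z + t) I) (I • u z) := by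
      have hI : HasFDerivAt (fun z => I • u z) (I • fderiv ℝ u z) z :=
        (hd z).hasFDerivAt.const_smul I
      rw [((hdt z).inner ℝ hI).fderiv]
      simp
    simp_rw [h1] at h0
    rw [integral_add (hint t) (hint2 t)] at h0
    have h2 : A (-t) = ∫ z, inner ℝ (u z) (I • fderiv ℝ u (z + t) I) := by
      rw [hA]
      simp only
      rw [← integral_add_right_eq_self _ (t : ℂ)]
      simp
    rw [h2]
    have h3 : ∫ z, inner ℝ (u z) (I • fderiv ℝ u (z + t) I)
        = - ∫ z, inner ℝ (fderiv ℝ u (z + t) I) (I • u z) := by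
      rw [← integral_neg]
      congr 1; ext z; exact aux_antisymm _ _
    rw [h3, hA]
    linarith
  obtain ⟨C, hC⟩ := (hsf 1).exists_bound_of_continuous (hcf 1)
  have hder : HasDerivAt A (∫ z, inner ℝ (fderiv ℝ u (z + (0:ℝ)) 1) (I • fderiv ℝ u z I)) 0 := by
    refine (hasDerivAt_integral_of_dominated_loc_of_deriv_le (μ := (volume : Measure ℂ))
      (F := fun t z => inner ℝ (u (z + (t : ℝ))) (I • fderiv ℝ u z I))
      (F' := fun t z => inner ℝ (fderiv ℝ u (z + (t : ℝ)) 1) (I • fderiv ℝ u z I))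
      (bound := fun z => C * ‖fderiv ℝ u z I‖)
      (s := Set.univ) Filter.univ_mem ?_ ?_ ?_ ?_ ?_ ?_).2
    · exact Eventually.of_forall fun t => (hint t).aestronglyMeasurable
    · exact hint _
    · have := hcf 1
      have h2 := hcf I
      have : Continuous (fun z => fderiv ℝ u (z + (0:ℝ)) 1) := (hcf 1).comp (by fun_prop)
      exact Continuous.aestronglyMeasurable (by fun_prop)
    · refine Eventually.of_forall fun z t _ => ?_
      refine (norm_inner_le_norm _ _).trans ?_
      rw [norm_smul]
      simp only [norm_I, one_mul]
      gcongr
      exact hC _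
    · exact (((hcf I).norm).integrable_of_hasCompactSupport (hsf I).norm).const_mul C
    · refine Eventually.of_forall fun z t _ => ?_
      have h1 : HasDerivAt (fun t : ℝ => z + (t : ℂ)) 1 t := by
        simpa using (Complex.ofRealCLM.hasDerivAt (x := t)).const_add z
      have h2 : HasDerivAt (fun t : ℝ => u (z + t)) (fderiv ℝ u (z + t) 1) t :=
        (hd (z + t)).hasFDerivAt.comp_hasDerivAt t h1
      simpa using h2.inner ℝ (hasDerivAt_const t (I • fderiv ℝ u z I))
  have hder2 := hder
  have h4 : HasDerivAt (fun t => A (-t))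
      (-(∫ z, inner ℝ (fderiv ℝ u (z + (0:ℝ)) 1) (I • fderiv ℝ u z I))) 0 := by
    have : HasDerivAt A (∫ z, inner ℝ (fderiv ℝ u (z + (0:ℝ)) 1) (I • fderiv ℝ u z I)) (-0) := by
      simpa using hder
    simpa [Function.comp_def] using HasDerivAt.scomp (0:ℝ) this (hasDerivAt_neg (0:ℝ))
  simp_rw [heven] at h4
  have h5 := hder.unique h4
  simp only [ofReal_zero, add_zero] at h5
  linarith

lemma aux_poincare {u : ℂ → E} (hu : ContDiff ℝ 1 u) (hc : HasCompactSupport u)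
    (hs : tsupport u ⊆ ball (0 : ℂ) 1) :
    ∫ z, ‖u z‖ ^ 2 ≤ 4 * ∫ z, ‖fderiv ℝ u z 1‖ ^ 2 := by
  have hd : Differentiable ℝ u := hu.differentiable one_ne_zero
  have hcf (v : ℂ) : Continuous (fun z => fderiv ℝ u z v) :=
    (hu.continuous_fderiv one_ne_zero).clm_apply continuous_const
  have hsf (v : ℂ) : HasCompactSupport (fun z => fderiv ℝ u z v) := hc.fderiv_apply ℝ v
  have hcu := hu.continuous
  have i1 : Integrable (fun z => ‖u z‖ ^ 2) :=
    (hcu.norm.pow 2).integrable_of_hasCompactSupport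
      (hc.mono fun z hz h => hz (by simp [h]))
  have i2 : Integrable (fun z => ‖fderiv ℝ u z 1‖ ^ 2) :=
    ((hcf 1).norm.pow 2).integrable_of_hasCompactSupport
      ((hsf 1).mono fun z hz h => hz (by simp only at h; simp [h]))
  have i3 : Integrable (fun z : ℂ => z.re * (2 * inner ℝ (u z) (fderiv ℝ u z 1))) := by
    apply Continuous.integrable_of_hasCompactSupport
    · have := hcf 1
      fun_prop
    · refine hc.mono ?_
      intro z hz h
      apply hz
      simp [h]
  have h0 : ∫ z, fderiv ℝ (fun z : ℂ => z.re * ‖u z‖ ^ 2) z 1 = 0 := by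
    apply aux_int_fderiv
    · exact ContDiff.mul Complex.reCLM.contDiff (hu.norm_sq ℝ)
    · refine hc.mono ?_
      intro z hz h
      apply hz
      simp [h]
  have h1 (z : ℂ) : fderiv ℝ (fun z : ℂ => z.re * ‖u z‖ ^ 2) z 1
      = z.re * (2 * inner ℝ (u z) (fderiv ℝ u z 1)) + ‖u z‖ ^ 2 := by
    have hr : HasFDerivAt (fun z : ℂ => z.re) Complex.reCLM z := Complex.reCLM.hasFDerivAt
    have hm := (hr.mul (hd z).hasFDerivAt.norm_sq).fderiv
    change fderiv ℝ (fun z : ℂ => z.re * ‖u z‖ ^ 2) z = _ at hm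
    rw [hm]
    simp
  simp_rw [h1] at h0
  rw [integral_add i3 i1] at h0
  have h2 : -(∫ z : ℂ, z.re * (2 * inner ℝ (u z) (fderiv ℝ u z 1)))
      ≤ ∫ z, (2⁻¹ * ‖u z‖ ^ 2 + 2 * ‖fderiv ℝ u z 1‖ ^ 2) := by
    rw [← integral_neg]
    refine integral_mono i3.neg ((i1.const_mul _).add (i2.const_mul _)) fun z => ?_
    simp only
    by_cases hz : z ∈ ball (0:ℂ) 1
    · have hz1 : |z.re| ≤ 1 := (abs_re_le_norm z).trans (by simpa using (mem_ball_zero_iff.1 hz).le)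
      have h3 := abs_real_inner_le_norm (u z) (fderiv ℝ u z 1)
      have h4 : |z.re * inner ℝ (u z) (fderiv ℝ u z 1)| ≤ 1 * (‖u z‖ * ‖fderiv ℝ u z 1‖) := by
        rw [abs_mul]; gcongr
      have h5 := neg_abs_le (z.re * inner ℝ (u z) (fderiv ℝ u z 1))
      nlinarith [sq_nonneg (‖u z‖ - 2 * ‖fderiv ℝ u z 1‖)]
    · have : u z = 0 := image_eq_zero_of_notMem_tsupport fun h => hz (hs h)
      simp [this]
  rw [integral_add (i1.const_mul _) (i2.const_mul _), integral_const_mul, integral_const_mul] at h2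
  linarith

lemma aux_main {u : ℂ → E} (hu : ContDiff ℝ 1 u) (hc : HasCompactSupport u)
    (hs : tsupport u ⊆ ball (0 : ℂ) 1) :
    (1/16) * (∫ z in ball (0 : ℂ) 1, ‖u z‖ ^ 2) ≤ ∫ z in ball (0 : ℂ) 1, ‖dbar u z‖ ^ 2 := by
  have hcf (v : ℂ) : Continuous (fun z => fderiv ℝ u z v) :=
    (hu.continuous_fderiv one_ne_zero).clm_apply continuous_const
  have hsf (v : ℂ) : HasCompactSupport (fun z => fderiv ℝ u z v) := hc.fderiv_apply ℝ v
  have i2 (v : ℂ) : Integrable (fun z => ‖fderiv ℝ u z v‖ ^ 2) :=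
    ((hcf v).norm.pow 2).integrable_of_hasCompactSupport
      ((hsf v).mono fun z hz h => hz (by simp only at h; simp [h]))
  have i3 : Integrable (fun z => inner ℝ (fderiv ℝ u z 1) (I • fderiv ℝ u z I)) := by
    apply Continuous.integrable_of_hasCompactSupport
    · have := hcf 1
      have := hcf I
      fun_prop
    · refine (hsf 1).mono ?_
      intro z hz h
      apply hz
      simp only at h
      simp [h]
  rw [setIntegral_eq_integral_of_forall_compl_eq_zero, setIntegral_eq_integral_of_forall_compl_eq_zero]
  · have h1 (z : ℂ) : ‖dbar u z‖ ^ 2 = 4⁻¹ * (‖fderiv ℝ u z 1‖ ^ 2 + ‖fderiv ℝ u z I‖ ^ 2)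
        + 2⁻¹ * inner ℝ (fderiv ℝ u z 1) (I • fderiv ℝ u z I) := by
      rw [dbar, norm_smul, mul_pow, norm_add_sq_real, norm_smul I]
      simp only [norm_I, one_mul, norm_inv, Real.norm_ofNat]
      ring
    simp_rw [h1]
    have i4 : Integrable (fun z => ‖fderiv ℝ u z 1‖ ^ 2 + ‖fderiv ℝ u z I‖ ^ 2) :=
      (i2 1).add (i2 I)
    rw [integral_add (i4.const_mul _) (i3.const_mul _), integral_const_mul,
      integral_const_mul, aux_null hu hc, integral_add (i2 1) (i2 I)]
    have h3 := aux_poincare hu hc hs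
    have h4 : 0 ≤ ∫ z, ‖fderiv ℝ u z I‖ ^ 2 := integral_nonneg fun z => by positivity
    linarith
  · intro z hz
    have : fderiv ℝ u z = 0 :=
      image_eq_zero_of_notMem_tsupport fun h => hz (hs (tsupport_fderiv_subset ℝ h))
    simp [dbar, this]
  · intro z hz
    have : u z = 0 := image_eq_zero_of_notMem_tsupport fun h => hz (hs h)
    simp [this]

end

/-- there is `K > 0` such that for every `C¹` map `u : ℂ → ℂⁿ`
compactly supported in the unit disc, `∫_D ‖∂u/∂z̄‖² ≥ K ∫_D ‖u‖²`. -/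
theorem poincare_dbar (n : ℕ) :
    ∃ K : ℝ, 0 < K ∧
      ∀ (u : ℂ → EuclideanSpace ℂ (Fin n)),
        ContDiff ℝ 1 u → HasCompactSupport u →
        tsupport u ⊆ ball (0 : ℂ) 1 →
        K * (∫ z in ball (0 : ℂ) 1, ‖u z‖ ^ 2)
          ≤ ∫ z in ball (0 : ℂ) 1, ‖dbar u z‖ ^ 2 := by
  refine ⟨1/16, by norm_num, fun u hu hc hs => ?_⟩
  exact aux_main hu hc hs
end

section
/- Let u : D → ℂⁿ be a C¹ map satisfying ‖∂u/∂z̄(z)‖ ≤ C·‖u(z)‖ for all z ∈ D and some constant C > 0. If u vanishes to infinite order at 0, then u ≡ 0 on some neighborhood of 0 in D. -/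
open Complex MeasureTheory Metric Filter Asymptotics Topology

open scoped ENNReal

lemma pol_deriv (p : ℝ × ℝ) : ∃ L : ℝ × ℝ →L[ℝ] ℂ,
    HasFDerivAt (fun p : ℝ × ℝ => (p.1 : ℂ) * cexp (p.2 * I)) L p ∧
    L (1,0) = cexp (p.2 * I) ∧ L (0,1) = p.1 * (cexp (p.2 * I) * I) := by
  have h1 : HasFDerivAt (fun p : ℝ × ℝ => (p.1 : ℂ))
      (ofRealCLM.comp (ContinuousLinearMap.fst ℝ ℝ ℝ)) p :=
    (ofRealCLM.hasFDerivAt).comp p hasFDerivAt_fst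
  have h2 : HasFDerivAt (fun p : ℝ × ℝ => (p.2 : ℂ))
      (ofRealCLM.comp (ContinuousLinearMap.snd ℝ ℝ ℝ)) p :=
    (ofRealCLM.hasFDerivAt).comp p hasFDerivAt_snd
  refine ⟨_, h1.mul (h2.mul_const I).cexp, ?_, ?_⟩ <;> simp

section
variable {E : Type*} [NormedAddCommGroup E] [NormedSpace ℂ E]

lemma polar_identity (h : ℂ → E) (p : ℝ × ℝ) (hp : p.1 ≠ 0)
    (hd : DifferentiableAt ℝ h ((p.1 : ℂ) * cexp (p.2 * I))) :
    DifferentiableAt ℝ (fun p : ℝ × ℝ => h ((p.1 : ℂ) * cexp (p.2 * I))) p ∧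
    DifferentiableAt ℝ (fun p : ℝ × ℝ => (I * ((p.1⁻¹ : ℝ) : ℂ)) • h ((p.1 : ℂ) * cexp (p.2 * I))) p ∧
    fderiv ℝ (fun p : ℝ × ℝ => h ((p.1 : ℂ) * cexp (p.2 * I))) p (1,0) +
    fderiv ℝ (fun p : ℝ × ℝ => (I * ((p.1⁻¹ : ℝ) : ℂ)) • h ((p.1 : ℂ) * cexp (p.2 * I))) p (0,1)
    = (2 * cexp (-(p.2 * I))) • dbar h ((p.1 : ℂ) * cexp (p.2 * I)) := by
  obtain ⟨L, hL, hL1, hL2⟩ := pol_deriv p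
  have hf := hd.hasFDerivAt.comp p hL
  have hi : HasFDerivAt (fun p : ℝ × ℝ => p.1⁻¹)
      (((-(p.1^2)⁻¹) : ℝ) • (ContinuousLinearMap.fst ℝ ℝ ℝ)) p :=
    (hasDerivAt_inv hp).comp_hasFDerivAt p hasFDerivAt_fst
  have hi2 : HasFDerivAt (fun p : ℝ × ℝ => I * ((p.1⁻¹ : ℝ) : ℂ)) _ p :=
    ((ofRealCLM.hasFDerivAt).comp p hi).const_mul I
  have hg := hi2.smul hf
  refine ⟨hf.differentiableAt, hg.differentiableAt, ?_⟩
  have e1 := hf.fderiv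
  have e2 := hg.fderiv
  simp only [Function.comp_def] at e1 e2
  have e2' : fderiv ℝ (fun p : ℝ × ℝ => (I * ((p.1⁻¹ : ℝ) : ℂ)) • h ((p.1 : ℂ) * cexp (p.2 * I))) p = _ := e2
  rw [e1, e2']
  have key : ∀ w : ℂ, fderiv ℝ h ((p.1 : ℂ) * cexp (p.2 * I)) w =
     (w.re : ℂ) • fderiv ℝ h ((p.1 : ℂ) * cexp (p.2 * I)) 1 +
     (w.im : ℂ) • fderiv ℝ h ((p.1 : ℂ) * cexp (p.2 * I)) I := by
    intro w
    have : w = w.re • (1:ℂ) + w.im • I := by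
      apply Complex.ext <;> simp
    conv_lhs => rw [this]
    rw [map_add, map_smul, map_smul]
    simp only [Complex.coe_smul]
  have hpc : (p.1 : ℂ) ≠ 0 := by exact_mod_cast hp
  simp [hL1, hL2]
  rw [key (cexp (p.2 * I)), key ((p.1 : ℂ) * (cexp (p.2 * I) * I))]
  have hE : cexp (p.2 * I) = (Real.cos p.2 : ℂ) + Real.sin p.2 * I := by
    rw [Complex.exp_mul_I]; simp
  have hE2 : cexp (-(p.2 * I)) = (Real.cos p.2 : ℂ) - Real.sin p.2 * I := by
    rw [← neg_mul, Complex.exp_mul_I]; simp [sub_eq_add_neg]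
  unfold dbar
  set A := fderiv ℝ h ((p.1 : ℂ) * cexp (p.2 * I)) 1
  set B := fderiv ℝ h ((p.1 : ℂ) * cexp (p.2 * I)) I
  rw [← Complex.coe_smul (2⁻¹ : ℝ), hE2]
  simp only [hE]
  have s1 : ((Real.cos p.2 : ℂ) + Real.sin p.2 * I).re = Real.cos p.2 := by
    generalize Real.cos p.2 = c
    generalize Real.sin p.2 = s
    simp
  have s2 : ((Real.cos p.2 : ℂ) + Real.sin p.2 * I).im = Real.sin p.2 := by
    generalize Real.cos p.2 = c
    generalize Real.sin p.2 = s
    simp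
  have s3 : ((p.1 : ℂ) * (((Real.cos p.2 : ℂ) + Real.sin p.2 * I) * I)).re = - (p.1 * Real.sin p.2) := by
    generalize Real.cos p.2 = c
    generalize Real.sin p.2 = s
    simp
  have s4 : ((p.1 : ℂ) * (((Real.cos p.2 : ℂ) + Real.sin p.2 * I) * I)).im = (p.1 * Real.cos p.2) := by
    generalize Real.cos p.2 = c
    generalize Real.sin p.2 = s
    simp
  rw [s1, s2, s3, s4]
  push_cast
  generalize Complex.cos (p.2:ℂ) = c
  generalize Complex.sin (p.2:ℂ) = s
  match_scalars
  · field_simp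
    ring
  · field_simp
    linear_combination s * I_sq

lemma claim_eps [CompleteSpace E] [MeasurableSpace E] [BorelSpace E] [SecondCountableTopology E]
    (h : ℂ → E) (hc : Continuous h) (M : ℝ)
    (hM : ∀ z, M ≤ ‖z‖ → h z = 0) (c : ℂ) (hd : ∀ z, z ≠ c → DifferentiableAt ℝ h z)
    (hfin : ∫⁻ ζ, ‖dbar h ζ‖ₑ * ‖ζ‖ₑ⁻¹ ≠ ⊤) (ε : ℝ) (hε : 0 < ε) (hεM : ε < M) :
    ‖∫ θ in (-Real.pi)..Real.pi, h ((ε : ℂ) * cexp (θ * I))‖ₑ ≤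
      2 * ∫⁻ ζ, ‖dbar h ζ‖ₑ * ‖ζ‖ₑ⁻¹ := by
  set f : ℝ × ℝ → E := fun p => h ((p.1 : ℂ) * cexp (p.2 * I)) with hf
  set g : ℝ × ℝ → E := fun p => (I * ((p.1⁻¹ : ℝ) : ℂ)) • h ((p.1 : ℂ) * cexp (p.2 * I)) with hg
  set dv : ℝ × ℝ → E := fun p => fderiv ℝ f p (1,0) + fderiv ℝ g p (0,1) with hdv
  have hpol : ∀ p : ℝ × ℝ, Complex.polarCoord.symm p = (p.1 : ℂ) * cexp (p.2 * I) := by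
    intro p
    rw [Complex.polarCoord_symm_apply, Complex.exp_mul_I]; simp
  set s : Set (ℝ × ℝ) := {p | p ∈ polarCoord.target ∧ (p.1 : ℂ) * cexp (p.2 * I) = c} with hs
  have hscount : s.Countable := by
    apply Set.Subsingleton.countable
    intro p hp q hq
    apply Complex.polarCoord.symm.injOn (hp.1) (hq.1)
    rw [hpol, hpol, hp.2, hq.2]
  have hsub : Set.Ioo ε M ×ˢ Set.Ioo (-Real.pi) Real.pi ⊆ polarCoord.target := by
    intro p hp
    exact ⟨hε.trans hp.1.1, hp.2⟩
  have hid : ∀ p ∈ (Set.Ioo ε M ×ˢ Set.Ioo (-Real.pi) Real.pi) \ s,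
      DifferentiableAt ℝ f p ∧ DifferentiableAt ℝ g p ∧
      dv p = (2 * cexp (-(p.2 * I))) • dbar h ((p.1 : ℂ) * cexp (p.2 * I)) := by
    intro p hp
    apply polar_identity h p (hε.trans hp.1.1.1).ne'
    apply hd
    intro hpc
    exact hp.2 ⟨hsub hp.1, hpc⟩
  have hmeas : Measurable dv :=
    (measurable_fderiv_apply_const ℝ f _).add (measurable_fderiv_apply_const ℝ g _)
  have hae : (Set.Icc ε M ×ˢ Set.Icc (-Real.pi) Real.pi : Set (ℝ × ℝ)) =ᵐ[volume]
      (Set.Ioo ε M ×ˢ Set.Ioo (-Real.pi) Real.pi : Set (ℝ × ℝ)) :=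
    Measure.set_prod_ae_eq Ioo_ae_eq_Icc.symm Ioo_ae_eq_Icc.symm
  have hbound : ∫⁻ p in Set.Icc ε M ×ˢ Set.Icc (-Real.pi) Real.pi, ‖dv p‖ₑ ≤
      2 * ∫⁻ ζ, ‖dbar h ζ‖ₑ * ‖ζ‖ₑ⁻¹ := by
    rw [setLIntegral_congr hae, ← Complex.lintegral_comp_polarCoord_symm,
      ← lintegral_const_mul' _ _ (by simp)]
    refine le_trans (lintegral_mono_ae (g := fun p => 2 * (ENNReal.ofReal p.1 •
      (‖dbar h (Complex.polarCoord.symm p)‖ₑ * ‖Complex.polarCoord.symm p‖ₑ⁻¹))) ?_)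
      (lintegral_mono_set hsub)
    have h1 : ∀ᵐ p : ℝ × ℝ, p ∉ s := hscount.ae_notMem _
    filter_upwards [ae_restrict_mem (measurableSet_Ioo.prod measurableSet_Ioo),
      ae_restrict_of_ae h1] with p hp hps
    rw [(hid p ⟨hp, hps⟩).2.2, hpol]
    have hp0 : 0 < p.1 := hε.trans hp.1.1
    have n1 : ‖(2 * cexp (-(p.2 * I)) : ℂ)‖ₑ = 2 := by
      rw [← ofReal_norm, norm_mul, ← neg_mul, ← Complex.ofReal_neg, norm_exp_ofReal_mul_I]
      simp
    have n2 : ‖((p.1 : ℂ) * cexp (p.2 * I) : ℂ)‖ₑ = ENNReal.ofReal p.1 := by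
      rw [← ofReal_norm, norm_mul, norm_exp_ofReal_mul_I]
      simp [abs_of_pos hp0]
    rw [enorm_smul, n1, n2, smul_eq_mul, mul_comm (ENNReal.ofReal p.1), mul_assoc,
      ENNReal.inv_mul_cancel (by simpa using hp0) (by simp), mul_one]
  have hint : IntegrableOn dv (Set.Icc ε M ×ˢ Set.Icc (-Real.pi) Real.pi) :=
    ⟨hmeas.aestronglyMeasurable, lt_of_le_of_lt hbound (ENNReal.mul_lt_top (by simp) hfin.lt_top)⟩
  have hpi : -Real.pi ≤ Real.pi := by linarith [Real.pi_pos]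
  have hfc : Continuous f := by
    apply hc.comp; fun_prop
  have hgc : ContinuousOn g (Set.Icc ε M ×ˢ Set.Icc (-Real.pi) Real.pi) := by
    apply ContinuousOn.smul _ hfc.continuousOn
    apply ContinuousOn.mul continuousOn_const
    apply Complex.continuous_ofReal.comp_continuousOn
    apply ContinuousOn.inv₀ continuousOn_fst
    intro p hp
    exact (hε.trans_le hp.1.1).ne'
  have hdiv := integral2_divergence_prod_of_hasFDerivAt_off_countable f g (fderiv ℝ f) (fderiv ℝ g)
    ε (-Real.pi) M Real.pi s hscount hfc.continuousOn
    (by rwa [Set.uIcc_of_le hεM.le, Set.uIcc_of_le hpi])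
    (by rw [min_eq_left hεM.le, max_eq_right hεM.le, min_eq_left hpi, max_eq_right hpi]
        intro p hp; exact (hid p hp).1.hasFDerivAt)
    (by rw [min_eq_left hεM.le, max_eq_right hεM.le, min_eq_left hpi, max_eq_right hpi]
        intro p hp; exact (hid p hp).2.1.hasFDerivAt)
    (by rwa [Set.uIcc_of_le hεM.le, Set.uIcc_of_le hpi])
  have g1 : ∀ x, g (x, Real.pi) = g (x, -Real.pi) := by
    intro x
    simp only [hg]
    congr 3
    simp [Complex.exp_neg, Complex.exp_pi_mul_I]
  have f1 : ∀ y, f (M, y) = 0 := by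
    intro y
    apply hM
    rw [norm_mul, norm_exp_ofReal_mul_I]
    simpa using le_abs_self M
  simp only [g1, f1, sub_self, intervalIntegral.integral_zero, zero_add, zero_sub] at hdiv
  have e : ‖∫ θ in (-Real.pi)..Real.pi, h ((ε : ℂ) * cexp (θ * I))‖ₑ =
      ‖∫ x in ε..M, ∫ y in (-Real.pi)..Real.pi, dv (x, y)‖ₑ := by
    rw [← enorm_neg]
    exact congrArg enorm hdiv.symm
  rw [e]
  have hint' : IntegrableOn dv (Set.Ioc ε M ×ˢ Set.Ioc (-Real.pi) Real.pi) :=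
    hint.mono_set (Set.prod_mono Set.Ioc_subset_Icc_self Set.Ioc_subset_Icc_self)
  rw [intervalIntegral.integral_of_le hεM.le]
  simp only [intervalIntegral.integral_of_le hpi]
  rw [← setIntegral_prod (μ := volume) (ν := volume) dv hint']
  refine (enorm_integral_le_lintegral_enorm _).trans (le_trans ?_ hbound)
  exact lintegral_mono_set (Set.prod_mono Set.Ioc_subset_Icc_self Set.Ioc_subset_Icc_self)

lemma cauchy_pompeiu [CompleteSpace E] [MeasurableSpace E] [BorelSpace E] [SecondCountableTopology E]
    (h : ℂ → E) (hc : Continuous h) (M : ℝ) (hM0 : 0 < M)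
    (hM : ∀ z, M ≤ ‖z‖ → h z = 0) (c : ℂ) (hd : ∀ z, z ≠ c → DifferentiableAt ℝ h z) :
    ENNReal.ofReal Real.pi * ‖h 0‖ₑ ≤ ∫⁻ ζ, ‖dbar h ζ‖ₑ * ‖ζ‖ₑ⁻¹ := by
  by_cases hfin : ∫⁻ ζ, ‖dbar h ζ‖ₑ * ‖ζ‖ₑ⁻¹ = ⊤
  · rw [hfin]; exact le_top
  have hcont : Continuous fun ε : ℝ => ∫ θ in (-Real.pi)..Real.pi, h ((ε : ℂ) * cexp (θ * I)) := by
    apply intervalIntegral.continuous_parametric_intervalIntegral_of_continuous'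
    apply hc.comp
    fun_prop
  have ht : Tendsto (fun ε : ℝ => ‖∫ θ in (-Real.pi)..Real.pi, h ((ε : ℂ) * cexp (θ * I))‖ₑ)
      (𝓝[>] 0) (𝓝 ‖∫ θ in (-Real.pi)..Real.pi, h (((0:ℝ) : ℂ) * cexp (θ * I))‖ₑ) :=
    (hcont.enorm.tendsto 0).mono_left nhdsWithin_le_nhds
  have hle := le_of_tendsto ht (b := 2 * ∫⁻ ζ, ‖dbar h ζ‖ₑ * ‖ζ‖ₑ⁻¹) (by
    filter_upwards [Ioo_mem_nhdsGT hM0] with ε hε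
    exact claim_eps h hc M hM c hd hfin ε hε.1 hε.2)
  have e : ‖∫ θ in (-Real.pi)..Real.pi, h (((0:ℝ) : ℂ) * cexp (θ * I))‖ₑ =
      2 * (ENNReal.ofReal Real.pi * ‖h 0‖ₑ) := by
    simp only [ofReal_zero, zero_mul, intervalIntegral.integral_const]
    rw [enorm_smul, ← mul_assoc, Real.enorm_eq_ofReal_abs]
    congr 1
    rw [show Real.pi - -Real.pi = 2 * Real.pi by ring, abs_of_pos (by positivity),
      ENNReal.ofReal_mul (by norm_num)]
    simp
  rw [e] at hle
  exact (ENNReal.mul_le_mul_iff_right (by simp) (by simp)).1 hle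

lemma dbar_translate (g : ℂ → E) (z ζ : ℂ) : dbar (fun w => g (z + w)) ζ = dbar g (z + ζ) := by
  unfold dbar
  rw [fderiv_comp_add_left]

lemma kernel_bound (ζ : ℂ) (R : ℝ) (hR : 0 < R) :
    ∫⁻ z in ball ζ R, ‖ζ - z‖ₑ⁻¹ ≤ ENNReal.ofReal (2 * Real.pi * R) := by
  rw [← lintegral_indicator measurableSet_ball]
  rw [← lintegral_add_left_eq_self _ ζ, ← Complex.lintegral_comp_polarCoord_symm]
  have : ∫⁻ p in polarCoord.target, ENNReal.ofReal p.1 •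
     (ball ζ R).indicator (fun z => ‖ζ - z‖ₑ⁻¹) (ζ + Complex.polarCoord.symm p) ≤
     ∫⁻ p in polarCoord.target, (Set.Ioo 0 R ×ˢ Set.Ioo (-Real.pi) Real.pi).indicator 1 p := by
    apply setLIntegral_mono' polarCoord.open_target.measurableSet
    intro p hp
    have hp0 : 0 < p.1 := hp.1
    by_cases hb : ζ + Complex.polarCoord.symm p ∈ ball ζ R
    · rw [Set.indicator_of_mem hb, Set.indicator_of_mem]
      · have : ‖ζ - (ζ + Complex.polarCoord.symm p)‖ₑ = ENNReal.ofReal p.1 := by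
          rw [← ofReal_norm, sub_add_cancel_left, norm_neg, norm_polarCoord_symm,
            abs_of_pos hp0]
        rw [this, smul_eq_mul, ENNReal.mul_inv_cancel (by simpa using hp0) (by simp)]
        simp
      · refine ⟨⟨hp0, ?_⟩, hp.2⟩
        rw [mem_ball, dist_eq_norm, add_sub_cancel_left, norm_polarCoord_symm, abs_of_pos hp0] at hb
        exact hb
    · rw [Set.indicator_of_notMem hb]; simp
  refine this.trans ((setLIntegral_le_lintegral _ _).trans ?_)
  rw [lintegral_indicator_one (measurableSet_Ioo.prod measurableSet_Ioo), Measure.volume_eq_prod,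
    Measure.prod_prod, Real.volume_Ioo, Real.volume_Ioo, ← ENNReal.ofReal_mul (by linarith)]
  apply ENNReal.ofReal_le_ofReal
  apply le_of_eq; ring

lemma l1_bound [CompleteSpace E] [MeasurableSpace E] [BorelSpace E] [SecondCountableTopology E]
    (g : ℂ → E) (hc : Continuous g) (R : ℝ) (hR : 0 < R)
    (hM : ∀ z, R ≤ ‖z‖ → g z = 0) (hd : ∀ z, z ≠ 0 → DifferentiableAt ℝ g z) :
    ∫⁻ z, ‖g z‖ₑ ≤ ENNReal.ofReal (4 * R) * ∫⁻ z, ‖dbar g z‖ₑ := by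
  have hdz : ∀ z, R < ‖z‖ → dbar g z = 0 := by
    intro z hz
    have : g =ᶠ[𝓝 z] fun _ => 0 := by
      filter_upwards [(isOpen_lt continuous_const continuous_norm).mem_nhds hz] with w hw
      exact hM w (le_of_lt hw)
    unfold dbar
    rw [this.fderiv_eq]; simp
  have hmeas : Measurable (dbar g) := by
    unfold dbar
    exact ((measurable_fderiv_apply_const ℝ g _).add
      ((measurable_fderiv_apply_const ℝ g _).const_smul I)).const_smul (2⁻¹ : ℝ)
  have hpt : ∀ z, ENNReal.ofReal Real.pi * ‖g z‖ₑ ≤ ∫⁻ ζ, ‖dbar g ζ‖ₑ * ‖ζ - z‖ₑ⁻¹ := by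
    intro z
    have := cauchy_pompeiu (fun w => g (z + w)) (hc.comp (by fun_prop)) (R + ‖z‖) (by positivity)
      (by intro w hw
          apply hM
          have := norm_sub_le (z + w) z
          rw [add_sub_cancel_left] at this
          linarith) (-z)
      (by intro w hw
          have h1 : z + w ≠ 0 := fun h => hw (by linear_combination h)
          exact (hd _ h1).comp w (by fun_prop))
    simp only [dbar_translate, add_zero] at this
    refine this.trans (le_of_eq ?_)
    rw [← lintegral_add_left_eq_self (fun ζ => ‖dbar g ζ‖ₑ * ‖ζ - z‖ₑ⁻¹) z]
    simp
  have hpi : ENNReal.ofReal Real.pi ≠ 0 := by simpa using Real.pi_pos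
  have h1 : ∫⁻ z, ‖g z‖ₑ = ∫⁻ z in ball 0 R, ‖g z‖ₑ := by
    rw [← lintegral_indicator measurableSet_ball]
    congr 1; ext z
    by_cases hz : z ∈ ball (0:ℂ) R
    · rw [Set.indicator_of_mem hz]
    · rw [Set.indicator_of_notMem hz, hM z (by simpa using hz)]; simp
  rw [← ENNReal.mul_le_mul_iff_right hpi ENNReal.ofReal_ne_top]
  calc ENNReal.ofReal Real.pi * ∫⁻ z, ‖g z‖ₑ
      = ∫⁻ z in ball 0 R, ENNReal.ofReal Real.pi * ‖g z‖ₑ := by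
        rw [h1, lintegral_const_mul' _ _ ENNReal.ofReal_ne_top]
    _ ≤ ∫⁻ z in ball 0 R, ∫⁻ ζ, ‖dbar g ζ‖ₑ * ‖ζ - z‖ₑ⁻¹ := lintegral_mono fun z => hpt z
    _ = ∫⁻ ζ, ∫⁻ z in ball 0 R, ‖dbar g ζ‖ₑ * ‖ζ - z‖ₑ⁻¹ := by
        apply lintegral_lintegral_swap
        apply Measurable.aemeasurable
        exact (hmeas.comp measurable_snd).enorm.mul
          ((measurable_snd.sub measurable_fst).enorm.inv)
    _ ≤ ∫⁻ ζ, ENNReal.ofReal (4 * Real.pi * R) * ‖dbar g ζ‖ₑ := by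
        apply lintegral_mono
        intro ζ
        simp only
        by_cases hζ : R < ‖ζ‖
        · rw [hdz ζ hζ]; simp
        · rw [lintegral_const_mul' _ _ enorm_ne_top, mul_comm]
          gcongr
          calc ∫⁻ z in ball 0 R, ‖ζ - z‖ₑ⁻¹ ≤ ∫⁻ z in ball ζ (2*R), ‖ζ - z‖ₑ⁻¹ := by
                apply lintegral_mono_set
                apply ball_subset_ball'
                rw [dist_zero_left]; linarith
            _ ≤ _ := by
                refine (kernel_bound ζ (2*R) (by positivity)).trans (le_of_eq ?_)
                congr 1; ring
    _ = _ := by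
        rw [lintegral_const_mul' _ _ ENNReal.ofReal_ne_top, ← mul_assoc, ← ENNReal.ofReal_mul Real.pi_pos.le]
        congr 2; ring

lemma dbar_smul_holo (a : ℂ → ℂ) (v : ℂ → E) (z : ℂ) (ha : DifferentiableAt ℂ a z)
    (hv : DifferentiableAt ℝ v z) : dbar (fun w => a w • v w) z = a z • dbar v z := by
  have h1 : HasFDerivAt a _ z := ha.hasDerivAt.hasFDerivAt.restrictScalars ℝ
  have h2 : HasFDerivAt (fun w => a w • v w) _ z := h1.smul hv.hasFDerivAt
  unfold dbar
  rw [h2.fderiv]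
  simp only [← Complex.coe_smul]
  simp
  match_scalars
  · ring
  · linear_combination (1/2) * deriv a z * I_sq
  · ring

lemma g_continuous (v : ℂ → E) (hv : Continuous v)
    (hflat : ∀ N : ℕ, 0 < N →
      (fun z : ℂ => ‖v z‖) =O[𝓝 (0 : ℂ)] fun z : ℂ => ‖z‖ ^ N) (N : ℕ) (hN : 0 < N) :
    Continuous (fun z : ℂ => (z ^ N)⁻¹ • v z) := by
  rw [continuous_iff_continuousAt]
  intro z
  by_cases hz : z = 0
  · subst hz
    have h0 : ((0:ℂ) ^ N)⁻¹ • v 0 = 0 := by simp [hN.ne']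
    rw [ContinuousAt, h0]
    obtain ⟨B, hB⟩ := (hflat (N+1) (by omega)).bound
    have ht : Tendsto (fun z : ℂ => B * ‖z‖) (𝓝 0) (𝓝 0) := by
      have : Continuous (fun z : ℂ => B * ‖z‖) := by fun_prop
      simpa using this.tendsto 0
    refine squeeze_zero_norm' ?_ ht
    filter_upwards [hB] with w hw
    by_cases hw0 : w = 0
    · subst hw0; simp [hN.ne']
    have hpos : 0 < ‖w‖ := norm_pos_iff.2 hw0
    rw [norm_smul, norm_inv, norm_pow, inv_mul_le_iff₀ (by positivity)]
    simp only [norm_norm, norm_pow] at hw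
    calc ‖v w‖ ≤ _ := hw
      _ = _ := by ring
  · exact ((continuousAt_id.pow N).inv₀ (pow_ne_zero _ hz)).smul hv.continuousAt

lemma g_bound [CompleteSpace E] [MeasurableSpace E] [BorelSpace E] [SecondCountableTopology E]
    (v : ℂ → E) (hv : ContDiff ℝ 1 v) (C R K : ℝ) (hC : 0 < C) (hR : 0 < R)
    (hCR : 4 * R * C ≤ 1 / 2) (hK0 : 0 ≤ K)
    (hM : ∀ z, R ≤ ‖z‖ → v z = 0)
    (hK : ∀ z, ‖dbar v z‖ ≤ K)
    (hin : ∀ z, ‖z‖ < R / 2 → ‖dbar v z‖ ≤ C * ‖v z‖)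
    (hflat : ∀ N : ℕ, 0 < N →
      (fun z : ℂ => ‖v z‖) =O[𝓝 (0 : ℂ)] fun z : ℂ => ‖z‖ ^ N) (N : ℕ) (hN : 0 < N) :
    ∫⁻ z, ‖(z ^ N)⁻¹ • v z‖ₑ ≤ ENNReal.ofReal
      (2 * (4 * R * (volume (closedBall (0:ℂ) R)).toReal * K * (2 / R) ^ N)) := by
  set g : ℂ → E := fun z => (z ^ N)⁻¹ • v z with hg
  have hgc : Continuous g := g_continuous v hv.continuous hflat N hN
  have hgR : ∀ z, R ≤ ‖z‖ → g z = 0 := fun z hz => by simp [hg, hM z hz]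
  have hvd : Differentiable ℝ v := hv.differentiable (by norm_num)
  have hinv : ∀ z : ℂ, z ≠ 0 → DifferentiableAt ℂ (fun w : ℂ => (w ^ N)⁻¹) z := fun z hz =>
    (differentiableAt_id.pow N).inv (pow_ne_zero _ hz)
  have hgd : ∀ z, z ≠ 0 → DifferentiableAt ℝ g z := fun z hz =>
    ((hinv z hz).restrictScalars ℝ).smul (hvd z)
  have hl1 := l1_bound g hgc R hR hgR hgd
  have hgi : HasCompactSupport g := by
    apply HasCompactSupport.intro (isCompact_closedBall (0:ℂ) R)
    intro z hz
    apply hgR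
    simp at hz; exact hz.le
  have hfin : ∫⁻ z, ‖g z‖ₑ ≠ ⊤ := (hgc.integrable_of_hasCompactSupport hgi).2.ne
  have hvolfin : volume (closedBall (0:ℂ) R) ≠ ⊤ := measure_closedBall_lt_top.ne
  have hdb : ∀ᵐ z : ℂ, ‖dbar g z‖ₑ ≤ ENNReal.ofReal C * ‖g z‖ₑ +
      (closedBall (0:ℂ) R).indicator (fun _ => ENNReal.ofReal (K * (2 / R) ^ N)) z := by
    filter_upwards [Measure.ae_ne volume (0:ℂ)] with z hz
    have hzp : 0 < ‖z‖ := norm_pos_iff.2 hz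
    have e : dbar g z = (z ^ N)⁻¹ • dbar v z := dbar_smul_holo _ v z (hinv z hz) (hvd z)
    by_cases h1 : ‖z‖ < R / 2
    · refine le_trans ?_ le_self_add
      rw [← ofReal_norm, ← ofReal_norm, ← ENNReal.ofReal_mul hC.le]
      apply ENNReal.ofReal_le_ofReal
      rw [e, hg]
      simp only [norm_smul]
      calc _ ≤ ‖(z ^ N)⁻¹‖ * (C * ‖v z‖) := by gcongr; exact hin z h1
        _ = _ := by ring
    · push Not at h1
      by_cases h2 : ‖z‖ ≤ R
      · refine le_trans ?_ le_add_self
        rw [Set.indicator_of_mem (by simpa using h2), ← ofReal_norm]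
        apply ENNReal.ofReal_le_ofReal
        rw [e, norm_smul, norm_inv, norm_pow, mul_comm, ← inv_pow]
        gcongr
        · exact hK z
        · rw [← inv_div]; gcongr
      · push Not at h2
        have : dbar v z = 0 := by
          have : v =ᶠ[𝓝 z] fun _ => 0 := by
            filter_upwards [(isOpen_lt continuous_const continuous_norm).mem_nhds h2] with w hw
            exact hM w (le_of_lt hw)
          unfold dbar
          rw [this.fderiv_eq]; simp
        rw [e, this]; simp
  have hA : ∫⁻ z, ‖dbar g z‖ₑ ≤ ENNReal.ofReal C * (∫⁻ z, ‖g z‖ₑ) +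
      ENNReal.ofReal (K * (2 / R) ^ N) * volume (closedBall (0:ℂ) R) := by
    refine (lintegral_mono_ae hdb).trans (le_of_eq ?_)
    rw [lintegral_add_left (hgc.enorm.measurable.const_mul _),
      lintegral_const_mul' _ _ ENNReal.ofReal_ne_top,
      lintegral_indicator_const measurableSet_closedBall]
  replace hl1 := hl1.trans (mul_le_mul_right hA _)
  change ∫⁻ z, ‖g z‖ₑ ≤ _
  set A := ∫⁻ z, ‖g z‖ₑ
  set V := volume (closedBall (0:ℂ) R)
  rw [← ENNReal.ofReal_toReal hfin, ← ENNReal.ofReal_toReal hvolfin] at hl1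
  rw [← ENNReal.ofReal_toReal hfin]
  have ha : 0 ≤ A.toReal := ENNReal.toReal_nonneg
  have hV : 0 ≤ V.toReal := ENNReal.toReal_nonneg
  rw [← ENNReal.ofReal_mul hC.le, ← ENNReal.ofReal_mul (by positivity),
    ← ENNReal.ofReal_add (by positivity) (by positivity), ← ENNReal.ofReal_mul (by positivity),
    ENNReal.ofReal_le_ofReal_iff (by positivity)] at hl1
  apply ENNReal.ofReal_le_ofReal
  have : 4 * R * C * A.toReal ≤ 1 / 2 * A.toReal := by gcongr
  nlinarith

lemma core [CompleteSpace E] [MeasurableSpace E] [BorelSpace E] [SecondCountableTopology E]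
    (v : ℂ → E) (hv : ContDiff ℝ 1 v) (C R K : ℝ) (hC : 0 < C) (hR : 0 < R)
    (hCR : 4 * R * C ≤ 1 / 2) (hK0 : 0 ≤ K)
    (hM : ∀ z, R ≤ ‖z‖ → v z = 0)
    (hK : ∀ z, ‖dbar v z‖ ≤ K)
    (hin : ∀ z, ‖z‖ < R / 2 → ‖dbar v z‖ ≤ C * ‖v z‖)
    (hflat : ∀ N : ℕ, 0 < N →
      (fun z : ℂ => ‖v z‖) =O[𝓝 (0 : ℂ)] fun z : ℂ => ‖z‖ ^ N) :
    ∀ z ∈ ball (0:ℂ) (R / 4), v z = 0 := by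
  have hv0 : v 0 = 0 := by
    have := (hflat 1 one_pos).eq_zero_imp.self_of_nhds
    simpa using this
  set Q := 4 * R * (volume (closedBall (0:ℂ) R)).toReal * K with hQ
  have hJ : ∀ N : ℕ, 0 < N → ∫⁻ z in ball (0:ℂ) (R/4), ‖v z‖ₑ ≤
      ENNReal.ofReal (2 * Q * (1/2) ^ N) := by
    intro N hN
    calc ∫⁻ z in ball (0:ℂ) (R/4), ‖v z‖ₑ
        ≤ ∫⁻ z in ball (0:ℂ) (R/4), ENNReal.ofReal ((R/4)^N) * ‖(z ^ N)⁻¹ • v z‖ₑ := by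
          apply setLIntegral_mono' measurableSet_ball
          intro z hz
          by_cases hz0 : z = 0
          · subst hz0; simp [hv0]
          have hzp : 0 < ‖z‖ := norm_pos_iff.2 hz0
          have hz1 : ‖z‖ < R / 4 := by simpa using hz
          rw [← ofReal_norm, ← ofReal_norm, ← ENNReal.ofReal_mul (by positivity)]
          apply ENNReal.ofReal_le_ofReal
          rw [norm_smul, norm_inv, norm_pow, ← mul_assoc, ← div_eq_mul_inv, ← div_pow]
          have : 1 ≤ (R / 4 / ‖z‖) ^ N := one_le_pow₀ (by rw [one_le_div hzp]; exact hz1.le)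
          nlinarith [norm_nonneg (v z)]
      _ ≤ ENNReal.ofReal ((R/4)^N) * ∫⁻ z, ‖(z ^ N)⁻¹ • v z‖ₑ := by
          rw [lintegral_const_mul' _ _ ENNReal.ofReal_ne_top]
          gcongr
          exact Measure.restrict_le_self
      _ ≤ ENNReal.ofReal ((R/4)^N) * ENNReal.ofReal (2 * (Q * (2 / R) ^ N)) := by
          gcongr
          exact g_bound v hv C R K hC hR hCR hK0 hM hK hin hflat N hN
      _ = _ := by
          rw [← ENNReal.ofReal_mul (by positivity)]
          congr 1
          have : (1/2 : ℝ)^N = (R/4)^N * (2/R)^N := by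
            rw [← mul_pow]; congr 1; field_simp; norm_num
          rw [this]; ring
  have hlim : Tendsto (fun N : ℕ => ENNReal.ofReal (2 * Q * (1/2) ^ N)) atTop (𝓝 0) := by
    have := (tendsto_pow_atTop_nhds_zero_of_lt_one (r := (1/2:ℝ)) (by norm_num) (by norm_num)).const_mul
      (2 * Q)
    rw [mul_zero] at this
    simpa using ENNReal.tendsto_ofReal this
  have hJ0 : ∫⁻ z in ball (0:ℂ) (R/4), ‖v z‖ₑ = 0 := by
    apply le_antisymm _ (zero_le)
    apply ge_of_tendsto hlim
    filter_upwards [eventually_gt_atTop 0] with N hN using hJ N hN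
  rw [lintegral_eq_zero_iff hv.continuous.enorm.measurable] at hJ0
  have hae : v =ᵐ[volume.restrict (ball (0:ℂ) (R/4))] (fun _ => (0:E)) := by
    filter_upwards [hJ0] with z hz
    simpa using hz
  have := Measure.eqOn_open_of_ae_eq hae isOpen_ball hv.continuous.continuousOn continuousOn_const
  exact fun z hz => this hz

lemma main_generic [CompleteSpace E] [MeasurableSpace E] [BorelSpace E] [SecondCountableTopology E]
    (u : ℂ → E)
    (hu : ContDiffOn ℝ 1 u (ball (0 : ℂ) 1))
    (C : ℝ) (hC : 0 < C)
    (hineq : ∀ z ∈ ball (0 : ℂ) 1, ‖dbar u z‖ ≤ C * ‖u z‖)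
    (hflat : ∀ N : ℕ, 0 < N →
      (fun z : ℂ => ‖u z‖) =O[𝓝 (0 : ℂ)] fun z : ℂ => ‖z‖ ^ N) :
    ∃ V ∈ 𝓝 (0 : ℂ), ∀ z ∈ V ∩ ball (0 : ℂ) 1, u z = 0 := by
  obtain ⟨R, hR, hR1, hCR⟩ : ∃ R : ℝ, 0 < R ∧ R ≤ 1/2 ∧ 4 * R * C ≤ 1/2 := by
    refine ⟨min (1/2) (1/(8*C)), by positivity, min_le_left _ _, ?_⟩
    calc 4 * min (1/2) (1/(8*C)) * C ≤ 4 * (1/(8*C)) * C := by gcongr; exact min_le_right _ _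
      _ = 1/2 := by field_simp; norm_num
  let χ : ContDiffBump (0:ℂ) := ⟨R/2, R, by positivity, by linarith⟩
  set v : ℂ → E := fun z => χ z • u z with hvdef
  have hM : ∀ z, R ≤ ‖z‖ → v z = 0 := by
    intro z hz
    have : χ z = 0 := χ.zero_of_le_dist (by simpa using hz)
    simp [hvdef, this]
  have hv : ContDiff ℝ 1 v := by
    rw [contDiff_iff_contDiffAt]
    intro z
    by_cases hz : ‖z‖ < 1
    · have : ContDiffAt ℝ 1 u z := hu.contDiffAt (isOpen_ball.mem_nhds (by simpa using hz))
      exact χ.contDiffAt.smul this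
    · have : v =ᶠ[𝓝 z] fun _ => 0 := by
        filter_upwards [(isOpen_lt continuous_const continuous_norm).mem_nhds
          (show R < ‖z‖ by linarith)] with w hw
        exact hM w (le_of_lt hw)
      exact contDiffAt_const.congr_of_eventuallyEq this
  have huv : ∀ z, ‖z‖ < R/2 → v =ᶠ[𝓝 z] u := by
    intro z hz
    filter_upwards [χ.eventuallyEq_one_of_mem_ball (x := z) (by simpa using hz)] with w hw
    simp [hvdef, hw]
  have hdbc : Continuous (dbar v) := by
    have h1 : Continuous (fderiv ℝ v) := hv.continuous_fderiv (by norm_num)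
    unfold dbar
    fun_prop
  have hcs : HasCompactSupport (dbar v) := by
    apply HasCompactSupport.intro (isCompact_closedBall (0:ℂ) R)
    intro z hz
    have h2 : R < ‖z‖ := by simpa using hz
    have : v =ᶠ[𝓝 z] fun _ => 0 := by
      filter_upwards [(isOpen_lt continuous_const continuous_norm).mem_nhds h2] with w hw
      exact hM w (le_of_lt hw)
    unfold dbar
    rw [this.fderiv_eq]; simp
  obtain ⟨K, hK⟩ := hcs.exists_bound_of_continuous hdbc
  have hfl : ∀ N : ℕ, 0 < N →
      (fun z : ℂ => ‖v z‖) =O[𝓝 (0 : ℂ)] fun z : ℂ => ‖z‖ ^ N := by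
    intro N hN
    refine (hflat N hN).congr' ?_ EventuallyEq.rfl
    filter_upwards [huv 0 (by simpa using hR)] with z hz
    rw [hz]
  have := core v hv C R K hC hR hCR ((norm_nonneg _).trans (hK 0)) hM hK (by
    intro z hz
    have e := huv z hz
    have : dbar v z = dbar u z := by unfold dbar; rw [e.fderiv_eq]
    rw [this, e.eq_of_nhds]
    exact hineq z (by simp; linarith)) hfl
  refine ⟨ball 0 (R/4), ball_mem_nhds _ (by positivity), ?_⟩
  intro z hz
  rw [← (huv z (by have := hz.1; simp at this; linarith)).eq_of_nhds]
  exact this z hz.1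
end

/-- if `u : D → ℂⁿ` is `C¹`, satisfies `‖∂u/∂z̄‖ ≤ C·‖u‖` on `D`, and
vanishes to infinite order at `0`, then `u ≡ 0` on a neighborhood of `0` in `D`. -/
theorem infinite_order_vanishing (n : ℕ)
    (u : ℂ → EuclideanSpace ℂ (Fin n))
    (hu : ContDiffOn ℝ 1 u (ball (0 : ℂ) 1))
    (C : ℝ) (hC : 0 < C)
    (hineq : ∀ z ∈ ball (0 : ℂ) 1, ‖dbar u z‖ ≤ C * ‖u z‖)
    (hflat : ∀ N : ℕ, 0 < N →
      (fun z : ℂ => ‖u z‖) =O[𝓝 (0 : ℂ)] fun z : ℂ => ‖z‖ ^ N) :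
    ∃ V ∈ 𝓝 (0 : ℂ), ∀ z ∈ V ∩ ball (0 : ℂ) 1, u z = 0 :=
  main_generic u hu C hC hineq hflat
end

section
/- Let u : D → ℂⁿ be a C¹ map satisfying ‖∂u/∂z̄(z)‖ ≤ C·‖u(z)‖ for all z ∈ D and some constant C > 0. If the zero set {z ∈ D : u(z) = 0} has an accumulation point in D, then u ≡ 0 on D. -/
open Complex MeasureTheory Metric Filter Topology

section ZSA

variable {E : Type*} [NormedAddCommGroup E] [NormedSpace ℂ E]

lemma ker_lint (ρ : ℝ) (hρ : 0 < ρ) :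
    ∫⁻ z in ball (0:ℂ) ρ, ENNReal.ofReal ‖z‖⁻¹ ≤ ENNReal.ofReal (2 * Real.pi * ρ) := by
  rw [← lintegral_indicator measurableSet_ball, ← Complex.lintegral_comp_polarCoord_symm]
  have h : ∀ p ∈ polarCoord.target, ENNReal.ofReal p.1 • (ball (0:ℂ) ρ).indicator (fun z => ENNReal.ofReal ‖z‖⁻¹) (Complex.polarCoord.symm p) ≤ (Set.Ioo 0 ρ ×ˢ Set.Ioo (-Real.pi) Real.pi).indicator (fun _ => 1) p := by
    rintro ⟨r, t⟩ hp
    rw [polarCoord_target] at hp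
    obtain ⟨h1, h2⟩ := hp
    simp only [Set.mem_Ioi] at h1
    have hn : ‖Complex.polarCoord.symm (r, t)‖ = r := by
      rw [Complex.norm_polarCoord_symm, abs_of_pos h1]
    by_cases h3 : r < ρ
    · rw [Set.indicator_of_mem (by rw [mem_ball_zero_iff, hn]; exact h3), Set.indicator_of_mem (by exact ⟨⟨h1, h3⟩, h2⟩), hn]
      simp only [smul_eq_mul]
      rw [← ENNReal.ofReal_mul h1.le, mul_inv_cancel₀ h1.ne', ENNReal.ofReal_one]
    · rw [Set.indicator_of_notMem (by rw [mem_ball_zero_iff, hn]; exact h3)]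
      simp
  refine (setLIntegral_mono' polarCoord.open_target.measurableSet h).trans ?_
  refine (setLIntegral_le_lintegral _ _).trans ?_
  rw [lintegral_indicator (measurableSet_Ioo.prod measurableSet_Ioo)]
  simp only [lintegral_const, one_mul, Measure.restrict_apply_univ]
  rw [Measure.volume_eq_prod, Measure.prod_prod, Real.volume_Ioo, Real.volume_Ioo, ← ENNReal.ofReal_mul (by linarith)]
  apply ENNReal.ofReal_le_ofReal
  apply le_of_eq; ring

lemma ker_lint' (ζ z₀ : ℂ) (R : ℝ) (hR : 0 < R) (h : ζ ∈ closedBall z₀ R) :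
    ∫⁻ z in ball z₀ (2*R), ENNReal.ofReal ‖z - ζ‖⁻¹ ≤ ENNReal.ofReal (6 * Real.pi * R) := by
  have h1 : ball z₀ (2*R) ⊆ ball ζ (3*R) := by
    apply ball_subset_ball'
    rw [dist_comm]; rw [mem_closedBall] at h; linarith
  refine (lintegral_mono_set h1).trans ?_
  rw [← lintegral_indicator measurableSet_ball]
  have : (fun z => (ball ζ (3*R)).indicator (fun z => ENNReal.ofReal ‖z - ζ‖⁻¹) z) = fun z => (fun w => (ball (0:ℂ) (3*R)).indicator (fun z => ENNReal.ofReal ‖z‖⁻¹) w) (z - ζ) := by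
    funext z
    simp [Set.indicator, dist_eq_norm]
  rw [this, lintegral_sub_right_eq_self (fun w => (ball (0:ℂ) (3*R)).indicator (fun z => ENNReal.ofReal ‖z‖⁻¹) w), lintegral_indicator measurableSet_ball]
  refine (ker_lint (3*R) (by linarith)).trans (le_of_eq ?_)
  congr 1; ring

lemma dbar_polar (F : ℂ → E) (z : ℂ) (c s r : ℝ) (hr : 0 < r) (h : c^2 + s^2 = 1)  :
    r • (((r:ℂ) * (c + s * Complex.I))⁻¹ • dbar F z) =
    (2⁻¹ : ℝ) • (fderiv ℝ F z (c + s * Complex.I) + Complex.I • fderiv ℝ F z (-s + c * Complex.I)) := by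
  have hinv : ((r:ℂ) * (c + s * Complex.I))⁻¹ = (r:ℂ)⁻¹ * (c - s * Complex.I) := by
    have hr' : (r:ℂ) ≠ 0 := by exact_mod_cast hr.ne'
    have h' : (c:ℂ)^2 + (s:ℂ)^2 = 1 := by exact_mod_cast h
    rw [mul_inv]
    congr 1
    apply inv_eq_of_mul_eq_one_right
    linear_combination h' - s^2 * Complex.I_sq
  have h1 : fderiv ℝ F z (c + s * Complex.I) = (c:ℂ) • fderiv ℝ F z 1 + (s:ℂ) • fderiv ℝ F z Complex.I := by
    have : (c + s * Complex.I : ℂ) = c • (1:ℂ) + s • Complex.I := by simp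
    rw [this, map_add, map_smul, map_smul]
    simp only [Complex.coe_smul]
  have h2 : fderiv ℝ F z (-s + c * Complex.I) = (-s:ℂ) • fderiv ℝ F z 1 + (c:ℂ) • fderiv ℝ F z Complex.I := by
    have : (-s + c * Complex.I : ℂ) = (-s) • (1:ℂ) + c • Complex.I := by simp
    rw [this, map_add, map_smul, map_smul]
    rw [← Complex.ofReal_neg]
    simp only [Complex.coe_smul]
  have hr' : (r:ℂ) ≠ 0 := by exact_mod_cast hr.ne'
  rw [hinv, h1, h2, dbar, ← Complex.coe_smul r, ← Complex.coe_smul 2⁻¹, ← Complex.coe_smul 2⁻¹]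
  match_scalars <;> field_simp
  · ring
  · linear_combination (-s:ℂ) * Complex.I_sq

lemma cp_int (G : ℝ × ℝ → E) (hG : Continuous G) (R : ℝ) (h0 : ∀ r t, R < r → G (r, t) = 0) :
    IntegrableOn G (Set.Ioi 0 ×ˢ Set.Ioo (-Real.pi) Real.pi) := by
  have h1 : IntegrableOn G (Set.Icc 0 R ×ˢ Set.Icc (-Real.pi) Real.pi) :=
    hG.continuousOn.integrableOn_compact (isCompact_Icc.prod isCompact_Icc)
  refine h1.of_forall_sdiff_eq_zero ((measurableSet_Ioi.prod measurableSet_Ioo)) ?_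
  rintro ⟨r, t⟩ ⟨⟨ha, hb⟩, hc⟩
  apply h0
  by_contra hh
  apply hc
  exact ⟨⟨le_of_lt ha, not_lt.mp hh⟩, ⟨hb.1.le, hb.2.le⟩⟩

noncomputable abbrev pol (p : ℝ × ℝ) : ℂ := p.1 * (Real.cos p.2 + Real.sin p.2 * Complex.I)

lemma pol_cont : Continuous pol := by
  unfold pol; fun_prop

lemma pol_norm (p : ℝ × ℝ) : ‖pol p‖ = |p.1| := by
  rw [← Complex.norm_polarCoord_symm, Complex.polarCoord_symm_apply]

lemma cp_zero [CompleteSpace E] (F : ℂ → E) (hF : ContDiff ℝ 1 F) (hs : HasCompactSupport F) :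
    ∫ z : ℂ, z⁻¹ • dbar F z = -(Real.pi • F 0) := by
  have hD := hF.continuous_fderiv (by simp)
  have hdiff : Differentiable ℝ F := hF.differentiable (by simp)
  obtain ⟨R, hR⟩ := hs.isCompact.isBounded.subset_closedBall (0:ℂ)
  have hz : ∀ z : ℂ, R < ‖z‖ → fderiv ℝ F z = 0 := by
    intro z hz
    by_contra hh
    have := hR (support_fderiv_subset ℝ (f := F) hh)
    simp at this; linarith
  have hz0 : ∀ z : ℂ, R < ‖z‖ → F z = 0 := by
    intro z hz
    by_contra hh
    have := hR (subset_tsupport F hh)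
    simp at this; linarith
  set A : ℝ × ℝ → E := fun p => fderiv ℝ F (pol p) (Real.cos p.2 + Real.sin p.2 * Complex.I) with hA
  set B : ℝ × ℝ → E := fun p => Complex.I • fderiv ℝ F (pol p) (-Real.sin p.2 + Real.cos p.2 * Complex.I) with hB
  have hpc := pol_cont
  have hAc : Continuous A := by
    refine (hD.comp hpc).clm_apply (by fun_prop)
  have hBc : Continuous B := by
    refine ((hD.comp hpc).clm_apply (by fun_prop)).const_smul _
  have hpol : ∀ r t : ℝ, max R 0 < r → R < ‖pol (r, t)‖ := by
    intro r t h
    rw [pol_norm]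
    exact lt_of_lt_of_le ((le_max_left _ _).trans_lt h) (le_abs_self _)
  have hAi := cp_int A hAc (max R 0) (by
    intro r t h
    simp only [hA]; rw [hz _ (hpol r t h)]; simp)
  have hBi := cp_int B hBc (max R 0) (by
    intro r t h
    simp only [hB]; rw [hz _ (hpol r t h)]; simp)
  have key : ∫ z : ℂ, z⁻¹ • dbar F z = ∫ p in Set.Ioi (0:ℝ) ×ˢ Set.Ioo (-Real.pi) Real.pi, (2⁻¹:ℝ) • (A p + B p) := by
    rw [← Complex.integral_comp_polarCoord_symm, polarCoord_target]
    apply setIntegral_congr_fun (measurableSet_Ioi.prod measurableSet_Ioo)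
    rintro ⟨r, t⟩ ⟨h1, h2⟩
    simp only [Complex.polarCoord_symm_apply]
    exact dbar_polar F _ _ _ r h1 (Real.cos_sq_add_sin_sq t)
  have hder : ∀ r t : ℝ, HasDerivAt (fun r => F (pol (r, t))) (A (r, t)) r := by
    intro r t
    have h1 : HasDerivAt (fun r : ℝ => pol (r, t)) (Real.cos t + Real.sin t * Complex.I) r := by
      unfold pol
      simpa using (Complex.ofRealCLM.hasDerivAt (x := r)).mul_const (Real.cos t + Real.sin t * Complex.I : ℂ)
    exact (hdiff _).hasFDerivAt.comp_hasDerivAt r h1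
  have hder2 : ∀ r t : ℝ, HasDerivAt (fun t => Complex.I • F (pol (r, t))) (r • B (r, t)) t := by
    intro r t
    have h1 : HasDerivAt (fun t : ℝ => pol (r, t)) (r • (-Real.sin t + Real.cos t * Complex.I)) t := by
      unfold pol
      have := ((Real.hasDerivAt_cos t).ofReal_comp.add ((Real.hasDerivAt_sin t).ofReal_comp.mul_const Complex.I)).const_mul (r:ℂ)
      simpa [mul_add] using this
    have := ((hdiff _).hasFDerivAt.comp_hasDerivAt t h1).const_smul Complex.I
    rw [map_smul, smul_comm] at this
    exact this
  have iA : ∫ p in Set.Ioi (0:ℝ) ×ˢ Set.Ioo (-Real.pi) Real.pi, A p = -((2 * Real.pi) • F 0) := by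
    rw [Measure.volume_eq_prod, ← setIntegral_prod_swap, setIntegral_prod (fun z : ℝ × ℝ => A z.swap) hAi.swap]
    have : ∀ t : ℝ, ∫ r in Set.Ioi (0:ℝ), A (r, t) = - F 0 := by
      intro t
      have hc : Continuous (fun r : ℝ => F (pol (r, t))) := hF.continuous.comp (hpc.comp (by fun_prop))
      rw [integral_Ioi_of_hasDerivAt_of_tendsto (f := fun r => F (pol (r, t))) (m := 0) hc.continuousWithinAt (fun r _ => hder r t)]
      · simp [pol]
      · have h1 : IntegrableOn (fun r => A (r, t)) (Set.Icc 0 (max R 0)) :=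
          (hAc.comp (by fun_prop : Continuous fun r : ℝ => (r, t))).continuousOn.integrableOn_compact isCompact_Icc
        refine h1.of_forall_sdiff_eq_zero measurableSet_Ioi ?_
        rintro r ⟨ha, hb⟩
        have : max R 0 < r := by
          by_contra hh
          exact hb ⟨le_of_lt ha, not_lt.mp hh⟩
        simp only [hA]; rw [hz _ (hpol r t this)]; simp
      · apply tendsto_const_nhds.congr'
        filter_upwards [eventually_gt_atTop (max R 0)] with r hr
        exact (hz0 _ (hpol r t hr)).symm
    simp only [Prod.swap_prod_mk, this]
    rw [setIntegral_const]
    simp only [Measure.real, Real.volume_Ioo]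
    rw [ENNReal.toReal_ofReal (by linarith [Real.pi_pos]), smul_neg]
    congr 2; ring
  have iB : ∫ p in Set.Ioi (0:ℝ) ×ˢ Set.Ioo (-Real.pi) Real.pi, B p = 0 := by
    rw [Measure.volume_eq_prod, setIntegral_prod _ hBi]
    rw [← integral_zero (α := ℝ) (μ := volume.restrict (Set.Ioi 0)) (G := E)]
    apply setIntegral_congr_fun measurableSet_Ioi
    intro r hr
    simp only [Set.mem_Ioi] at hr
    have hb : Continuous (fun t => B (r, t)) := hBc.comp (by fun_prop)
    have h1 : ∫ t in (-Real.pi)..Real.pi, r • B (r, t) = 0 := by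
      rw [intervalIntegral.integral_eq_sub_of_hasDerivAt (fun t _ => hder2 r t)]
      · simp [pol]
      · exact (hb.const_smul r).intervalIntegrable _ _
    rw [intervalIntegral.integral_smul, smul_eq_zero_iff_right hr.ne', intervalIntegral.integral_of_le (by linarith [Real.pi_pos]), integral_Ioc_eq_integral_Ioo] at h1
    exact h1
  rw [key, integral_smul, integral_add hAi hBi, iA, iB, add_zero, smul_neg, smul_smul]
  congr 2; ring

lemma cp [CompleteSpace E] (F : ℂ → E) (hF : ContDiff ℝ 1 F) (hs : HasCompactSupport F) (ζ : ℂ) :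
    ∫ z : ℂ, (z - ζ)⁻¹ • dbar F z = -(Real.pi • F ζ) := by
  have h1 := cp_zero (fun z => F (z + ζ)) (hF.comp (by fun_prop)) (hs.comp_homeomorph (Homeomorph.addRight ζ))
  rw [← integral_add_right_eq_self _ ζ]
  simp only [zero_add] at h1
  rw [← h1]
  congr 1; funext z
  simp [dbar, fderiv_comp_add_right]

lemma ker_integrable (ζ z₀ : ℂ) (R : ℝ) (hR : 0 < R) (h : ζ ∈ closedBall z₀ R) :
    IntegrableOn (fun z => ‖z - ζ‖⁻¹) (ball z₀ (2*R)) ∧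
      ∫ z in ball z₀ (2*R), ‖z - ζ‖⁻¹ ≤ 6 * Real.pi * R := by
  have h1 := ker_lint' ζ z₀ R hR h
  have hm : Measurable (fun z : ℂ => ‖z - ζ‖⁻¹) := by fun_prop
  constructor
  · refine ⟨hm.aestronglyMeasurable, ?_⟩
    rw [hasFiniteIntegral_iff_ofReal (Eventually.of_forall fun z => by positivity)]
    exact h1.trans_lt ENNReal.ofReal_lt_top
  · rw [integral_eq_lintegral_of_nonneg_ae (Eventually.of_forall fun z => by positivity) hm.aestronglyMeasurable]
    apply ENNReal.toReal_le_of_le_ofReal _ h1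
    have := Real.pi_pos
    positivity

lemma dbar_cont (F : ℂ → E) (hF : ContDiff ℝ 1 F) : Continuous (dbar F) := by
  have hD := hF.continuous_fderiv (by simp)
  unfold dbar
  exact ((hD.clm_apply continuous_const).add ((hD.clm_apply continuous_const).const_smul _)).const_smul _

lemma dbar_zero_of (F : ℂ → E) (z : ℂ) (h : z ∉ tsupport F) : dbar F z = 0 := by
  have : fderiv ℝ F z = 0 := by
    by_contra hh
    exact h (support_fderiv_subset ℝ (f := F) hh)
  simp [dbar, this]

lemma dbar_supp (F : ℂ → E) (hs : HasCompactSupport F) : HasCompactSupport (dbar F) :=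
  HasCompactSupport.intro hs.isCompact (fun z hz => dbar_zero_of F z hz)

lemma base_int (F : ℂ → E) (hF : ContDiff ℝ 1 F) (hs : HasCompactSupport F) (ζ : ℂ) :
    Integrable (fun z => (z - ζ)⁻¹ • dbar F z) := by
  obtain ⟨B, hB⟩ := (dbar_supp F hs).exists_bound_of_continuous (dbar_cont F hF)
  obtain ⟨R, hR0, hR⟩ := hs.isCompact.isBounded.subset_ball_lt 0 ζ
  have h1 := (ker_integrable ζ ζ R hR0 (by simp [hR0.le])).1.mul_const B
  have h2 : IntegrableOn (fun z => (z - ζ)⁻¹ • dbar F z) (ball ζ (2*R)) := by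
    refine Integrable.mono' h1 ?_ (Eventually.of_forall fun z => ?_)
    · have hm : Measurable (fun z : ℂ => (z - ζ)⁻¹) := by fun_prop
      exact hm.aestronglyMeasurable.smul (dbar_cont F hF).aestronglyMeasurable
    · rw [norm_smul, norm_inv]
      exact mul_le_mul_of_nonneg_left (hB z) (by positivity)
  rw [← integrableOn_univ]
  refine h2.of_forall_sdiff_eq_zero MeasurableSet.univ ?_
  rintro z ⟨-, hz⟩
  rw [dbar_zero_of, smul_zero]
  intro hh
  exact hz (ball_subset_ball (by linarith) (hR hh))

lemma cps [CompleteSpace E] (F : ℂ → E) (hF : ContDiff ℝ 1 F) (hs : HasCompactSupport F) (S : Finset ℂ) :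
    (∀ a ∈ S, F a = 0) → ∀ ζ ∉ S,
    Integrable (fun z => ((∏ a ∈ S, (z - a)) * (z - ζ))⁻¹ • dbar F z) ∧
    ∫ z, ((∏ a ∈ S, (z - a)) * (z - ζ))⁻¹ • dbar F z = -(Real.pi • (∏ a ∈ S, (ζ - a))⁻¹ • F ζ) := by
  induction S using Finset.induction_on with
  | empty =>
    intro _ ζ _
    simp only [Finset.prod_empty, one_mul, inv_one, one_smul]
    exact ⟨base_int F hF hs ζ, cp F hF hs ζ⟩
  | insert a S ha ih =>
    intro h0 ζ hζ
    have ih' := ih (fun b hb => h0 b (Finset.mem_insert_of_mem hb))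
    rw [Finset.mem_insert, not_or] at hζ
    obtain ⟨i1, e1⟩ := ih' ζ hζ.2
    obtain ⟨i2, e2⟩ := ih' a ha
    have hne : ζ - a ≠ 0 := sub_ne_zero.mpr hζ.1
    have hae : (fun z => ((∏ b ∈ insert a S, (z - b)) * (z - ζ))⁻¹ • dbar F z) =ᵐ[volume]
        fun z => (ζ - a)⁻¹ • (((∏ a ∈ S, (z - a)) * (z - ζ))⁻¹ • dbar F z - ((∏ b ∈ S, (z - b)) * (z - a))⁻¹ • dbar F z) := by
      have hf : ((insert a (insert ζ S) : Finset ℂ) : Set ℂ)ᶜ ∈ ae (volume : Measure ℂ) :=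
        compl_mem_ae_iff.mpr (Finset.measure_zero _ _)
      filter_upwards [hf] with z hz
      simp only [Finset.coe_insert, Set.mem_compl_iff, Set.mem_insert_iff, Finset.mem_coe, not_or] at hz
      rw [← sub_smul, smul_smul, Finset.prod_insert ha]
      congr 1
      have h1 : z - a ≠ 0 := sub_ne_zero.mpr hz.1
      have h2 : z - ζ ≠ 0 := sub_ne_zero.mpr hz.2.1
      have h3 : ∏ b ∈ S, (z - b) ≠ 0 := Finset.prod_ne_zero_iff.mpr fun b hb => sub_ne_zero.mpr (by rintro rfl; exact hz.2.2 hb)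
      generalize ∏ b ∈ S, (z - b) = p at *
      field_simp
      ring
    refine ⟨((i1.sub i2).smul (ζ - a)⁻¹).congr hae.symm, ?_⟩
    rw [integral_congr_ae hae, integral_smul, integral_sub i1 i2, e1, e2, h0 a (Finset.mem_insert_self _ _), Finset.prod_insert ha, mul_inv, mul_smul]
    simp only [smul_zero, neg_zero, sub_zero, smul_neg]
    rw [smul_comm]

lemma quot_bdd (F : ℂ → E) (hF : ContDiff ℝ 1 F) (hs : HasCompactSupport F) (S : Finset ℂ) :
    (∀ a ∈ S, F a = 0) → ∃ M, 0 ≤ M ∧ ∀ z, ‖F z‖ ≤ M * ‖∏ a ∈ S, (z - a)‖ := by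
  induction S using Finset.induction_on with
  | empty =>
    intro _
    obtain ⟨M, hM⟩ := hs.exists_bound_of_continuous hF.continuous
    exact ⟨M, (norm_nonneg _).trans (hM 0), fun z => by simpa using hM z⟩
  | insert a S ha ih =>
    intro h0
    obtain ⟨M, hM0, hM⟩ := ih (fun b hb => h0 b (Finset.mem_insert_of_mem hb))
    obtain ⟨L, hL⟩ := ContDiff.lipschitzWith_of_hasCompactSupport hs hF (by simp)
    have hp : 0 < ‖∏ b ∈ S, (a - b)‖ := by
      rw [norm_pos_iff]
      exact Finset.prod_ne_zero_iff.mpr fun b hb => sub_ne_zero.mpr (by rintro rfl; exact ha hb)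
    have hc : Continuous fun z : ℂ => ‖∏ b ∈ S, (z - b)‖ := by fun_prop
    have hev := hc.continuousAt.eventually (lt_mem_nhds (half_lt_self hp))
    obtain ⟨δ, hδ, hball⟩ := Metric.eventually_nhds_iff.mp hev
    set c := ‖∏ b ∈ S, (a - b)‖ / 2
    have hc0 : 0 < c := by positivity
    refine ⟨L / c + M / δ, by positivity, fun z => ?_⟩
    rw [Finset.prod_insert ha, norm_mul]
    by_cases hz : dist z a < δ
    · have h1 := hball hz
      have h2 : ‖F z‖ ≤ L * ‖z - a‖ := by
        have := hL.dist_le_mul z a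
        rwa [h0 a (Finset.mem_insert_self _ _), dist_zero_right, dist_eq_norm] at this
      calc ‖F z‖ ≤ L * ‖z - a‖ := h2
        _ = L / c * (‖z - a‖ * c) := by field_simp
        _ ≤ L / c * (‖z - a‖ * ‖∏ b ∈ S, (z - b)‖) := by gcongr
        _ ≤ _ := by gcongr; exact le_add_of_nonneg_right (by positivity)
    · rw [not_lt, dist_eq_norm] at hz
      calc ‖F z‖ ≤ M * ‖∏ b ∈ S, (z - b)‖ := hM z
        _ = M / δ * (δ * ‖∏ b ∈ S, (z - b)‖) := by field_simp
        _ ≤ M / δ * (‖z - a‖ * ‖∏ b ∈ S, (z - b)‖) := by gcongr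
        _ ≤ _ := by gcongr; exact le_add_of_nonneg_left (by positivity)

lemma improve [CompleteSpace E] (F : ℂ → E) (hF : ContDiff ℝ 1 F) (z₀ : ℂ) (R C B : ℝ) (hR : 0 < R)
    (hs : tsupport F ⊆ closedBall z₀ R) (hC : 0 < C) (hRC : 6 * R * C ≤ 1 / 2)
    (hB : ∀ z, ‖dbar F z‖ ≤ B) (hFC : ∀ z ∈ ball z₀ (R/2), ‖dbar F z‖ ≤ C * ‖F z‖)
    (S : Finset ℂ) (hS : ∀ a ∈ S, a ∈ ball z₀ (R/8)) (hS0 : ∀ a ∈ S, F a = 0)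
    (M : ℝ) (hM0 : 0 ≤ M) (hM : ∀ z, ‖F z‖ ≤ M * ‖∏ a ∈ S, (z - a)‖) (ζ : ℂ) :
    ‖F ζ‖ ≤ (M / 2 + 6 * R * (B * (8 / (3 * R)) ^ S.card)) * ‖∏ a ∈ S, (ζ - a)‖ := by
  have hcs : HasCompactSupport F := HasCompactSupport.of_support_subset_isCompact
    (isCompact_closedBall z₀ R) ((subset_tsupport F).trans hs)
  have hB0 : 0 ≤ B := (norm_nonneg _).trans (hB 0)
  have hpi := Real.pi_pos
  by_cases hζS : ζ ∈ S
  · rw [hS0 ζ hζS, norm_zero]; positivity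
  by_cases hζR : ζ ∈ closedBall z₀ R
  swap
  · have : F ζ = 0 := by
      by_contra hh
      exact hζR (hs (subset_tsupport F hh))
    rw [this, norm_zero]; positivity
  obtain ⟨ii, ee⟩ := cps F hF hcs S hS0 ζ hζS
  obtain ⟨ki, kb⟩ := ker_integrable ζ z₀ R hR hζR
  set K := C * M + B * (8 / (3 * R)) ^ S.card with hK
  have hK0 : 0 ≤ K := by positivity
  have hpt : ∀ z, ‖((∏ a ∈ S, (z - a)) * (z - ζ))⁻¹ • dbar F z‖ ≤ K * ‖z - ζ‖⁻¹ := by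
    intro z
    rw [norm_smul, norm_inv, norm_mul, mul_inv, mul_assoc, mul_comm ‖z - ζ‖⁻¹, ← mul_assoc]
    refine mul_le_mul_of_nonneg_right ?_ (by positivity)
    rcases eq_or_ne (∏ a ∈ S, (z - a)) 0 with hp | hp
    · rw [hp]; simpa using hK0
    have hp' : 0 < ‖∏ a ∈ S, (z - a)‖ := norm_pos_iff.mpr hp
    by_cases hz : z ∈ ball z₀ (R/2)
    · have h1 : ‖dbar F z‖ ≤ C * (M * ‖∏ a ∈ S, (z - a)‖) :=
        (hFC z hz).trans (mul_le_mul_of_nonneg_left (hM z) hC.le)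
      rw [inv_mul_le_iff₀ hp']
      have : 0 ≤ B * (8 / (3 * R)) ^ S.card := by positivity
      nlinarith
    · have h2 : (3 * R / 8) ^ S.card ≤ ‖∏ a ∈ S, (z - a)‖ := by
        rw [norm_prod, ← Finset.prod_const]
        apply Finset.prod_le_prod (fun _ _ => by positivity)
        intro a ha
        have h3 := hS a ha
        rw [mem_ball] at h3 hz
        have h4 := dist_triangle z a z₀
        rw [← dist_eq_norm]
        linarith
      have h5 : ‖∏ a ∈ S, (z - a)‖⁻¹ ≤ (8 / (3 * R)) ^ S.card := by
        have := inv_anti₀ (by positivity) h2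
        rwa [← inv_pow, inv_div] at this
      calc ‖∏ a ∈ S, (z - a)‖⁻¹ * ‖dbar F z‖ ≤ (8 / (3 * R)) ^ S.card * B := by
            gcongr; exact hB z
        _ ≤ K := by
          rw [hK, mul_comm]; exact le_add_of_nonneg_left (by positivity)
  have hset : ∫ z, ((∏ a ∈ S, (z - a)) * (z - ζ))⁻¹ • dbar F z =
      ∫ z in ball z₀ (2 * R), ((∏ a ∈ S, (z - a)) * (z - ζ))⁻¹ • dbar F z := by
    symm
    apply setIntegral_eq_integral_of_forall_compl_eq_zero
    intro z hz
    rw [dbar_zero_of, smul_zero]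
    intro hh
    exact hz (closedBall_subset_ball (by linarith) (hs hh))
  have h1 : ‖∫ z, ((∏ a ∈ S, (z - a)) * (z - ζ))⁻¹ • dbar F z‖ ≤ K * (6 * Real.pi * R) := by
    rw [hset]
    refine (norm_integral_le_of_norm_le (ki.const_mul K) (Eventually.of_forall hpt)).trans ?_
    rw [integral_const_mul]
    exact mul_le_mul_of_nonneg_left kb hK0
  rw [ee, norm_neg, norm_smul, norm_smul, norm_inv, Real.norm_of_nonneg hpi.le] at h1
  have hp : 0 < ‖∏ a ∈ S, (ζ - a)‖ := by
    rw [norm_pos_iff]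
    exact Finset.prod_ne_zero_iff.mpr fun b hb => sub_ne_zero.mpr (by rintro rfl; exact hζS hb)
  have h2 : ‖∏ a ∈ S, (ζ - a)‖⁻¹ * ‖F ζ‖ ≤ K * (6 * R) := by
    refine le_of_mul_le_mul_left (h1.trans (le_of_eq ?_)) hpi
    ring
  rw [inv_mul_le_iff₀ hp, mul_comm] at h2
  refine h2.trans (mul_le_mul_of_nonneg_right ?_ hp.le)
  rw [hK]
  nlinarith

lemma final_bound [CompleteSpace E] (F : ℂ → E) (hF : ContDiff ℝ 1 F) (z₀ : ℂ) (R C B : ℝ) (hR : 0 < R)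
    (hs : tsupport F ⊆ closedBall z₀ R) (hC : 0 < C) (hRC : 6 * R * C ≤ 1 / 2)
    (hB : ∀ z, ‖dbar F z‖ ≤ B) (hFC : ∀ z ∈ ball z₀ (R/2), ‖dbar F z‖ ≤ C * ‖F z‖)
    (S : Finset ℂ) (hS : ∀ a ∈ S, a ∈ ball z₀ (R/8)) (hS0 : ∀ a ∈ S, F a = 0)
    (ζ : ℂ) (hζ : ζ ∈ ball z₀ (R/8)) :
    ‖F ζ‖ ≤ 12 * R * B * (2/3) ^ S.card := by
  have hcs : HasCompactSupport F := HasCompactSupport.of_support_subset_isCompact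
    (isCompact_closedBall z₀ R) ((subset_tsupport F).trans hs)
  have hB0 : 0 ≤ B := (norm_nonneg _).trans (hB 0)
  obtain ⟨M, hM0, hM⟩ := quot_bdd F hF hcs S hS0
  set D := 6 * R * (B * (8 / (3 * R)) ^ S.card) with hD
  have hD0 : 0 ≤ D := by positivity
  have hit : ∀ j : ℕ, ∀ z, ‖F z‖ ≤ (M * (1/2)^j + 2 * D) * ‖∏ a ∈ S, (z - a)‖ := by
    intro j
    induction j with
    | zero =>
      intro z
      refine (hM z).trans (mul_le_mul_of_nonneg_right ?_ (norm_nonneg _))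
      simp; positivity
    | succ j ih =>
      intro z
      refine (improve F hF z₀ R C B hR hs hC hRC hB hFC S hS hS0 _ (by positivity) ih z).trans
        (le_of_eq ?_)
      rw [← hD]; ring
  have hlim : Tendsto (fun j : ℕ => (M * (1/2:ℝ)^j + 2 * D) * ‖∏ a ∈ S, (ζ - a)‖) atTop
      (𝓝 ((M * 0 + 2 * D) * ‖∏ a ∈ S, (ζ - a)‖)) :=
    (((tendsto_pow_atTop_nhds_zero_of_lt_one (by norm_num) (by norm_num)).const_mul M).add_const _).mul_const _
  have h1 := ge_of_tendsto' hlim (fun j => hit j ζ)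
  have h2 : ‖∏ a ∈ S, (ζ - a)‖ ≤ (R / 4) ^ S.card := by
    rw [norm_prod, ← Finset.prod_const]
    apply Finset.prod_le_prod (fun _ _ => by positivity)
    intro a ha
    have h3 := hS a ha
    rw [mem_ball] at h3 hζ
    have h4 := dist_triangle_right ζ a z₀
    rw [← dist_eq_norm]
    linarith
  calc ‖F ζ‖ ≤ (M * 0 + 2 * D) * ‖∏ a ∈ S, (ζ - a)‖ := h1
    _ ≤ (M * 0 + 2 * D) * (R / 4) ^ S.card := by gcongr
    _ = 12 * R * B * (((8 / (3 * R)) * (R / 4)) ^ S.card) := by rw [hD, mul_pow]; ring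
    _ = _ := by
      congr 2; field_simp; norm_num

lemma local_zero [CompleteSpace E] (u : ℂ → E) (U : Set ℂ) (hU : IsOpen U)
    (hu : ContDiffOn ℝ 1 u U) (C : ℝ) (hC : 0 < C)
    (hineq : ∀ z ∈ U, ‖dbar u z‖ ≤ C * ‖u z‖) (z₀ : ℂ) (hz₀ : z₀ ∈ U)
    (hacc : AccPt z₀ (𝓟 {z : ℂ | z ∈ U ∧ u z = 0})) :
    ∀ᶠ z in 𝓝 z₀, u z = 0 := by
  obtain ⟨ε, hε, hεU⟩ := Metric.isOpen_iff.mp hU z₀ hz₀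
  set R := min (ε / 2) (1 / (12 * C)) with hRdef
  have hR : 0 < R := by positivity
  have hRε : R < ε := (min_le_left _ _).trans_lt (by linarith)
  have hRC : 6 * R * C ≤ 1 / 2 := by
    have : R ≤ 1 / (12 * C) := min_le_right _ _
    rw [le_div_iff₀ (by positivity)] at this
    linarith
  let χ : ContDiffBump z₀ := ⟨R / 2, R, by positivity, by linarith⟩
  set F : ℂ → E := fun z => χ z • u z with hFdef
  have hRU : closedBall z₀ R ⊆ U := (closedBall_subset_ball hRε).trans hεU
  have hs : tsupport F ⊆ closedBall z₀ R := by
    refine (tsupport_smul_subset_left (fun z => χ z) u).trans ?_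
    rw [χ.tsupport_eq]
  have hF : ContDiff ℝ 1 F := by
    rw [contDiff_iff_contDiffAt]
    intro z
    by_cases hz : z ∈ U
    · exact (χ.contDiff.contDiffAt).smul (hu.contDiffAt (hU.mem_nhds hz))
    · have : F =ᶠ[𝓝 z] fun _ => 0 := by
        refine notMem_tsupport_iff_eventuallyEq.mp ?_
        exact fun h => hz (hRU (hs h))
      exact contDiffAt_const.congr_of_eventuallyEq this
  have hcs : HasCompactSupport F := HasCompactSupport.of_support_subset_isCompact
    (isCompact_closedBall z₀ R) ((subset_tsupport F).trans hs)
  obtain ⟨B, hB⟩ := (dbar_supp F hcs).exists_bound_of_continuous (dbar_cont F hF)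
  have hFu : ∀ z ∈ ball z₀ (R/2), F z = u z := by
    intro z hz
    have : χ z = 1 := χ.one_of_mem_closedBall (ball_subset_closedBall hz)
    simp [hFdef, this]
  have hFC : ∀ z ∈ ball z₀ (R/2), ‖dbar F z‖ ≤ C * ‖F z‖ := by
    intro z hz
    have he : F =ᶠ[𝓝 z] u := by
      filter_upwards [isOpen_ball.mem_nhds hz] with w hw using hFu w hw
    have : dbar F z = dbar u z := by
      simp only [dbar, he.fderiv_eq]
    rw [this, hFu z hz]
    exact hineq z (hRU (ball_subset_closedBall (ball_subset_ball (by linarith) hz)))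
  have hinf : ({z : ℂ | z ∈ U ∧ u z = 0} ∩ ball z₀ (R/8)).Infinite := by
    have h1 : AccPt z₀ (𝓟 (ball z₀ (R/8) ∩ {z : ℂ | z ∈ U ∧ u z = 0})) :=
      hacc.nhds_inter (ball_mem_nhds z₀ (by positivity))
    rw [Set.inter_comm]
    exact Set.Infinite.of_accPt h1
  filter_upwards [ball_mem_nhds z₀ (show 0 < R/8 by positivity)] with ζ hζ
  rw [← hFu ζ (ball_subset_ball (by linarith) hζ)]
  have hk : ∀ k : ℕ, ‖F ζ‖ ≤ 12 * R * B * (2/3) ^ k := by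
    intro k
    obtain ⟨S, hS, hSk⟩ := hinf.exists_subset_card_eq k
    rw [← hSk]
    refine final_bound F hF z₀ R C B hR hs hC hRC hB hFC S (fun a ha => (hS ha).2) (fun a ha => ?_) ζ hζ
    rw [hFu a (ball_subset_ball (by linarith) (hS ha).2)]
    exact (hS ha).1.2
  have hlim : Tendsto (fun k : ℕ => 12 * R * B * (2/3 : ℝ) ^ k) atTop (𝓝 (12 * R * B * 0)) :=
    (tendsto_pow_atTop_nhds_zero_of_lt_one (by norm_num) (by norm_num)).const_mul _
  have := ge_of_tendsto' hlim hk
  rw [mul_zero] at this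
  exact norm_le_zero_iff.mp this

end ZSA

/-- if `u : D → ℂⁿ` is `C¹`, satisfies `‖∂u/∂z̄‖ ≤ C·‖u‖` on `D`, and
the zero set of `u` has an accumulation point in `D`, then `u ≡ 0` on `D`. -/
theorem zero_set_accumulation (n : ℕ)
    (u : ℂ → EuclideanSpace ℂ (Fin n))
    (hu : ContDiffOn ℝ 1 u (ball (0 : ℂ) 1))
    (C : ℝ) (hC : 0 < C)
    (hineq : ∀ z ∈ ball (0 : ℂ) 1, ‖dbar u z‖ ≤ C * ‖u z‖)
    (hacc : ∃ z₀ ∈ ball (0 : ℂ) 1,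
      AccPt z₀ (𝓟 {z : ℂ | z ∈ ball (0 : ℂ) 1 ∧ u z = 0})) :
    ∀ z ∈ ball (0 : ℂ) 1, u z = 0 := by
  have hloc := local_zero u (ball 0 1) isOpen_ball hu C hC hineq
  set Z := {z : ℂ | z ∈ ball (0 : ℂ) 1 ∧ u z = 0} with hZ
  have hV : ∀ z ∈ ball (0 : ℂ) 1, AccPt z (𝓟 Z) → z ∈ interior Z := by
    intro z hz ha
    rw [mem_interior_iff_mem_nhds]
    filter_upwards [hloc z hz ha, isOpen_ball.mem_nhds hz] with w h1 h2 using ⟨h2, h1⟩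
  have hsub : ball (0:ℂ) 1 ⊆ interior Z := by
    refine (convex_ball (0:ℂ) 1).isPreconnected.subset_of_closure_inter_subset isOpen_interior ?_ ?_
    · obtain ⟨z₀, h1, h2⟩ := hacc
      exact ⟨z₀, h1, hV z₀ h1 h2⟩
    · rintro z ⟨hz1, hz2⟩
      by_contra hz
      apply hz
      apply hV z hz2
      rw [accPt_iff_nhds]
      intro W hW
      obtain ⟨y, hy1, hy2⟩ := mem_closure_iff_nhds.mp hz1 W hW
      exact ⟨y, ⟨hy1, interior_subset hy2⟩, by rintro rfl; exact hz hy2⟩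
  exact fun z hz => (interior_subset (hsub hz)).2
end

section
/- There exist a continuous almost complex structure J on ℂ⁴ (i.e. p ↦ J(p) is continuous in operator norm and J(p)² = −Id for every p) and a C^∞-smooth J-holomorphic map U : D → ℂ⁴ such that: (i) U vanishes to infinite order at 0; (ii) 0 is an accumulation point of the set {z ∈ D \ {0} : U(z) = 0}; (iii) U is not identically 0 on any neighborhood of 0. -/
open Complex MeasureTheory Metric Filter Asymptotics Topology

noncomputable def kap (τ s : ℝ) : ℝ := 2 * (round ((s - τ) / 2) : ℝ) + τ

lemma kap_abs (τ s : ℝ) : |s - kap τ s| ≤ 1 := by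
  have h := abs_sub_round ((s - τ) / 2)
  unfold kap
  rw [abs_le] at *
  constructor <;> linarith [h.1, h.2]

lemma kap_local (τ s₀ s : ℝ) (h : |s - s₀| < 1 / 10) :
    kap τ s = kap τ s₀ ∨ (9 / 10 ≤ |s - kap τ s| ∧ 9 / 10 ≤ |s - kap τ s₀|) := by
  by_cases he : round ((s - τ) / 2) = round ((s₀ - τ) / 2)
  · left; simp [kap, he]
  right
  have h1 := kap_abs τ s
  have h2 := kap_abs τ s₀
  have h3 : 2 ≤ |kap τ s - kap τ s₀| := by
    have : (1 : ℤ) ≤ |round ((s - τ) / 2) - round ((s₀ - τ) / 2)| :=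
      Int.one_le_abs (sub_ne_zero.2 he)
    have h' : (1 : ℝ) ≤ |(round ((s - τ) / 2) : ℝ) - round ((s₀ - τ) / 2)| := by exact_mod_cast this
    have : kap τ s - kap τ s₀ = 2 * ((round ((s - τ) / 2) : ℝ) - round ((s₀ - τ) / 2)) := by
      unfold kap; ring
    rw [this, abs_mul, abs_two]; linarith
  rw [abs_le] at h1 h2
  rw [abs_lt] at h
  rcases le_abs.1 h3 with h3 | h3
  · exact ⟨le_abs.2 (Or.inr (by linarith)), le_abs.2 (Or.inl (by linarith))⟩
  · exact ⟨le_abs.2 (Or.inl (by linarith)), le_abs.2 (Or.inr (by linarith))⟩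

structure Bmp (ψ : ℝ → ℝ) : Prop where
  sm : ContDiff ℝ (⊤ : ℕ∞) ψ
  sp : ∀ t, 9 / 10 ≤ |t| → ψ t = 0

lemma Bmp.deriv {ψ : ℝ → ℝ} (h : Bmp ψ) : Bmp (deriv ψ) := by
  refine ⟨(contDiff_infty_iff_deriv.1 h.sm).2, ?_⟩
  -- derivative vanishes on the closed set by continuity
  have hc : Continuous (_root_.deriv ψ) := (contDiff_infty_iff_deriv.1 h.sm).2.continuous
  have hs : ∀ t, 9 / 10 < |t| → _root_.deriv ψ t = 0 := by
    intro t ht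
    have : ψ =ᶠ[𝓝 t] fun _ => 0 := by
      filter_upwards [(continuous_abs.isOpen_preimage _ isOpen_Ioi).mem_nhds
        (show t ∈ (fun t : ℝ => |t|) ⁻¹' Set.Ioi (9 / 10) from ht)] with x hx
      exact h.sp x (le_of_lt hx)
    rw [this.deriv_eq]; simp
  intro t ht
  have hl : Tendsto (fun c : ℝ => _root_.deriv ψ (c * t)) (𝓝[>] 1) (𝓝 (_root_.deriv ψ (1 * t))) :=
    ((hc.comp (continuous_id.mul continuous_const)).tendsto 1).mono_left nhdsWithin_le_nhds
  rw [one_mul] at hl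
  refine tendsto_nhds_unique hl ?_
  refine tendsto_const_nhds.congr' ?_
  filter_upwards [self_mem_nhdsWithin] with c hc1
  have hc1 : 1 < c := hc1
  symm
  apply hs
  rw [abs_mul, abs_of_pos (by linarith)]
  nlinarith

lemma Bmp.bdd {ψ : ℝ → ℝ} (h : Bmp ψ) : ∃ M, 0 ≤ M ∧ ∀ t, |ψ t| ≤ M := by
  have hcs : HasCompactSupport ψ := by
    refine HasCompactSupport.intro (isCompact_Icc (a := -1) (b := 1)) ?_
    intro x hx
    apply h.sp
    by_contra hlt
    push Not at hlt
    rw [abs_lt] at hlt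
    exact hx ⟨by linarith, by linarith⟩
  obtain ⟨C, hC⟩ := h.sm.continuous.bounded_above_of_compact_support hcs
  exact ⟨C, le_trans (norm_nonneg _) (hC 0), hC⟩

noncomputable def FF (τ : ℝ) (ψ : ℝ → ℝ) (j l : ℕ) (z : ℂ) : ℂ :=
  if 0 < z.re then
    ((z.re⁻¹ ^ j * Real.exp (-(z.re⁻¹) ^ 2 / 2) * ψ (z.re⁻¹ - kap τ z.re⁻¹)
      * kap τ z.re⁻¹ ^ l : ℝ) : ℂ) * cexp (I * ((kap τ z.re⁻¹ ^ 3 * z.im : ℝ) : ℂ))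
  else 0

lemma poly_exp_bdd (j l : ℕ) : ∃ C : ℝ, 0 ≤ C ∧ ∀ s : ℝ, 0 < s →
    s ^ j * Real.exp (-s ^ 2 / 2) * (s + 1) ^ l ≤ C := by
  refine ⟨(j + l).factorial * Real.exp 2, by positivity, fun s hs => ?_⟩
  have h1 : s ^ j * (s + 1) ^ l ≤ (s + 1) ^ (j + l) := by
    rw [pow_add]; gcongr; linarith
  have h2 := Real.pow_div_factorial_le_exp (s + 1) (by linarith) (j + l)
  rw [div_le_iff₀ (by positivity)] at h2
  have h3 : Real.exp (s + 1) * Real.exp (-s ^ 2 / 2) ≤ Real.exp 2 := by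
    rw [← Real.exp_add]; apply Real.exp_le_exp.2; nlinarith [sq_nonneg (s - 1)]
  calc s ^ j * Real.exp (-s ^ 2 / 2) * (s + 1) ^ l
      = (s ^ j * (s + 1) ^ l) * Real.exp (-s ^ 2 / 2) := by ring
    _ ≤ (Real.exp (s + 1) * (j + l).factorial) * Real.exp (-s ^ 2 / 2) := by
        exact mul_le_mul_of_nonneg_right (h1.trans h2) (Real.exp_pos _).le
    _ = (j + l).factorial * (Real.exp (s + 1) * Real.exp (-s ^ 2 / 2)) := by ring
    _ ≤ _ := by gcongr

lemma norm_cexp_I (t : ℝ) : ‖cexp (I * (t : ℂ))‖ = 1 := by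
  rw [mul_comm]; exact Complex.norm_exp_ofReal_mul_I t

lemma FF_bdd (τ : ℝ) {ψ : ℝ → ℝ} (h : Bmp ψ) (j l : ℕ) :
    ∃ C, 0 ≤ C ∧ ∀ z, ‖FF τ ψ j l z‖ ≤ C := by
  obtain ⟨M, hM0, hM⟩ := h.bdd
  obtain ⟨C, hC0, hC⟩ := poly_exp_bdd j l
  refine ⟨C * M, by positivity, fun z => ?_⟩
  unfold FF
  split_ifs with hz
  · have hs : 0 < z.re⁻¹ := inv_pos.2 hz
    set s := z.re⁻¹
    rw [norm_mul, norm_cexp_I, mul_one, Complex.norm_real, Real.norm_eq_abs, abs_mul, abs_mul,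
      abs_pow (kap τ s), abs_of_pos (by positivity : 0 < s ^ j * Real.exp (-s ^ 2 / 2))]
    have hk : |kap τ s| ≤ s + 1 := by
      have := kap_abs τ s
      rw [abs_le] at *; constructor <;> linarith
    calc s ^ j * Real.exp (-s ^ 2 / 2) * |ψ (s - kap τ s)| * |kap τ s| ^ l
        ≤ s ^ j * Real.exp (-s ^ 2 / 2) * M * (s + 1) ^ l := by
          gcongr; exact hM _
      _ = (s ^ j * Real.exp (-s ^ 2 / 2) * (s + 1) ^ l) * M := by ring
      _ ≤ _ := by gcongr; exact hC s hs
  · simp; positivity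

lemma FF_shift (τ : ℝ) (ψ : ℝ → ℝ) (j l N : ℕ) (z : ℂ) :
    FF τ ψ j l z = (z.re ^ N : ℝ) * FF τ ψ (j + N) l z := by
  unfold FF
  split_ifs with hz
  · rw [← mul_assoc, ← Complex.ofReal_mul]
    congr 2
    have : z.re ^ N * z.re⁻¹ ^ N = 1 := by rw [← mul_pow, mul_inv_cancel₀ hz.ne', one_pow]
    rw [pow_add]
    linear_combination (-z.re⁻¹ ^ j * Real.exp (-(z.re⁻¹) ^ 2 / 2) * ψ (z.re⁻¹ - kap τ z.re⁻¹)
      * kap τ z.re⁻¹ ^ l) * this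
  · simp

noncomputable def FX (τ : ℝ) (ψ : ℝ → ℝ) (j l : ℕ) (z : ℂ) : ℂ :=
  -(j : ℂ) * FF τ ψ (j + 1) l z + FF τ ψ (j + 3) l z - FF τ (deriv ψ) (j + 2) l z

noncomputable def mkD (a b : ℂ) : ℂ →L[ℝ] ℂ :=
  reCLM.smulRight a + imCLM.smulRight b

lemma FF_hasFDerivAt_pos (τ : ℝ) {ψ : ℝ → ℝ} (h : Bmp ψ) (j l : ℕ) (z : ℂ) (hz : 0 < z.re) :
    HasFDerivAt (FF τ ψ j l) (mkD (FX τ ψ j l z) (I * FF τ ψ j (l + 3) z)) z := by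
  set k := kap τ z.re⁻¹ with hk
  let r : ℝ → ℝ := fun x => x⁻¹ ^ j * Real.exp (-(x⁻¹) ^ 2 / 2) * ψ (x⁻¹ - k) * k ^ l
  have hev : FF τ ψ j l =ᶠ[𝓝 z] fun w => ((r w.re : ℝ) : ℂ) * cexp (I * ((k ^ 3 * w.im : ℝ) : ℂ)) := by
    have hc : ContinuousAt (fun w : ℂ => w.re⁻¹) z :=
      (Complex.continuous_re.continuousAt).inv₀ hz.ne'
    have h1 := hc.eventually (Metric.ball_mem_nhds _ (by norm_num : (0 : ℝ) < 1 / 10))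
    have h2 : ∀ᶠ w : ℂ in 𝓝 z, 0 < w.re :=
      Complex.continuous_re.continuousAt.eventually (lt_mem_nhds hz)
    filter_upwards [h1, h2] with w hw1 hw2
    have hw1 : |w.re⁻¹ - z.re⁻¹| < 1 / 10 := by simpa [Real.dist_eq] using hw1
    simp only [FF, if_pos hw2, r]
    rcases kap_local τ _ _ hw1 with he | ⟨ha, hb⟩
    · rw [he]
    · rw [h.sp _ ha, h.sp _ hb]; simp
  refine HasFDerivAt.congr_of_eventuallyEq ?_ hev
  have hψ : HasDerivAt ψ (deriv ψ (z.re⁻¹ - k)) (z.re⁻¹ - k) :=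
    (h.sm.differentiable (by simp)).differentiableAt.hasDerivAt
  have hi : HasDerivAt (fun x : ℝ => x⁻¹) (-(z.re ^ 2)⁻¹) z.re := hasDerivAt_inv hz.ne'
  have hr : HasDerivAt r ((-(j : ℝ) * (z.re⁻¹ ^ (j + 1) * Real.exp (-(z.re⁻¹) ^ 2 / 2) * ψ (z.re⁻¹ - k) * k ^ l)
      + (z.re⁻¹ ^ (j + 3) * Real.exp (-(z.re⁻¹) ^ 2 / 2) * ψ (z.re⁻¹ - k) * k ^ l)
      - (z.re⁻¹ ^ (j + 2) * Real.exp (-(z.re⁻¹) ^ 2 / 2) * deriv ψ (z.re⁻¹ - k) * k ^ l))) z.re := by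
    have h0 := ((((hi.pow j).mul ((((hi.pow 2).neg).div_const 2).exp)).mul
      (hψ.comp z.re (hi.sub_const k))).mul_const (k ^ l))
    refine h0.congr_deriv ?_
    have e2 : (z.re ^ 2)⁻¹ = z.re⁻¹ ^ 2 := by rw [inv_pow]
    simp only [e2, Pi.mul_apply, Pi.pow_apply, Pi.neg_apply, Function.comp]
    rcases j with _ | j
    · simp; ring
    · simp; ring
  have hre : HasFDerivAt (fun w : ℂ => w.re) reCLM z := reCLM.hasFDerivAt
  have him : HasFDerivAt (fun w : ℂ => w.im) imCLM z := imCLM.hasFDerivAt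
  have hA : HasFDerivAt (fun w : ℂ => ((r w.re : ℝ) : ℂ)) _ z :=
    hr.ofReal_comp.hasFDerivAt.comp z hre
  have hE0 : HasDerivAt (fun y : ℝ => cexp (I * ((k ^ 3 * y : ℝ) : ℂ)))
      (cexp (I * ((k ^ 3 * z.im : ℝ) : ℂ)) * (I * ((k ^ 3 : ℝ) : ℂ))) z.im := by
    have := (((((hasDerivAt_id z.im).const_mul (k ^ 3)).ofReal_comp).const_mul I).cexp)
    simpa using this
  have hE : HasFDerivAt (fun w : ℂ => cexp (I * ((k ^ 3 * w.im : ℝ) : ℂ))) _ z :=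
    hE0.hasFDerivAt.comp z him
  have := hA.mul hE
  refine this.congr_fderiv ?_
  ext v
  simp [mkD, FX, FF, if_pos hz, ← hk, r]
  ring

lemma FF_neg (τ : ℝ) (ψ : ℝ → ℝ) (j l : ℕ) (z : ℂ) (hz : z.re ≤ 0) : FF τ ψ j l z = 0 := by
  simp [FF, not_lt.2 hz]

lemma FF_hasFDerivAt (τ : ℝ) {ψ : ℝ → ℝ} (h : Bmp ψ) (j l : ℕ) (z : ℂ) :
    HasFDerivAt (FF τ ψ j l) (mkD (FX τ ψ j l z) (I * FF τ ψ j (l + 3) z)) z := by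
  by_cases hz : 0 < z.re
  · exact FF_hasFDerivAt_pos τ h j l z hz
  have hz' := not_lt.1 hz
  have e0 : mkD (FX τ ψ j l z) (I * FF τ ψ j (l + 3) z) = 0 := by
    ext v
    simp [mkD, FX, FF_neg _ _ _ _ z hz']
  rw [e0]
  obtain ⟨C, hC0, hC⟩ := FF_bdd τ h (j + 2) l
  have : FF τ ψ j l =O[𝓝 z] fun w => ‖w - z‖ ^ 2 := by
    refine IsBigO.of_bound C (Eventually.of_forall fun w => ?_)
    by_cases hw : 0 < w.re
    · rw [FF_shift τ ψ j l 2 w, norm_mul, mul_comm]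
      have h1 : |w.re - z.re| ≤ ‖w - z‖ := by simpa using Complex.abs_re_le_norm (w - z)
      rw [abs_of_nonneg (by linarith)] at h1
      have h2 : w.re ≤ ‖w - z‖ := by linarith
      gcongr
      · exact hC w
      · rw [Complex.norm_real, norm_pow, norm_pow, norm_norm, Real.norm_eq_abs, abs_of_pos hw]
        gcongr
    · rw [FF_neg _ _ _ _ w (not_lt.1 hw)]; simp; positivity
  exact this.hasFDerivAt (by norm_num)

lemma FF_contDiff_nat (τ : ℝ) (n : ℕ) : ∀ {ψ : ℝ → ℝ} (_ : Bmp ψ) (j l : ℕ),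
    ContDiff ℝ n (FF τ ψ j l) := by
  induction n with
  | zero =>
    intro ψ h j l
    exact contDiff_zero.2 (continuous_iff_continuousAt.2
      fun z => (FF_hasFDerivAt τ h j l z).continuousAt)
  | succ n ih =>
    intro ψ h j l
    have : ((n + 1 : ℕ) : WithTop ℕ∞) = (n : WithTop ℕ∞) + 1 := by norm_cast
    rw [this, contDiff_succ_iff_fderiv]
    refine ⟨fun z => (FF_hasFDerivAt τ h j l z).differentiableAt, by simp, ?_⟩
    have e : fderiv ℝ (FF τ ψ j l) = fun z => mkD (FX τ ψ j l z) (I * FF τ ψ j (l + 3) z) := by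
      funext z; exact (FF_hasFDerivAt τ h j l z).fderiv
    rw [e]
    have hX : ContDiff ℝ n (FX τ ψ j l) := by
      unfold FX
      exact ((contDiff_const.mul (ih h _ _)).add (ih h _ _)).sub (ih h.deriv _ _)
    have hY : ContDiff ℝ n (fun z => I * FF τ ψ j (l + 3) z) := contDiff_const.mul (ih h _ _)
    unfold mkD
    exact (contDiff_const.smulRight hX).add (contDiff_const.smulRight hY)

lemma FF_contDiff (τ : ℝ) {ψ : ℝ → ℝ} (h : Bmp ψ) (j l : ℕ) :
    ContDiff ℝ (⊤ : ℕ∞) (FF τ ψ j l) :=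
  contDiff_infty.2 fun n => FF_contDiff_nat τ n h j l

lemma exists_bump : ∃ χ : ℝ → ℝ, Bmp χ ∧ ∀ t, |t| ≤ 1 / 2 → χ t = 1 ∧ deriv χ t = 0 := by
  let b : ContDiffBump (0 : ℝ) := ⟨6 / 10, 9 / 10, by norm_num, by norm_num⟩
  refine ⟨b, ⟨b.contDiff, fun t ht => b.zero_of_le_dist (by simpa [Real.dist_eq] using ht)⟩, ?_⟩
  intro t ht
  have h1 : ∀ x : ℝ, |x| ≤ 6 / 10 → b x = 1 := fun x hx =>
    b.one_of_mem_closedBall (by simpa [Real.dist_eq] using hx)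
  refine ⟨h1 t (by linarith), ?_⟩
  have : (b : ℝ → ℝ) =ᶠ[𝓝 t] fun _ => 1 := by
    filter_upwards [(continuous_abs.isOpen_preimage _ isOpen_Iio).mem_nhds
        (show t ∈ (fun t : ℝ => |t|) ⁻¹' Set.Iio (6 / 10) from lt_of_le_of_lt ht (by norm_num))] with x hx
    exact h1 x (le_of_lt hx)
  rw [this.deriv_eq]; simp

noncomputable def GG (x : ℝ) : ℝ := Real.exp (-(x⁻¹) ^ 2 / 2)

lemma FF_E (τ : ℝ) (χ : ℝ → ℝ) (z : ℂ) (hz : 0 < z.re) :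
    FX τ χ 0 0 z + I * (I * FF τ χ 0 3 z) =
    ((GG z.re * ((z.re⁻¹ ^ 3 - kap τ z.re⁻¹ ^ 3) * χ (z.re⁻¹ - kap τ z.re⁻¹)
      - z.re⁻¹ ^ 2 * deriv χ (z.re⁻¹ - kap τ z.re⁻¹)) : ℝ) : ℂ)
      * cexp (I * ((kap τ z.re⁻¹ ^ 3 * z.im : ℝ) : ℂ)) := by
  simp only [FX, FF, if_pos hz, GG]
  push_cast
  linear_combination ((z.re : ℂ)⁻¹ ^ 0 * cexp (-(z.re : ℂ)⁻¹ ^ 2 / 2) * χ (z.re⁻¹ - kap τ z.re⁻¹)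
      * kap τ z.re⁻¹ ^ 3) * cexp (I * (kap τ z.re⁻¹ ^ 3 * z.im)) * I_mul_I

lemma FF_P (τ : ℝ) (χ : ℝ → ℝ) (z : ℂ) (hz : 0 < z.re) :
    FX τ χ 0 0 z - I * (I * FF τ χ 0 3 z) =
    ((GG z.re * ((z.re⁻¹ ^ 3 + kap τ z.re⁻¹ ^ 3) * χ (z.re⁻¹ - kap τ z.re⁻¹)
      - z.re⁻¹ ^ 2 * deriv χ (z.re⁻¹ - kap τ z.re⁻¹)) : ℝ) : ℂ)
      * cexp (I * ((kap τ z.re⁻¹ ^ 3 * z.im : ℝ) : ℂ)) := by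
  simp only [FX, FF, if_pos hz, GG]
  push_cast
  linear_combination (-(z.re : ℂ)⁻¹ ^ 0 * cexp (-(z.re : ℂ)⁻¹ ^ 2 / 2) * χ (z.re⁻¹ - kap τ z.re⁻¹)
      * kap τ z.re⁻¹ ^ 3) * cexp (I * (kap τ z.re⁻¹ ^ 3 * z.im)) * I_mul_I

lemma FF_E_bound {χ : ℝ → ℝ} (h : Bmp χ) : ∃ C, 0 < C ∧ ∀ (τ : ℝ) (z : ℂ), 0 < z.re → z.re ≤ 1 →
    ‖FX τ χ 0 0 z + I * (I * FF τ χ 0 3 z)‖ ≤ C * (GG z.re * z.re⁻¹ ^ 2) := by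
  obtain ⟨M, hM0, hM⟩ := h.bdd
  obtain ⟨M', hM0', hM'⟩ := h.deriv.bdd
  refine ⟨7 * M + M' + 1, by positivity, fun τ z hz hz1 => ?_⟩
  rw [FF_E τ χ z hz, norm_mul, norm_cexp_I, mul_one, Complex.norm_real, Real.norm_eq_abs, abs_mul]
  have hG : 0 < GG z.re := Real.exp_pos _
  rw [abs_of_pos hG]
  have hs : 1 ≤ z.re⁻¹ := (one_le_inv₀ hz).2 hz1
  set s := z.re⁻¹
  set k := kap τ s with hk
  have hks := kap_abs τ s
  rw [← hk] at hks
  have h3 : |s ^ 3 - k ^ 3| ≤ 7 * s ^ 2 := by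
    have e : s ^ 3 - k ^ 3 = (s - k) * (s ^ 2 + s * k + k ^ 2) := by ring
    rw [e, abs_mul]
    rw [abs_le] at hks
    have h5 : |s ^ 2 + s * k + k ^ 2| ≤ 7 * s ^ 2 := by
      rw [abs_le]; constructor <;> nlinarith
    calc |s - k| * |s ^ 2 + s * k + k ^ 2| ≤ 1 * (7 * s ^ 2) := by
          gcongr; exact abs_le.2 hks
      _ = _ := one_mul _
  calc GG z.re * |(s ^ 3 - k ^ 3) * χ (s - k) - s ^ 2 * deriv χ (s - k)|
      ≤ GG z.re * (|s ^ 3 - k ^ 3| * |χ (s - k)| + s ^ 2 * |deriv χ (s - k)|) := by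
        gcongr
        refine (abs_sub _ _).trans ?_
        rw [abs_mul, abs_mul, abs_of_nonneg (sq_nonneg s)]
    _ ≤ GG z.re * ((7 * s ^ 2) * M + s ^ 2 * M') := by
        gcongr
        · exact hM _
        · exact hM' _
    _ ≤ _ := by nlinarith [mul_pos hG (by positivity : 0 < s ^ 2)]

lemma FF_P_bound {χ : ℝ → ℝ} (h : ∀ t, |t| ≤ 1 / 2 → χ t = 1 ∧ deriv χ t = 0) (z : ℂ) (hz : 0 < z.re)
    (hz1 : z.re ≤ 1) (τ : ℝ) (hτ : |z.re⁻¹ - kap τ z.re⁻¹| ≤ 1 / 2) :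
    GG z.re * z.re⁻¹ ^ 3 ≤ ‖FX τ χ 0 0 z - I * (I * FF τ χ 0 3 z)‖ := by
  rw [FF_P τ χ z hz, norm_mul, norm_cexp_I, mul_one, Complex.norm_real, Real.norm_eq_abs]
  have hG : 0 < GG z.re := Real.exp_pos _
  rw [(h _ hτ).1, (h _ hτ).2]
  have hs : 1 ≤ z.re⁻¹ := (one_le_inv₀ hz).2 hz1
  set s := z.re⁻¹
  set k := kap τ s with hk
  rw [abs_le] at hτ
  have : 0 ≤ k ^ 3 := pow_nonneg (by linarith) 3
  refine le_trans ?_ (le_abs_self _)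
  gcongr
  linarith

lemma kap_cover (s : ℝ) : |s - kap 0 s| ≤ 1 / 2 ∨ |s - kap 1 s| ≤ 1 / 2 := by
  by_contra hcon
  push Not at hcon
  obtain ⟨h1, h2⟩ := hcon
  have h3 := kap_abs 0 s
  have h4 := kap_abs 1 s
  have h5 : kap 1 s - kap 0 s = 1 + 2 * ((round ((s - 1) / 2) - round ((s - 0) / 2) : ℤ) : ℝ) := by
    unfold kap; push_cast; ring
  set m : ℤ := round ((s - 1) / 2) - round ((s - 0) / 2)
  rw [abs_le] at h3 h4
  have hm1 : (-2 : ℝ) < m := by linarith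
  have hm2 : (m : ℝ) < 1 := by linarith
  have hm1' : -2 < m := by exact_mod_cast hm1
  have hm2' : m < 1 := by exact_mod_cast hm2
  have hm : m = -1 ∨ m = 0 := by omega
  rcases hm with hm | hm <;> rw [hm] at h5 <;> push_cast at h5 <;>
    rcases lt_abs.1 h1 with h1 | h1 <;> rcases lt_abs.1 h2 with h2 | h2 <;> linarith

noncomputable def hh (x : ℝ) : ℝ := expNegInvGlue (x ^ 3)

lemma hh_contDiff : ContDiff ℝ (⊤ : ℕ∞) hh := expNegInvGlue.contDiff.comp (contDiff_id.pow 3)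

lemma hh_pos {x : ℝ} (hx : 0 < x) : 0 < hh x := expNegInvGlue.pos_of_pos (by positivity)

lemma hh_neg {x : ℝ} (hx : x ≤ 0) : hh x = 0 :=
  expNegInvGlue.zero_of_nonpos (by nlinarith [sq_nonneg x, mul_nonneg (sq_nonneg x) (neg_nonneg.2 hx)])

lemma hh_eq {x : ℝ} (hx : 0 < x) : hh x = Real.exp (-(x⁻¹ ^ 3)) := by
  have : ¬ x ^ 3 ≤ 0 := not_le.2 (by positivity)
  simp [hh, expNegInvGlue, this]

lemma hh_inj {x y : ℝ} (hx : 0 < x) (hy : 0 < y) (h : hh x = hh y) : x = y := by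
  rw [hh_eq hx, hh_eq hy] at h
  have h := Real.exp_injective h
  have h1 : x⁻¹ ^ 3 = y⁻¹ ^ 3 := by linarith
  have := (pow_left_inj₀ (inv_pos.2 hx).le (inv_pos.2 hy).le (by norm_num)).1 h1
  exact inv_injective this

lemma hh_deriv {x : ℝ} (hx : 0 < x) : HasDerivAt hh (3 * x⁻¹ ^ 4 * hh x) x := by
  have hev : hh =ᶠ[𝓝 x] fun x => Real.exp (-(x⁻¹ ^ 3)) := by
    filter_upwards [lt_mem_nhds hx] with y hy using hh_eq hy
  refine HasDerivAt.congr_of_eventuallyEq ?_ hev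
  rw [hh_eq hx]
  have := (((hasDerivAt_inv hx.ne').pow 3).neg).exp
  refine this.congr_deriv ?_
  simp; ring

lemma hh_bound {x : ℝ} (hx : 0 < x) (hx1 : x ≤ 1) : x⁻¹ ^ 4 * hh x ≤ 2 * (GG x * x⁻¹ ^ 2) := by
  rw [hh_eq hx, GG]
  have hs : 1 ≤ x⁻¹ := (one_le_inv₀ hx).2 hx1
  set s := x⁻¹
  have h1 : s ^ 2 ≤ 2 * Real.exp (s ^ 3 - s ^ 2 / 2) := by
    have := Real.add_one_le_exp (s ^ 3 - s ^ 2 / 2)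
    nlinarith [mul_nonneg (sq_nonneg s) (sub_nonneg.2 hs)]
  have h2 : Real.exp (-s ^ 2 / 2) = Real.exp (s ^ 3 - s ^ 2 / 2) * Real.exp (-s ^ 3) := by
    rw [← Real.exp_add]; congr 1; ring
  rw [h2]
  have h3 := Real.exp_pos (-s ^ 3)
  have : 0 ≤ s ^ 2 * Real.exp (-s ^ 3) := by positivity
  nlinarith [mul_le_mul_of_nonneg_right h1 this]

noncomputable def u0 (z : ℂ) : ℂ := (hh z.re : ℂ) * (1 + I * z.im)

lemma u0_contDiff : ContDiff ℝ (⊤ : ℕ∞) u0 := by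
  have h1 : ContDiff ℝ (⊤ : ℕ∞) (fun z : ℂ => ((hh z.re : ℝ) : ℂ)) :=
    ofRealCLM.contDiff.comp (hh_contDiff.comp reCLM.contDiff)
  have h2 : ContDiff ℝ (⊤ : ℕ∞) (fun z : ℂ => ((z.im : ℝ) : ℂ)) :=
    ofRealCLM.contDiff.comp imCLM.contDiff
  exact h1.mul (contDiff_const.add (contDiff_const.mul h2))

lemma u0_hasFDerivAt (z : ℂ) (hz : 0 < z.re) : HasFDerivAt u0
    (mkD (((3 * z.re⁻¹ ^ 4 * hh z.re : ℝ) : ℂ) * (1 + I * z.im)) (I * hh z.re)) z := by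
  have hre : HasFDerivAt (fun w : ℂ => w.re) reCLM z := reCLM.hasFDerivAt
  have him : HasFDerivAt (fun w : ℂ => w.im) imCLM z := imCLM.hasFDerivAt
  have hA : HasFDerivAt (fun w : ℂ => ((hh w.re : ℝ) : ℂ)) _ z :=
    (hh_deriv hz).ofReal_comp.hasFDerivAt.comp z hre
  have hB : HasFDerivAt (fun w : ℂ => (1 + I * (w.im : ℂ))) _ z :=
    ((((hasDerivAt_id z.im).ofReal_comp).const_mul I).const_add 1).hasFDerivAt.comp z him
  refine (hA.mul hB).congr_fderiv ?_
  ext v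
  simp [mkD]
  ring

lemma u0_E_bound (z : ℂ) (hz : 0 < z.re) (hz1 : z.re ≤ 1) (hy : |z.im| ≤ 1) :
    ‖((3 * z.re⁻¹ ^ 4 * hh z.re : ℝ) : ℂ) * (1 + I * z.im) + I * (I * hh z.re)‖
      ≤ 14 * (GG z.re * z.re⁻¹ ^ 2) := by
  have hp := hh_pos hz
  have hs : 1 ≤ z.re⁻¹ := (one_le_inv₀ hz).2 hz1
  have h1 : ‖(1 + I * z.im : ℂ)‖ ≤ 2 := by
    refine (norm_add_le _ _).trans ?_
    simp; linarith
  have h2 : hh z.re ≤ z.re⁻¹ ^ 4 * hh z.re := by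
    have : 1 ≤ z.re⁻¹ ^ 4 := one_le_pow₀ hs
    nlinarith
  have h3 := hh_bound hz hz1
  calc _ ≤ ‖((3 * z.re⁻¹ ^ 4 * hh z.re : ℝ) : ℂ) * (1 + I * z.im)‖ + ‖I * (I * (hh z.re : ℂ))‖ :=
        norm_add_le _ _
    _ ≤ (3 * z.re⁻¹ ^ 4 * hh z.re) * 2 + hh z.re := by
        have e1 : ‖((3 * z.re⁻¹ ^ 4 * hh z.re : ℝ) : ℂ)‖ = 3 * z.re⁻¹ ^ 4 * hh z.re := by
          rw [Complex.norm_real, Real.norm_eq_abs, abs_of_pos (by positivity)]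
        have e2 : ‖I * (I * (hh z.re : ℂ))‖ = hh z.re := by
          simp [abs_of_pos hp]
        rw [norm_mul, e1, e2]
        gcongr
    _ ≤ _ := by linarith

abbrev E4 := EuclideanSpace ℂ (Fin 4)

noncomputable def dP (U : ℂ → E4) (z : ℂ) : E4 := fderiv ℝ U z 1 - I • fderiv ℝ U z I
noncomputable def dE (U : ℂ → E4) (z : ℂ) : E4 := fderiv ℝ U z 1 + I • fderiv ℝ U z I

noncomputable def UU (χ : ℝ → ℝ) (z : ℂ) : E4 :=
  WithLp.toLp 2 ![FF 0 χ 0 0 z, FF 1 χ 0 0 z, u0 z, 0]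

lemma UU_contDiff {χ : ℝ → ℝ} (h : Bmp χ) : ContDiff ℝ (⊤ : ℕ∞) (UU χ) := by
  rw [contDiff_piLp 2]
  intro i
  fin_cases i
  · exact FF_contDiff 0 h 0 0
  · exact FF_contDiff 1 h 0 0
  · exact u0_contDiff
  · exact contDiff_const

lemma fderiv_apply_coord {U : ℂ → E4} {z : ℂ} (h : DifferentiableAt ℝ U z) (i : Fin 4) {D : ℂ →L[ℝ] ℂ}
    (hD : HasFDerivAt (fun w => U w i) D z) (v : ℂ) : (fderiv ℝ U z v) i = D v := by
  have h1 : HasFDerivAt (fun w => U w i) _ z :=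
    ((EuclideanSpace.proj (𝕜 := ℂ) i : E4 →L[ℂ] ℂ).restrictScalars ℝ).hasFDerivAt.comp z h.hasFDerivAt
  rw [hD.unique h1]
  rfl

lemma norm_le_coord (v : E4) (B : ℝ) (h : ∀ i, ‖v i‖ ≤ B) : ‖v‖ ≤ 2 * B := by
  have hB : 0 ≤ B := (norm_nonneg _).trans (h 0)
  have : ‖v‖ ^ 2 ≤ (2 * B) ^ 2 := by
    rw [EuclideanSpace.norm_sq_eq]
    calc ∑ i, ‖v i‖ ^ 2 ≤ ∑ _i : Fin 4, B ^ 2 := by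
          gcongr with i; exact h i
      _ = _ := by simp; ring
  exact (pow_le_pow_iff_left₀ (norm_nonneg _) (by positivity) (by norm_num)).1 this

lemma UU_key {χ : ℝ → ℝ} (h : Bmp χ) (h' : ∀ t, |t| ≤ 1 / 2 → χ t = 1 ∧ deriv χ t = 0)
    (ε : ℝ) (hε : 0 < ε) : ∃ δ, 0 < δ ∧ ∀ z : ℂ, 0 < z.re → z.re < δ → |z.im| ≤ 1 →
      ‖dE (UU χ) z‖ ≤ ε * ‖dP (UU χ) z‖ ∧ dP (UU χ) z ≠ 0 := by
  obtain ⟨C, hC, hCb⟩ := FF_E_bound h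
  refine ⟨min 1 (ε / (2 * (C + 14))), by positivity, fun z hz hzd hy => ?_⟩
  have hz1 : z.re ≤ 1 := (hzd.trans_le (min_le_left _ _)).le
  have hz2 : z.re < ε / (2 * (C + 14)) := hzd.trans_le (min_le_right _ _)
  have hd : DifferentiableAt ℝ (UU χ) z := ((UU_contDiff h).differentiable (by simp)).differentiableAt
  have c0 := fun v => fderiv_apply_coord hd 0 (FF_hasFDerivAt 0 h 0 0 z) v
  have c1 := fun v => fderiv_apply_coord hd 1 (FF_hasFDerivAt 1 h 0 0 z) v
  have c2 := fun v => fderiv_apply_coord hd 2 (u0_hasFDerivAt z hz) v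
  have c3 := fun v => fderiv_apply_coord hd 3 (hasFDerivAt_const (0 : ℂ) z) v
  have hG : 0 < GG z.re := Real.exp_pos _
  have hs : 0 < z.re⁻¹ := inv_pos.2 hz
  have hGs : 0 < GG z.re * z.re⁻¹ ^ 2 := by positivity
  have hE : ‖dE (UU χ) z‖ ≤ 2 * ((C + 14) * (GG z.re * z.re⁻¹ ^ 2)) := by
    apply norm_le_coord
    intro i
    fin_cases i
    · have := hCb 0 z hz hz1
      have e : dE (UU χ) z 0 = FX 0 χ 0 0 z + I * (I * FF 0 χ 0 3 z) := by
        simp [dE, c0, mkD]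
      change ‖dE (UU χ) z 0‖ ≤ _
      rw [e]; linarith
    · have := hCb 1 z hz hz1
      have e : dE (UU χ) z 1 = FX 1 χ 0 0 z + I * (I * FF 1 χ 0 3 z) := by
        simp [dE, c1, mkD]
      change ‖dE (UU χ) z 1‖ ≤ _
      rw [e]; linarith
    · have := u0_E_bound z hz hz1 hy
      have e : dE (UU χ) z 2 = ((3 * z.re⁻¹ ^ 4 * hh z.re : ℝ) : ℂ) * (1 + I * z.im) + I * (I * hh z.re) := by
        simp [dE, c2, mkD]
      change ‖dE (UU χ) z 2‖ ≤ _
      rw [e]; nlinarith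
    · have e : dE (UU χ) z 3 = 0 := by
        simp [dE, c3]
      change ‖dE (UU χ) z 3‖ ≤ _
      rw [e]; simp; positivity
  have hP : GG z.re * z.re⁻¹ ^ 3 ≤ ‖dP (UU χ) z‖ := by
    rcases kap_cover z.re⁻¹ with hk | hk
    · have e : dP (UU χ) z 0 = FX 0 χ 0 0 z - I * (I * FF 0 χ 0 3 z) := by
        simp [dP, c0, mkD]
      refine (FF_P_bound h' z hz hz1 0 hk).trans ?_
      rw [← e]; exact PiLp.norm_apply_le _ _
    · have e : dP (UU χ) z 1 = FX 1 χ 0 0 z - I * (I * FF 1 χ 0 3 z) := by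
        simp [dP, c1, mkD]
      refine (FF_P_bound h' z hz hz1 1 hk).trans ?_
      rw [← e]; exact PiLp.norm_apply_le _ _
  constructor
  · refine hE.trans (le_trans ?_ (mul_le_mul_of_nonneg_left hP hε.le))
    rw [lt_div_iff₀ (by positivity)] at hz2
    have h5 : 2 * (C + 14) ≤ ε * z.re⁻¹ := by
      rw [← div_eq_mul_inv, le_div_iff₀ hz]; linarith
    calc 2 * ((C + 14) * (GG z.re * z.re⁻¹ ^ 2)) = (2 * (C + 14)) * (GG z.re * z.re⁻¹ ^ 2) := by ring
      _ ≤ (ε * z.re⁻¹) * (GG z.re * z.re⁻¹ ^ 2) := by gcongr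
      _ = _ := by ring
  · intro h0
    rw [h0, norm_zero] at hP
    have : 0 < GG z.re * z.re⁻¹ ^ 3 := by positivity
    linarith

lemma UU_neg (χ : ℝ → ℝ) (z : ℂ) (hz : z.re ≤ 0) : UU χ z = 0 := by
  ext i
  fin_cases i <;> simp [UU, FF_neg _ _ _ _ z hz, u0, hh_neg hz]

lemma UU_inj (χ : ℝ → ℝ) (z w : ℂ) (hz : 0 < z.re) (h : UU χ z = UU χ w) : z = w := by
  have h2 : u0 z = u0 w := by
    have := congrArg (fun v : E4 => v 2) h
    simpa [UU] using this
  have hr := congrArg Complex.re h2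
  have hi := congrArg Complex.im h2
  simp only [u0, Complex.mul_re, Complex.mul_im, Complex.add_re, Complex.add_im, Complex.ofReal_re,
    Complex.ofReal_im, Complex.one_re, Complex.one_im, Complex.I_re, Complex.I_im] at hr hi
  ring_nf at hr hi
  have hp := hh_pos hz
  have hw : 0 < w.re := by
    by_contra hw
    rw [hh_neg (not_lt.1 hw)] at hr
    linarith
  rw [← hr] at hi
  exact Complex.ext (hh_inj hz hw hr) (mul_left_cancel₀ hp.ne' hi)

lemma UU_flat {χ : ℝ → ℝ} (h : Bmp χ) (N : ℕ) : (fun z : ℂ => ‖UU χ z‖) =O[𝓝 (0 : ℂ)] fun z : ℂ => ‖z‖ ^ N := by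
  obtain ⟨C0, hC0, hb0⟩ := FF_bdd 0 h (0 + N) 0
  obtain ⟨C1, hC1, hb1⟩ := FF_bdd 1 h (0 + N) 0
  have hF : ∀ (τ C : ℝ), (∀ z, ‖FF τ χ (0 + N) 0 z‖ ≤ C) → ∀ z, ‖FF τ χ 0 0 z‖ ≤ C * ‖z‖ ^ N := by
    intro τ C hb z
    have hC := (norm_nonneg _).trans (hb 0)
    rw [FF_shift τ χ 0 0 N z, norm_mul, mul_comm]
    gcongr
    · exact hb z
    · rw [Complex.norm_real, norm_pow]
      gcongr
      exact Complex.abs_re_le_norm z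
  have hh0 : ∀ z : ℂ, ‖z‖ ≤ 1 → ‖u0 z‖ ≤ (2 * N.factorial) * ‖z‖ ^ N := by
    intro z hz
    by_cases hr : 0 < z.re
    · have h1 : ‖(1 + I * z.im : ℂ)‖ ≤ 2 := by
        refine (norm_add_le _ _).trans ?_
        have := Complex.abs_im_le_norm z
        simp; linarith
      have hp := hh_pos hr
      have hrz : z.re ≤ ‖z‖ := Complex.re_le_norm z
      have h2 : hh z.re ≤ N.factorial * ‖z‖ ^ N := by
        rw [hh_eq hr, Real.exp_neg]
        have := Real.pow_div_factorial_le_exp (z.re⁻¹ ^ 3) (by positivity) N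
        calc (Real.exp (z.re⁻¹ ^ 3))⁻¹ ≤ ((z.re⁻¹ ^ 3) ^ N / N.factorial)⁻¹ := by
              gcongr
          _ = N.factorial * (z.re ^ 3) ^ N := by
              rw [inv_div, inv_pow, inv_pow, div_inv_eq_mul]
          _ ≤ _ := by
              gcongr
              calc z.re ^ 3 ≤ z.re ^ 1 := pow_le_pow_of_le_one hr.le (hrz.trans hz) (by norm_num)
                _ ≤ _ := by simpa using hrz
      rw [u0, norm_mul, Complex.norm_real, Real.norm_eq_abs, abs_of_pos hp]
      calc hh z.re * ‖(1 + I * z.im : ℂ)‖ ≤ (N.factorial * ‖z‖ ^ N) * 2 := by gcongr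
        _ = _ := by ring
    · rw [u0, hh_neg (not_lt.1 hr)]; simp; positivity
  refine IsBigO.of_bound (2 * (C0 + C1 + 2 * N.factorial)) ?_
  filter_upwards [Metric.closedBall_mem_nhds (0 : ℂ) one_pos] with z hz
  have hz : ‖z‖ ≤ 1 := by simpa using hz
  rw [norm_norm, norm_pow, norm_norm, mul_assoc]
  apply norm_le_coord
  have hzN : 0 ≤ ‖z‖ ^ N := by positivity
  have hf : (0 : ℝ) ≤ 2 * N.factorial := by positivity
  intro i
  fin_cases i
  · change ‖FF 0 χ 0 0 z‖ ≤ _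
    refine (hF 0 C0 hb0 z).trans ?_
    gcongr; linarith
  · change ‖FF 1 χ 0 0 z‖ ≤ _
    refine (hF 1 C1 hb1 z).trans ?_
    gcongr; linarith
  · change ‖u0 z‖ ≤ _
    refine (hh0 z hz).trans ?_
    gcongr; linarith
  · change ‖(0 : ℂ)‖ ≤ _
    simp; positivity

/-- factor a continuous map on a compact set through another and extend -/
lemma factor_extend {K : Set ℂ} (hK : IsCompact K) {U : ℂ → E4} (hU : Continuous U)
    {Q : ℂ → (E4 →L[ℝ] E4)} (hQ : ContinuousOn Q K)
    (hfib : ∀ z ∈ K, ∀ w ∈ K, U z = U w → Q z = Q w) :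
    ∃ G : E4 → (E4 →L[ℝ] E4), Continuous G ∧ ∀ z ∈ K, G (U z) = Q z := by
  have : CompactSpace K := isCompact_iff_compactSpace.1 hK
  let S : Set E4 := U '' K
  have hS : IsClosed S := (hK.image hU).isClosed
  let f : K → S := fun z => ⟨U z, z, z.2, rfl⟩
  have hf : Continuous f := (hU.comp continuous_subtype_val).subtype_mk _
  have hsurj : Function.Surjective f := by
    rintro ⟨_, z, hz, rfl⟩; exact ⟨⟨z, hz⟩, rfl⟩
  have hq : IsQuotientMap (⟨f, hf⟩ : C(K, S)) := hf.isClosedMap.isQuotientMap hf hsurj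
  let g : C(K, E4 →L[ℝ] E4) := ⟨fun z => Q z, hQ.domRestrict⟩
  have hg : Function.FactorsThrough g (⟨f, hf⟩ : C(K, S)) := by
    intro a b hab
    exact hfib a a.2 b b.2 (congrArg Subtype.val hab)
  let G0 := hq.lift g hg
  obtain ⟨G, hG⟩ := ContinuousMap.exists_restrict_eq hS G0
  refine ⟨G, G.continuous, fun z hz => ?_⟩
  have h1 : G0 (f ⟨z, hz⟩) = g ⟨z, hz⟩ := by
    have := hq.lift_comp g hg
    exact congrArg (fun F : C(K, E4 →L[ℝ] E4) => F ⟨z, hz⟩) this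
  have h2 : G (U z) = G0 (f ⟨z, hz⟩) := by rw [← hG]; rfl
  rw [h2, h1]; rfl

/-- rank-one antilinear operator sending `f` to `e` -/
noncomputable def rk (e f : E4) : E4 →L[ℝ] E4 :=
  ((innerSL ℝ f).smulRight e + (innerSL ℝ (I • f)).smulRight (-(I • e)))

lemma inner_If (f : E4) : inner ℝ (I • f) f = (0 : ℝ) := by
  simp [PiLp.inner_apply, Complex.inner]
  rw [← Finset.sum_sub_distrib]
  refine Finset.sum_eq_zero fun i _ => ?_
  ring

lemma rk_apply_self (e f : E4) : rk e f f = (‖f‖ ^ 2 : ℝ) • e := by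
  simp [rk, inner_If]

lemma rk_apply_I (e f : E4) : rk e f (I • f) = -((‖f‖ ^ 2 : ℝ) • (I • e)) := by
  have h : inner ℝ f (I • f) = (0 : ℝ) := by rw [real_inner_comm]; exact inner_If f
  simp [rk, h, norm_smul]

lemma rk_norm (e f : E4) : ‖rk e f‖ ≤ 2 * (‖e‖ * ‖f‖) := by
  refine (norm_add_le _ _).trans ?_
  rw [ContinuousLinearMap.norm_smulRight_apply, ContinuousLinearMap.norm_smulRight_apply,
    innerSL_apply_norm, innerSL_apply_norm, norm_neg, norm_smul, norm_smul]
  simp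
  linarith

lemma rk_cont {X : Type*} [TopologicalSpace X] {e f : X → E4} {x : X} (he : ContinuousAt e x)
    (hf : ContinuousAt f x) : ContinuousAt (fun x => rk (e x) (f x)) x := by
  unfold rk
  have h1 : Continuous fun p : E4 × E4 => (innerSL ℝ p.2).smulRight p.1 +
      (innerSL ℝ (I • p.2)).smulRight (-(I • p.1)) := by
    fun_prop
  exact h1.continuousAt.comp (f := fun x => (e x, f x)) (he.prodMk hf)

noncomputable def J0 : E4 →L[ℝ] E4 := (I • ContinuousLinearMap.id ℂ E4).restrictScalars ℝ

lemma J0_apply (v : E4) : J0 v = I • v := rfl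

noncomputable def trunc (Q : E4 →L[ℝ] E4) : E4 →L[ℝ] E4 := (max 1 (2 * ‖Q‖))⁻¹ • Q

lemma trunc_norm (Q : E4 →L[ℝ] E4) : ‖trunc Q‖ < 1 := by
  have hp : 0 < max 1 (2 * ‖Q‖) := lt_max_of_lt_left one_pos
  rw [trunc, norm_smul, norm_inv, Real.norm_eq_abs, abs_of_pos hp, inv_mul_lt_iff₀ hp, mul_one]
  rcases le_or_gt ‖Q‖ (1 / 2) with h | h
  · exact lt_max_of_lt_left (by linarith)
  · exact lt_max_of_lt_right (by linarith)

lemma trunc_eq (Q : E4 →L[ℝ] E4) (h : ‖Q‖ ≤ 1 / 2) : trunc Q = Q := by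
  rw [trunc, max_eq_left (by linarith)]; simp

lemma trunc_cont : Continuous trunc := by
  unfold trunc
  refine Continuous.smul (f := fun Q : E4 →L[ℝ] E4 => (max 1 (2 * ‖Q‖))⁻¹) (Continuous.inv₀ (f := fun Q : E4 →L[ℝ] E4 => max 1 (2 * ‖Q‖)) (by fun_prop) ?_) continuous_id
  intro Q
  exact (lt_max_of_lt_left one_pos).ne'

noncomputable def mkJ (Q : E4 →L[ℝ] E4) : E4 →L[ℝ] E4 :=
  (1 + trunc Q) * J0 * Ring.inverse (1 + trunc Q)

lemma isUnit_one_add_trunc (Q : E4 →L[ℝ] E4) : IsUnit (1 + trunc Q) := by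
  have : ‖-trunc Q‖ < 1 := by rw [norm_neg]; exact trunc_norm Q
  have h := isUnit_one_sub_of_norm_lt_one this
  simpa using h

lemma mkJ_cont : Continuous mkJ := by
  unfold mkJ
  have h1 : Continuous fun Q => 1 + trunc Q := continuous_const.add trunc_cont
  refine (h1.mul continuous_const).mul ?_
  rw [continuous_iff_continuousAt]
  intro Q
  obtain ⟨u, hu⟩ := isUnit_one_add_trunc Q
  have := NormedRing.inverse_continuousAt u
  rw [hu] at this
  exact ContinuousAt.comp (f := fun Q => 1 + trunc Q) this h1.continuousAt

lemma mkJ_sq (Q : E4 →L[ℝ] E4) (x : E4) : mkJ Q (mkJ Q x) = -x := by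
  have h1 := Ring.inverse_mul_cancel _ (isUnit_one_add_trunc Q)
  have h2 := Ring.mul_inverse_cancel _ (isUnit_one_add_trunc Q)
  have hJ : J0 * J0 = -1 := by
    ext1 v
    simp [J0_apply, smul_smul]
  have : mkJ Q * mkJ Q = -1 := by
    unfold mkJ
    set A := 1 + trunc Q
    calc A * J0 * Ring.inverse A * (A * J0 * Ring.inverse A)
        = A * J0 * (Ring.inverse A * A) * J0 * Ring.inverse A := by noncomm_ring
      _ = A * (J0 * J0) * Ring.inverse A := by rw [h1]; noncomm_ring
      _ = -(A * Ring.inverse A) := by rw [hJ]; ext1 v; exact map_neg A (Ring.inverse A v)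
      _ = -1 := by rw [h2]
  calc mkJ Q (mkJ Q x) = (mkJ Q * mkJ Q) x := rfl
    _ = -x := by rw [this]; simp

/-- action of `mkJ` on the tangent vector -/
lemma mkJ_apply (Q : E4 →L[ℝ] E4) (hQ : ‖Q‖ ≤ 1 / 2) (p e : E4) (h1 : Q p = e) (h2 : Q (I • p) = -(I • e)) :
    mkJ Q (p + e) = I • p - I • e := by
  have h := Ring.inverse_mul_cancel _ (isUnit_one_add_trunc Q)
  have h3 : (1 + trunc Q) p = p + e := by rw [trunc_eq Q hQ]; simp [h1]
  have h4 : Ring.inverse (1 + trunc Q) (p + e) = p := by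
    rw [← h3]
    calc _ = (Ring.inverse (1 + trunc Q) * (1 + trunc Q)) p := rfl
      _ = p := by rw [h]; rfl
  calc mkJ Q (p + e) = (1 + trunc Q) (J0 (Ring.inverse (1 + trunc Q) (p + e))) := rfl
    _ = I • p - I • e := by
      rw [h4, J0_apply, trunc_eq Q hQ]
      simp [h2, sub_eq_add_neg]

noncomputable def QQ (U : ℂ → E4) (z : ℂ) : E4 →L[ℝ] E4 :=
  if 0 < z.re then (‖dP U z‖ ^ 2)⁻¹ • rk (dE U z) (dP U z) else 0

lemma QQ_norm (U : ℂ → E4) (z : ℂ) (ε : ℝ) (hε : 0 ≤ ε)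
    (h : 0 < z.re → ‖dE U z‖ ≤ ε * ‖dP U z‖ ∧ dP U z ≠ 0) : ‖QQ U z‖ ≤ 2 * ε := by
  unfold QQ
  split_ifs with hz
  · obtain ⟨h1, h2⟩ := h hz
    have hp : 0 < ‖dP U z‖ := norm_pos_iff.2 h2
    rw [norm_smul, norm_inv, norm_pow, norm_norm, inv_mul_le_iff₀ (by positivity)]
    refine (rk_norm _ _).trans ?_
    nlinarith [mul_le_mul_of_nonneg_right h1 hp.le]
  · simpa using hε

lemma main_exists {U : ℂ → E4} (hU : ContDiff ℝ (⊤ : ℕ∞) U)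
    (hneg : ∀ z : ℂ, z.re ≤ 0 → U z = 0)
    (hinj : ∀ z w : ℂ, 0 < z.re → U z = U w → z = w)
    (hkey : ∀ ε : ℝ, 0 < ε → ∃ δ, 0 < δ ∧ ∀ z : ℂ, 0 < z.re → z.re < δ → |z.im| ≤ 1 →
      ‖dE U z‖ ≤ ε * ‖dP U z‖ ∧ dP U z ≠ 0) :
    ∃ (δ : ℝ) (J : E4 → (E4 →L[ℝ] E4)), 0 < δ ∧ Continuous J ∧ (∀ p x, J p (J p x) = -x) ∧
      ∀ z : ℂ, ‖z‖ ≤ δ → fderiv ℝ U z I = J (U z) (fderiv ℝ U z 1) := by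
  obtain ⟨δ₀, hδ₀, hk⟩ := hkey (1 / 4) (by norm_num)
  set δ := min (δ₀ / 2) (1 / 2) with hδ
  have hδp : 0 < δ := by positivity
  have hre : ∀ z : ℂ, ‖z‖ ≤ δ → z.re < δ₀ ∧ |z.im| < 1 := by
    intro z hz
    have h1 := Complex.re_le_norm z
    have h2 := Complex.abs_im_le_norm z
    have h3 := min_le_left (δ₀ / 2) (1 / 2)
    have h4 := min_le_right (δ₀ / 2) (1 / 2)
    constructor <;> linarith
  have hcf : Continuous (fderiv ℝ U) := hU.continuous_fderiv (by simp)
  have hc1 : Continuous (dP U) := by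
    unfold dP; fun_prop
  have hc2 : Continuous (dE U) := by
    unfold dE; fun_prop
  have hK : IsCompact (closedBall (0 : ℂ) δ) := isCompact_closedBall _ _
  have hQc : ContinuousOn (QQ U) (closedBall (0 : ℂ) δ) := by
    intro z hz
    have hz : ‖z‖ ≤ δ := by simpa using hz
    obtain ⟨hz1, hz2⟩ := hre z hz
    apply ContinuousAt.continuousWithinAt
    by_cases hp : 0 < z.re
    · have hne := (hk z hp hz1 hz2.le).2
      have hev : QQ U =ᶠ[𝓝 z] fun z => (‖dP U z‖ ^ 2)⁻¹ • rk (dE U z) (dP U z) := by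
        filter_upwards [Complex.continuous_re.continuousAt.eventually (lt_mem_nhds hp)] with w hw
        simp [QQ, hw]
      refine ContinuousAt.congr ?_ hev.symm
      refine ContinuousAt.smul (f := fun z => (‖dP U z‖ ^ 2)⁻¹) ?_ (rk_cont hc2.continuousAt hc1.continuousAt)
      exact ContinuousAt.inv₀ (f := fun z => ‖dP U z‖ ^ 2) (by fun_prop) (by simpa using hne)
    · have h0 : QQ U z = 0 := by simp [QQ, hp]
      rw [ContinuousAt, h0, tendsto_zero_iff_norm_tendsto_zero, Metric.tendsto_nhds]
      intro ε hε
      obtain ⟨d, hd, hkd⟩ := hkey (ε / 4) (by positivity)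
      have hzd : z.re < d := by linarith [not_lt.1 hp]
      filter_upwards [Complex.continuous_re.continuousAt.eventually (gt_mem_nhds hzd),
        (Complex.continuous_im.abs).continuousAt.eventually (gt_mem_nhds hz2)] with w hw1 hw2
      have := QQ_norm U w (ε / 4) (by positivity) (fun hw => hkd w hw hw1 (le_of_lt hw2))
      rw [Real.dist_eq, sub_zero, abs_of_nonneg (norm_nonneg _)]
      linarith
  have hfib : ∀ z ∈ closedBall (0 : ℂ) δ, ∀ w ∈ closedBall (0 : ℂ) δ, U z = U w → QQ U z = QQ U w := by
    intro z _ w _ h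
    by_cases hz : 0 < z.re
    · rw [hinj z w hz h]
    by_cases hw : 0 < w.re
    · rw [hinj w z hw h.symm]
    simp [QQ, hz, hw]
  obtain ⟨G, hG, hGU⟩ := factor_extend hK hU.continuous hQc hfib
  refine ⟨δ, fun p => mkJ (G p), hδp, mkJ_cont.comp hG, fun p x => mkJ_sq _ _, ?_⟩
  intro z hz
  have hGz := hGU z (by simpa using hz)
  obtain ⟨hz1, hz2⟩ := hre z hz
  have hQn : ‖QQ U z‖ ≤ 1 / 2 := by
    have := QQ_norm U z (1 / 4) (by norm_num) (fun h => hk z h hz1 hz2.le)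
    linarith
  simp only [hGz]
  -- the tangent vectors
  set a := fderiv ℝ U z 1 with ha
  set b := fderiv ℝ U z I with hb
  have hII : ∀ v : E4, I • I • v = -v := fun v => by simp [smul_smul]
  have hQ1 : QQ U z (dP U z) = dE U z ∧ QQ U z (I • dP U z) = -(I • dE U z) := by
    by_cases hp : 0 < z.re
    · have hne := (hk z hp hz1 hz2.le).2
      have hn : ‖dP U z‖ ^ 2 ≠ 0 := by simpa using hne
      simp only [QQ, if_pos hp, smul_apply, rk_apply_self, rk_apply_I]
      constructor
      · rw [smul_smul, inv_mul_cancel₀ hn, one_smul]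
      · rw [smul_neg, smul_smul, inv_mul_cancel₀ hn, one_smul]
    · -- derivative vanishes
      have hE0 : dE U z = 0 := by
        have hlt : ∀ w : ℂ, w.re < 0 → dE U w = 0 := by
          intro w hw
          have hev : U =ᶠ[𝓝 w] fun _ => 0 := by
            filter_upwards [Complex.continuous_re.continuousAt.eventually (gt_mem_nhds hw)] with v hv
            exact hneg v (le_of_lt hv)
          have : fderiv ℝ U w = 0 := by rw [hev.fderiv_eq]; simp
          simp [dE, this]
        have hl : Tendsto (fun t : ℝ => dE U (z - t)) (𝓝[>] 0) (𝓝 (dE U (z - (0 : ℝ)))) := by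
          have : Continuous (fun t : ℝ => dE U (z - t)) := by fun_prop
          exact (this.tendsto 0).mono_left nhdsWithin_le_nhds
        rw [Complex.ofReal_zero, sub_zero] at hl
        refine tendsto_nhds_unique hl (tendsto_const_nhds.congr' ?_)
        filter_upwards [self_mem_nhdsWithin] with t ht
        have ht : 0 < t := ht
        symm
        apply hlt
        simp
        linarith [not_lt.1 hp]
      simp [QQ, hp, hE0]
  have := mkJ_apply _ hQn _ _ hQ1.1 hQ1.2
  have e1 : dP U z + dE U z = (2 : ℝ) • a := by
    simp only [dP, dE, ← ha, ← hb, two_smul]; abel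
  have e2 : I • dP U z - I • dE U z = (2 : ℝ) • b := by
    simp only [dP, dE, ← ha, ← hb, smul_sub, smul_add, hII, two_smul]; abel
  rw [e1, e2, map_smul] at this
  exact (smul_right_injective E4 (two_ne_zero (α := ℝ)) this).symm

lemma acs_aux {U : ℂ → E4} (z : ℂ) (δ : ℝ) (v : ℂ) :
    fderiv ℝ (fun w : ℂ => U (δ • w)) z v = δ • fderiv ℝ U (δ • z) v := by
  rw [fderiv_comp_smul]; rfl

theorem continuous_acs_flat_disc :
    ∃ (J : EuclideanSpace ℂ (Fin 4) →
        (EuclideanSpace ℂ (Fin 4) →L[ℝ] EuclideanSpace ℂ (Fin 4)))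
      (U : ℂ → EuclideanSpace ℂ (Fin 4)),
      Continuous J ∧
      (∀ p x, J p (J p x) = -x) ∧
      ContDiffOn ℝ (⊤ : ℕ∞) U (ball (0 : ℂ) 1) ∧
      (∀ z ∈ ball (0 : ℂ) 1,
        fderiv ℝ U z Complex.I = J (U z) (fderiv ℝ U z 1)) ∧
      (∀ N : ℕ, 0 < N →
        (fun z : ℂ => ‖U z‖) =O[𝓝 (0 : ℂ)] fun z : ℂ => ‖z‖ ^ N) ∧
      AccPt (0 : ℂ) (𝓟 {z : ℂ | z ∈ ball (0 : ℂ) 1 ∧ z ≠ 0 ∧ U z = 0}) ∧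
      (∀ V ∈ 𝓝 (0 : ℂ), ∃ z ∈ V, U z ≠ 0) := by
  obtain ⟨χ, hχ, hχ'⟩ := exists_bump
  have hU := UU_contDiff hχ
  obtain ⟨δ, J, hδ, hJ, hJ2, hJU⟩ := main_exists hU (UU_neg χ) (UU_inj χ) (UU_key hχ hχ')
  have hlin : ContDiff ℝ (⊤ : ℕ∞) (fun w : ℂ => δ • w) := contDiff_id.const_smul δ
  refine ⟨J, fun z => UU χ (δ • z), hJ, hJ2, (hU.comp hlin).contDiffOn, ?_, ?_, ?_, ?_⟩
  · intro z hz
    have hz : ‖z‖ < 1 := by simpa using hz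
    rw [acs_aux z δ, acs_aux z δ, map_smul,
      hJU (δ • z)]
    rw [norm_smul, Real.norm_eq_abs, abs_of_pos hδ]
    nlinarith
  · intro N _
    have ht : Tendsto (fun w : ℂ => δ • w) (𝓝 0) (𝓝 0) := by
      simpa using hlin.continuous.tendsto 0
    have h1 := (UU_flat hχ N).comp_tendsto ht
    refine h1.trans ?_
    refine IsBigO.of_bound (δ ^ N) (Eventually.of_forall fun z => ?_)
    simp [norm_smul, mul_pow, abs_of_pos hδ]
  · rw [accPt_iff_frequently]
    have ht : Tendsto (fun t : ℝ => (-t : ℂ)) (𝓝[>] 0) (𝓝 0) := by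
      have : Continuous (fun t : ℝ => (-t : ℂ)) := by fun_prop
      simpa using (this.tendsto 0).mono_left nhdsWithin_le_nhds
    refine ht.frequently (Eventually.frequently ?_)
    filter_upwards [Ioo_mem_nhdsGT (zero_lt_one' ℝ)] with t ht
    have h0 : (-t : ℂ) ≠ 0 := by simpa using ht.1.ne'
    refine ⟨h0, ?_, h0, ?_⟩
    · simpa [abs_of_pos ht.1] using ht.2
    · apply UU_neg
      simp
      exact (mul_pos hδ ht.1).le
  · intro V hV
    have ht : Tendsto (fun t : ℝ => (t : ℂ)) (𝓝[>] 0) (𝓝 0) := by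
      have : Continuous (fun t : ℝ => (t : ℂ)) := by fun_prop
      simpa using (this.tendsto 0).mono_left nhdsWithin_le_nhds
    obtain ⟨t, htV, ht0⟩ := ((ht.eventually hV).and self_mem_nhdsWithin).exists
    refine ⟨t, htV, fun h => ?_⟩
    have ht0 : 0 < t := ht0
    have hp : 0 < (δ • (t : ℂ)).re := by simpa using mul_pos hδ ht0
    have := UU_inj χ (δ • (t : ℂ)) 0 hp (h.trans (UU_neg χ 0 (by simp)).symm)
    rw [this] at hp
    simp at hp
end
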